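/- arXiv:2603.14548 — 4 statements merged into one kernel-verified Lean document; each statement's English description precedes it below -/
import Mathlib

section
/- The series S = ∑_{n=1}^∞ (1/n)·((2 + sin n)/3)^n converges (here sin n denotes the real sine of the integer n, in radians). -/
/-- The `k`-th term of the Taylor series of `sin π`. -/
noncomputable def sinPiTerm (k : ℕ) : ℝ :=
  (-1) ^ k * Real.pi ^ (2 * k + 1) / (2 * k + 1).factorial

/-- The sum `∑_{i ≥ 0} (i choose n) (-1)^(m+i) π^(2(m+i)+1) / (2(m+i)+1)!`. -/
noncomputable def binomSinTail (m n : ℕ) : ℝ :=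
  ∑' i : ℕ, (i.choose n : ℝ) * sinPiTerm (m + i)

lemma pi_sq_mul_sinPiTerm (k : ℕ) :
    Real.pi ^ 2 * sinPiTerm k = -((2 * k + 3) * (2 * k + 2)) * sinPiTerm (k + 1) := by
  have h : ((2 * (k + 1) + 1).factorial : ℝ)
      = (2 * k + 3) * (2 * k + 2) * (2 * k + 1).factorial := by
    rw [show 2 * (k + 1) + 1 = 2 * k + 1 + 1 + 1 by ring, Nat.factorial_succ, Nat.factorial_succ]
    push_cast; ring
  have h0 : ((2 * k + 1).factorial : ℝ) ≠ 0 := by positivity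
  rw [sinPiTerm, sinPiTerm, h]
  field_simp
  ring

lemma abs_sinPiTerm (k : ℕ) :
    |sinPiTerm k| = Real.pi ^ (2 * k + 1) / (2 * k + 1).factorial := by
  have := Real.pi_pos
  rw [sinPiTerm, abs_div, abs_mul, abs_pow, abs_neg, abs_one, one_pow, one_mul,
    abs_of_pos (by positivity), abs_of_pos (by positivity)]

lemma abs_sinPiTerm_succ (k : ℕ) :
    |sinPiTerm (k + 1)| = Real.pi ^ 2 / ((2 * k + 3) * (2 * k + 2)) * |sinPiTerm k| := by
  have h := congrArg abs (pi_sq_mul_sinPiTerm k)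
  rw [abs_mul, abs_mul, abs_neg, abs_of_nonneg (sq_nonneg Real.pi),
    abs_of_nonneg (show (0 : ℝ) ≤ (2 * k + 3) * (2 * k + 2) by positivity)] at h
  field_simp
  linarith

lemma summable_binomSinTail (m n : ℕ) :
    Summable fun i : ℕ => (i.choose n : ℝ) * sinPiTerm (m + i) := by
  have hπ := Real.pi_pos
  have hs : Summable fun k : ℕ => Real.pi * ((2 * Real.pi ^ 2) ^ k / k.factorial) :=
    (Real.summable_pow_div_factorial _).mul_left _
  have hs' := (summable_nat_add_iff m).2 hs
  refine Summable.of_norm_bounded hs' fun i => ?_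
  rw [Real.norm_eq_abs, abs_mul, Nat.abs_cast, abs_sinPiTerm, add_comm i m]
  have h1 : (i.choose n : ℝ) ≤ 2 ^ (m + i) := by
    calc (i.choose n : ℝ) ≤ 2 ^ i := by exact_mod_cast Nat.choose_le_two_pow i n
      _ ≤ 2 ^ (m + i) := pow_le_pow_right₀ (by norm_num) (by omega)
  have h2 : ((m + i).factorial : ℝ) ≤ (2 * (m + i) + 1).factorial := by
    exact_mod_cast Nat.factorial_le (by omega)
  calc (i.choose n : ℝ) * (Real.pi ^ (2 * (m + i) + 1) / (2 * (m + i) + 1).factorial)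
      ≤ 2 ^ (m + i) * (Real.pi ^ (2 * (m + i) + 1) / (m + i).factorial) := by gcongr
    _ = _ := by rw [mul_pow, ← pow_mul, pow_succ]; ring

lemma binomSinTail_zero_right (m : ℕ) :
    binomSinTail (m + 1) 0 = binomSinTail m 0 - sinPiTerm m := by
  have h := (summable_binomSinTail m 0).tsum_eq_zero_add
  simp only [binomSinTail] at h ⊢
  rw [h]
  simp [show ∀ b, m + 1 + b = m + (b + 1) by intro b; ring]

lemma binomSinTail_succ_succ (m n : ℕ) :
    binomSinTail (m + 1) (n + 1) = binomSinTail m (n + 1) - binomSinTail (m + 1) n := by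
  have h := (summable_binomSinTail m (n + 1)).tsum_eq_zero_add
  have h2 := (summable_binomSinTail (m + 1) n).tsum_add (summable_binomSinTail (m + 1) (n + 1))
  simp only [binomSinTail] at h h2 ⊢
  rw [h, eq_sub_iff_add_eq, add_comm, ← h2]
  simp only [Nat.choose_zero_succ, Nat.cast_zero, zero_mul, zero_add]
  refine tsum_congr fun i => ?_
  rw [Nat.choose_succ_succ, show m + (i + 1) = m + 1 + i by ring]
  push_cast; ring

lemma binomSinTail_zero_zero : binomSinTail 0 0 = 0 := by
  have h := (Real.hasSum_sin Real.pi).tsum_eq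
  simpa [binomSinTail, sinPiTerm] using h

lemma binomSinTail_zero_one : binomSinTail 0 1 = -Real.pi / 2 := by
  have h1 := Real.hasSum_sin Real.pi
  have h2 := (Real.hasSum_cos Real.pi).mul_left Real.pi
  have h := ((h2.sub h1).div_const 2).tsum_eq
  rw [Real.sin_pi, Real.cos_pi] at h
  rw [binomSinTail, show -Real.pi / 2 = (Real.pi * -1 - 0) / 2 by ring, ← h]
  refine tsum_congr fun k => ?_
  have h0 : ((2 * k).factorial : ℝ) ≠ 0 := by positivity
  rw [sinPiTerm, zero_add, Nat.choose_one_right, Nat.factorial_succ]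
  push_cast
  field_simp
  ring

lemma binomSinTail_zero_add_two (n : ℕ) :
    4 * ((n + 2) * (n + 1)) * binomSinTail 0 (n + 2)
      = -(2 * (2 * n + 3) * (n + 1)) * binomSinTail 0 (n + 1)
        - Real.pi ^ 2 * binomSinTail 0 n := by
  have h2 := (summable_binomSinTail 0 (n + 2)).tsum_eq_zero_add
  have h1 := (summable_binomSinTail 0 (n + 1)).tsum_eq_zero_add
  have s2 := (summable_nat_add_iff 1).2 (summable_binomSinTail 0 (n + 2))
  have s1 := (summable_nat_add_iff 1).2 (summable_binomSinTail 0 (n + 1))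
  have s0 := summable_binomSinTail 0 n
  simp only [Nat.choose_zero_succ, Nat.cast_zero, zero_mul, zero_add] at h1 h2 s0 s1 s2
  simp only [binomSinTail, zero_add]
  rw [h1, h2, ← tsum_mul_left, ← tsum_mul_left, ← tsum_mul_left,
    ← (s1.mul_left _).tsum_sub (s0.mul_left _)]
  refine tsum_congr fun k => ?_
  have hπ := pi_sq_mul_sinPiTerm k
  have e1 : ((n : ℝ) + 1) * ((k + 1).choose (n + 1)) = (k + 1) * k.choose n := by
    have := Nat.add_one_mul_choose_eq k n
    rw [mul_comm ((n : ℝ) + 1)]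
    exact_mod_cast this.symm
  have e2 : ((n : ℝ) + 2) * ((k + 1).choose (n + 2)) = (k - n) * (k + 1).choose (n + 1) := by
    rcases lt_or_ge k n with hk | hk
    · rw [Nat.choose_eq_zero_of_lt (by omega), Nat.choose_eq_zero_of_lt (by omega)]; simp
    · have := Nat.choose_succ_right_eq (k + 1) (n + 1)
      rw [Nat.add_sub_add_right] at this
      rw [← Nat.cast_sub hk, mul_comm, mul_comm ((k - n : ℕ) : ℝ)]
      exact_mod_cast this
  linear_combination (4 * (n + 1) * sinPiTerm (k + 1)) * e2
    + (4 * (k - n) + 2 * (2 * n + 3)) * sinPiTerm (k + 1) * e1 + (k.choose n : ℝ) * hπ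

/-- The leading term dominates `binomSinTail m (2 * m)`. -/
lemma abs_binomSinTail_sub_le (m : ℕ) (hm : 2 ≤ m) :
    |binomSinTail m (2 * m) - sinPiTerm (3 * m)| ≤ |sinPiTerm (3 * m)| / 2 := by
  set t : ℕ → ℝ := fun i => ((2 * m + i).choose (2 * m) : ℝ) * sinPiTerm (3 * m + i) with ht
  have hsum : binomSinTail m (2 * m) = ∑' i, t i := by
    rw [binomSinTail, ← (summable_binomSinTail m (2 * m)).sum_add_tsum_nat_add (2 * m),
      Finset.sum_eq_zero, zero_add]
    · refine tsum_congr fun i => ?_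
      rw [ht, add_comm i, show m + (2 * m + i) = 3 * m + i by ring]
    · intro i hi
      rw [Nat.choose_eq_zero_of_lt (Finset.mem_range.1 hi)]; simp
  have hst : Summable t := by
    have := (summable_nat_add_iff (2 * m)).2 (summable_binomSinTail m (2 * m))
    refine this.congr fun i => ?_
    rw [ht, add_comm i, show m + (2 * m + i) = 3 * m + i by ring]
  have hratio : ∀ i, |t (i + 1)| ≤ |t i| * (1 / 3) := by
    intro i
    have hc : ((2 * m + (i + 1)).choose (2 * m) : ℝ) * (i + 1)
        = (2 * m + i + 1) * (2 * m + i).choose (2 * m) := by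
      have := Nat.add_one_mul_choose_eq (2 * m + i) (i)
      rw [show (2 * m + i + 1) = 2 * m + (i + 1) by ring,
        ← Nat.choose_symm_add, ← Nat.choose_symm_add] at this
      have h := congrArg (Nat.cast : ℕ → ℝ) this
      push_cast at h
      linarith
    have hc' : ((2 * m + (i + 1)).choose (2 * m) : ℝ)
        = (2 * m + i + 1) / (i + 1) * (2 * m + i).choose (2 * m) := by
      field_simp
      linarith
    have hπ : Real.pi ^ 2 ≤ 10 := by nlinarith [Real.pi_lt_d2, Real.pi_pos]
    have hm' : (2 : ℝ) ≤ m := by exact_mod_cast hm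
    have hi : (0 : ℝ) ≤ i := by positivity
    have key : (2 * m + i + 1) / (i + 1)
        * (Real.pi ^ 2 / ((2 * (3 * m + i : ℕ) + 3) * (2 * (3 * m + i : ℕ) + 2))) ≤ (1 / 3 : ℝ) := by
      push_cast
      rw [div_mul_div_comm, div_le_div_iff₀ (by positivity) (by norm_num)]
      calc (2 * m + i + 1) * Real.pi ^ 2 * (3 : ℝ) ≤ (2 * m + i + 1) * 10 * 3 := by gcongr
        _ ≤ 1 * ((2 * (3 * m + i) + 3) * (2 * (3 * m + i) + 2)) := by nlinarith
        _ ≤ 1 * ((i + 1) * ((2 * (3 * m + i) + 3) * (2 * (3 * m + i) + 2))) := by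
          have : 0 ≤ i * ((2 * (3 * m + i) + 3) * (2 * (3 * m + i) + 2) : ℝ) := by positivity
          nlinarith
    simp only [ht]
    rw [abs_mul, abs_mul, Nat.abs_cast, Nat.abs_cast, ← add_assoc (3 * m), abs_sinPiTerm_succ, hc']
    calc _ = (2 * m + i + 1) / (i + 1)
        * (Real.pi ^ 2 / ((2 * (3 * m + i : ℕ) + 3) * (2 * (3 * m + i : ℕ) + 2)))
        * (((2 * m + i).choose (2 * m) : ℝ) * |sinPiTerm (3 * m + i)|) := by ring
      _ ≤ 1 / 3 * (((2 * m + i).choose (2 * m) : ℝ) * |sinPiTerm (3 * m + i)|) := by gcongr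
      _ = _ := by ring
  have h0 : t 0 = sinPiTerm (3 * m) := by simp [ht]
  have hbound : ∀ i, |t (i + 1)| ≤ |sinPiTerm (3 * m)| / 3 * (1 / 3) ^ i := by
    intro i
    induction i with
    | zero => have := hratio 0; rw [h0] at this; simpa [div_eq_mul_inv] using this
    | succ i ih =>
      calc _ ≤ _ := hratio (i + 1)
        _ ≤ _ := mul_le_mul_of_nonneg_right ih (by norm_num)
        _ = _ := by ring
  have hg := (hasSum_geometric_of_lt_one (r := (1 / 3 : ℝ)) (by norm_num) (by norm_num)).mul_left
    (|sinPiTerm (3 * m)| / 3)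
  have hfin := tsum_of_norm_bounded (f := fun i => t (i + 1)) hg hbound
  rw [hsum, hst.tsum_eq_zero_add, h0, add_sub_cancel_left]
  exact hfin.trans (le_of_eq (by ring))
/-- `v` is the value at `π` of a function that behaves like an integer polynomial of degree at
most `d`, with the function and its slopes from `π` bounded by `M` on `[0, 4]`. -/
def IsPiForm (d : ℕ) (M v : ℝ) : Prop :=
  ∃ p : ℝ → ℝ, p Real.pi = v ∧
    (∀ (a : ℤ) (b : ℕ), 0 < b → ∃ z : ℤ, (b : ℝ) ^ d * p (a / b) = z) ∧
    ∀ x ∈ Set.Icc (0 : ℝ) 4, |p x| ≤ M ∧ |p x - p Real.pi| ≤ M * |x - Real.pi|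

namespace IsPiForm

variable {d d' : ℕ} {M M' v v' : ℝ}

lemma mono (h : IsPiForm d M v) (hd : d ≤ d') (hM : M ≤ M') : IsPiForm d' M' v := by
  obtain ⟨p, hv, hz, hb⟩ := h
  refine ⟨p, hv, fun a b hb0 => ?_, fun x hx => ⟨(hb x hx).1.trans hM, (hb x hx).2.trans ?_⟩⟩
  · obtain ⟨z, h⟩ := hz a b hb0
    refine ⟨b ^ (d' - d) * z, ?_⟩
    push_cast
    rw [← h, ← mul_assoc, ← pow_add, Nat.sub_add_cancel hd]
  · gcongr

lemma one : IsPiForm 0 1 1 :=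
  ⟨fun _ => 1, rfl, fun _ _ _ => ⟨1, by simp⟩, fun x _ => by simp⟩

lemma zero : IsPiForm 0 0 0 :=
  ⟨fun _ => 0, rfl, fun _ _ _ => ⟨0, by simp⟩, fun x _ => by simp⟩

lemma int_mul (h : IsPiForm d M v) (k : ℤ) : IsPiForm d (|(k : ℝ)| * M) (k * v) := by
  obtain ⟨p, rfl, hz, hb⟩ := h
  refine ⟨fun x => k * p x, rfl, fun a b hb0 => ?_, fun x hx => ⟨?_, ?_⟩⟩
  · obtain ⟨z, h⟩ := hz a b hb0
    exact ⟨k * z, by push_cast; rw [← h]; ring⟩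
  · rw [abs_mul]
    exact mul_le_mul_of_nonneg_left (hb x hx).1 (abs_nonneg _)
  · rw [← mul_sub, abs_mul, mul_assoc]
    exact mul_le_mul_of_nonneg_left (hb x hx).2 (abs_nonneg _)

lemma sub (h : IsPiForm d M v) (h' : IsPiForm d M' v') : IsPiForm d (M + M') (v - v') := by
  obtain ⟨p, rfl, hz, hb⟩ := h
  obtain ⟨q, rfl, hz', hb'⟩ := h'
  refine ⟨fun x => p x - q x, rfl, fun a b hb0 => ?_, fun x hx => ⟨?_, ?_⟩⟩
  · obtain ⟨z, h⟩ := hz a b hb0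
    obtain ⟨z', h'⟩ := hz' a b hb0
    exact ⟨z - z', by push_cast; rw [← h, ← h']; ring⟩
  · exact (abs_sub _ _).trans (add_le_add (hb x hx).1 (hb' x hx).1)
  · rw [sub_sub_sub_comm, add_mul]
    exact (abs_sub _ _).trans (add_le_add (hb x hx).2 (hb' x hx).2)

lemma pi_mul (h : IsPiForm d M v) : IsPiForm (d + 1) (5 * M) (Real.pi * v) := by
  obtain ⟨p, rfl, hz, hb⟩ := h
  have hπ : Real.pi ∈ Set.Icc (0 : ℝ) 4 := ⟨Real.pi_pos.le, Real.pi_le_four⟩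
  have hM : 0 ≤ M := (abs_nonneg _).trans (hb _ hπ).1
  refine ⟨fun x => x * p x, rfl, fun a b hb0 => ?_, fun x hx => ⟨?_, ?_⟩⟩
  · obtain ⟨z, h⟩ := hz a b hb0
    refine ⟨a * z, ?_⟩
    have : (b : ℝ) ≠ 0 := by positivity
    push_cast
    rw [← h, pow_succ]
    generalize p (a / b) = y
    field_simp
  · rw [abs_mul, abs_of_nonneg hx.1]
    calc x * |p x| ≤ 4 * M := mul_le_mul hx.2 (hb x hx).1 (abs_nonneg _) (by norm_num)
      _ ≤ 5 * M := by linarith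
  · calc |x * p x - Real.pi * p Real.pi|
        = |x * (p x - p Real.pi) + (x - Real.pi) * p Real.pi| := by congr 1; ring
      _ ≤ x * |p x - p Real.pi| + |x - Real.pi| * |p Real.pi| := by
        refine (abs_add_le _ _).trans ?_
        rw [abs_mul, abs_mul, abs_of_nonneg hx.1]
      _ ≤ 4 * (M * |x - Real.pi|) + |x - Real.pi| * M := by
        have h1 := (hb x hx).2
        have h2 := (hb _ hπ).1
        have h3 := hx.2
        gcongr
      _ = _ := by ring

lemma pi_pow (i : ℕ) : IsPiForm i (5 ^ i) (Real.pi ^ i) := by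
  induction i with
  | zero => simpa using one
  | succ i ih => rw [pow_succ', pow_succ']; exact ih.pi_mul

/-- The dichotomy behind irrationality measures: a small nonzero form forces `π` to be far from
rationals of moderate denominator. -/
lemma le_mul_abs_sub (h : IsPiForm d M v) (hv : v ≠ 0) {a : ℤ} {b : ℕ} (hb : 0 < b)
    (hab : |(a / b : ℝ) - Real.pi| ≤ 1 / 2) (hsmall : (b : ℝ) ^ d * (2 * |v|) < 1) :
    |v| ≤ M * |(a / b : ℝ) - Real.pi| := by
  obtain ⟨p, rfl, hz, hp⟩ := h
  by_contra! hlt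
  obtain ⟨z, hz⟩ := hz a b hb
  have hab' := abs_le.1 hab
  have hmem : (a / b : ℝ) ∈ Set.Icc (0 : ℝ) 4 :=
    ⟨by linarith [Real.pi_gt_three], by linarith [Real.pi_lt_d2]⟩
  have hdiff := (hp _ hmem).2.trans_lt hlt
  have hpos : 0 < (b : ℝ) ^ d := by positivity
  have h0 : p (a / b) ≠ 0 := by
    intro h0
    rw [h0, zero_sub, abs_neg] at hdiff
    exact lt_irrefl _ hdiff
  have hup : |p (a / b)| < 2 * |p Real.pi| := by
    have := abs_add_le (p (a / b) - p Real.pi) (p Real.pi)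
    rw [sub_add_cancel] at this
    linarith
  have hz1 : |(z : ℝ)| < 1 := by
    rw [← hz, abs_mul, abs_of_pos hpos]
    exact (mul_lt_mul_of_pos_left hup hpos).trans hsmall
  have hz0 : z = 0 := by
    rw [← Int.abs_lt_one_iff]
    exact_mod_cast hz1
  rw [hz0, Int.cast_zero] at hz
  exact (mul_ne_zero hpos.ne' h0) hz

end IsPiForm

lemma isPiForm_binomSinTail_zero (B : ℝ) (n : ℕ) (hB : 2 * n + 30 ≤ B) :
    IsPiForm n (B ^ n) ((-2) ^ n * n.factorial * binomSinTail 0 n) := by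
  have hB0 : (30 : ℝ) ≤ B := le_trans (by linarith [n.cast_nonneg (α := ℝ)]) hB
  induction n using Nat.twoStepInduction with
  | zero =>
    simpa [binomSinTail_zero_zero] using IsPiForm.zero.mono le_rfl zero_le_one
  | one =>
    have h := IsPiForm.one.pi_mul.mono (d' := 1) (M' := B ^ 1) le_rfl (by linarith)
    convert h using 1
    rw [binomSinTail_zero_one]
    norm_num
    ring
  | more n ih0 ih1 =>
    push_cast at hB ih1
    have h1 := (ih1 (by linarith)).int_mul (2 * n + 3)
    have h0 := (ih0 (by linarith)).pi_mul.pi_mul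
    have h := ((h1.mono (d' := n + 2) (by omega) le_rfl).sub h0)
    have hrec := binomSinTail_zero_add_two n
    have hM : |((2 * n + 3 : ℤ) : ℝ)| * B ^ (n + 1) + 5 * (5 * B ^ n) ≤ B ^ (n + 2) := by
      push_cast
      rw [abs_of_pos (by positivity)]
      have hBn : (0 : ℝ) ≤ B ^ n := by positivity
      have : (2 * n + 3) * B + 25 ≤ B * B := by nlinarith
      calc (2 * n + 3) * B ^ (n + 1) + 5 * (5 * B ^ n) = B ^ n * ((2 * n + 3) * B + 25) := by ring
        _ ≤ B ^ n * (B * B) := by gcongr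
        _ = _ := by ring
    convert h.mono le_rfl hM using 1
    rw [Nat.factorial_succ, Nat.factorial_succ]
    push_cast
    linear_combination (-2) ^ n * n.factorial * hrec

lemma isPiForm_binomSinTail (N m n : ℕ) (hm : 2 * m ≤ N) (hn : n ≤ N) :
    IsPiForm N (2 ^ (m + n) * (2 ^ N * N.factorial * (2 * N + 30) ^ N))
      (2 ^ N * N.factorial * binomSinTail m n) := by
  set X : ℝ := 2 ^ N * N.factorial * (2 * N + 30) ^ N with hX
  have hX0 : 0 ≤ X := by positivity
  induction m generalizing n with
  | zero =>
    obtain ⟨c, hc⟩ := Nat.factorial_dvd_factorial hn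
    obtain ⟨e, rfl⟩ := Nat.exists_eq_add_of_le hn
    have h := (isPiForm_binomSinTail_zero (2 * (n + e : ℕ) + 30) n
      (by push_cast; linarith [e.cast_nonneg (α := ℝ)])).int_mul ((-1) ^ n * 2 ^ e * c)
    have hf : ((n + e).factorial : ℝ) = n.factorial * c := by exact_mod_cast hc
    have hf1 : (c : ℝ) ≤ (n + e).factorial := by
      rw [hf]
      exact le_mul_of_one_le_left (by positivity) (by exact_mod_cast Nat.factorial_pos n)
    convert h.mono (d' := n + e) (M' := 2 ^ (0 + n) * X) hn ?_ using 1
    · rw [hf]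
      push_cast
      have : (-1 : ℝ) ^ n * (-2) ^ n = 2 ^ n := by rw [← mul_pow]; norm_num
      rw [pow_add, ← this]
      ring
    · push_cast
      rw [abs_mul, abs_mul, abs_pow, abs_neg, abs_one, one_pow, one_mul, Nat.abs_cast,
        abs_of_pos (by positivity)]
      have h1 : (1 : ℝ) ≤ 2 * (n + e) + 30 := by
        linarith [e.cast_nonneg (α := ℝ), n.cast_nonneg (α := ℝ)]
      calc (2 : ℝ) ^ e * c * (2 * (n + e) + 30) ^ n
          ≤ 2 ^ (n + e) * (n + e).factorial * (2 * (n + e) + 30) ^ (n + e) := by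
            gcongr <;> norm_num
        _ = X := by rw [hX]; push_cast; ring
        _ ≤ 2 ^ (0 + n) * X := le_mul_of_one_le_left hX0 (one_le_pow₀ (by norm_num))
  | succ m ih =>
    induction n with
    | zero =>
      obtain ⟨c, hc⟩ := Nat.factorial_dvd_factorial (show 2 * m + 1 ≤ N by omega)
      have h := ((IsPiForm.pi_pow (2 * m + 1)).int_mul ((-1) ^ m * 2 ^ N * c)).mono
        (d' := N) (by omega) le_rfl
      have hf : (N.factorial : ℝ) = (2 * m + 1).factorial * c := by exact_mod_cast hc
      have hf1 : (c : ℝ) ≤ N.factorial := by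
        rw [hf]
        exact le_mul_of_one_le_left (by positivity) (by exact_mod_cast Nat.factorial_pos _)
      convert ((ih 0 (by omega) (by omega)).sub h).mono le_rfl ?_ using 1
      · rw [binomSinTail_zero_right, sinPiTerm]
        have h0 : ((2 * m + 1).factorial : ℝ) ≠ 0 := by positivity
        rw [hf]
        push_cast
        field_simp
      · push_cast
        rw [abs_mul, abs_mul, abs_pow, abs_neg, abs_one, one_pow, one_mul, Nat.abs_cast,
          abs_of_pos (by positivity)]
        have h5 : (5 : ℝ) ≤ 2 * N + 30 := by linarith [N.cast_nonneg (α := ℝ)]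
        have h1 : (1 : ℝ) ≤ 2 * N + 30 := by linarith
        have hle : (2 : ℝ) ^ N * c * 5 ^ (2 * m + 1) ≤ X := by
          calc (2 : ℝ) ^ N * c * 5 ^ (2 * m + 1)
              ≤ 2 ^ N * N.factorial * (2 * N + 30) ^ (2 * m + 1) := by gcongr
            _ ≤ X := by
              rw [hX]
              have : 2 * m + 1 ≤ N := by omega
              gcongr
        have : X ≤ 2 ^ m * X := le_mul_of_one_le_left hX0 (one_le_pow₀ (by norm_num))
        calc (2 : ℝ) ^ (m + 0) * X + 2 ^ N * c * 5 ^ (2 * m + 1) ≤ 2 ^ m * X + 2 ^ m * X := by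
              rw [add_zero]; linarith
          _ = _ := by ring
    | succ n ihn =>
      convert ((ih (n + 1) (by omega) hn).sub (ihn (by omega))).mono le_rfl (le_of_eq ?_) using 1
      · rw [binomSinTail_succ_succ]; ring
      · ring

/-- An effective lower bound for the distance from `π` to rationals of denominator at most
`m ^ 2 / 16`. -/
lemma one_div_pow_le_abs_sub_pi {m b : ℕ} (hm : 5 ≤ m) (hb : 0 < b) (hbm : 16 * b ≤ m ^ 2)
    (a : ℤ) : 1 / (10 * m : ℝ) ^ (9 * m) ≤ |(a / b : ℝ) - Real.pi| := by
  have hπ0 := Real.pi_pos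
  have hm' : (5 : ℝ) ≤ m := by exact_mod_cast hm
  have hlarge : (1 : ℝ) ≤ (10 * m : ℝ) ^ (9 * m) / 2 := by
    have : (10 * m : ℝ) ^ 1 ≤ (10 * m : ℝ) ^ (9 * m) :=
      pow_le_pow_right₀ (by linarith) (by omega)
    linarith
  rcases le_or_gt |(a / b : ℝ) - Real.pi| (1 / 2) with hab | hab
  swap
  · refine le_trans ?_ hab.le
    rw [div_le_div_iff₀ (by positivity) (by norm_num)]
    linarith
  set s := |sinPiTerm (3 * m)| with hs
  have hs' : s = Real.pi ^ (6 * m + 1) / (6 * m + 1).factorial := by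
    rw [hs, abs_sinPiTerm, show 2 * (3 * m) = 6 * m by ring]
  have hs0 : 0 < s := by rw [hs']; positivity
  have hG := abs_binomSinTail_sub_le m (by omega)
  rw [← hs] at hG
  have hGu : |binomSinTail m (2 * m)| ≤ 3 / 2 * s := by
    have := abs_add_le (binomSinTail m (2 * m) - sinPiTerm (3 * m)) (sinPiTerm (3 * m))
    rw [sub_add_cancel] at this
    linarith
  have hGl : s / 2 ≤ |binomSinTail m (2 * m)| := by
    have := abs_sub_abs_le_abs_sub (sinPiTerm (3 * m)) (binomSinTail m (2 * m))
    rw [abs_sub_comm] at this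
    linarith
  have hform := isPiForm_binomSinTail (2 * m) m (2 * m) le_rfl le_rfl
  set Y : ℝ := 2 ^ (2 * m) * (2 * m).factorial with hY
  have hY0 : 0 < Y := by positivity
  have habs : |Y * binomSinTail m (2 * m)| = Y * |binomSinTail m (2 * m)| := by
    rw [abs_mul, abs_of_pos hY0]
  have hne : Y * binomSinTail m (2 * m) ≠ 0 := by
    rw [← abs_pos, habs]
    exact mul_pos hY0 (by linarith)
  have hsmall : (b : ℝ) ^ (2 * m) * (2 * |Y * binomSinTail m (2 * m)|) < 1 := by
    have hbm' : 16 * (b : ℝ) ≤ m ^ 2 := by exact_mod_cast hbm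
    have hπ3 : Real.pi ^ 3 ≤ 32 := by
      have : Real.pi ^ 3 ≤ 3.15 ^ 3 := by gcongr; exact Real.pi_lt_d2.le
      exact this.trans (by norm_num)
    have hbase : (b : ℝ) * 2 * Real.pi ^ 3 ≤ (2 * m) ^ 2 := by
      calc (b : ℝ) * 2 * Real.pi ^ 3 ≤ b * 2 * 32 := by gcongr
        _ ≤ (2 * m) ^ 2 := by nlinarith
    have hfac : ((2 * m).factorial : ℝ) * (2 * m + 1) ^ (4 * m + 1) ≤ (6 * m + 1).factorial := by
      have := Nat.factorial_mul_pow_le_factorial (m := 2 * m) (n := 4 * m + 1)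
      rw [show 2 * m + (4 * m + 1) = 6 * m + 1 by ring] at this
      exact_mod_cast this
    calc (b : ℝ) ^ (2 * m) * (2 * |Y * binomSinTail m (2 * m)|)
        ≤ (b : ℝ) ^ (2 * m) * (2 * (Y * (3 / 2 * s))) := by rw [habs]; gcongr
      _ = 3 * Real.pi * (2 * m).factorial * (b * 2 * Real.pi ^ 3) ^ (2 * m)
          / (6 * m + 1).factorial := by
        rw [hs', hY, mul_pow, mul_pow, ← pow_mul, show 3 * (2 * m) = 6 * m by ring, pow_succ]
        ring
      _ ≤ 3 * Real.pi * (2 * m).factorial * ((2 * m) ^ 2) ^ (2 * m)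
          / ((2 * m).factorial * (2 * m + 1) ^ (4 * m + 1)) := by gcongr
      _ ≤ 3 * Real.pi * (2 * m).factorial * (2 * m + 1) ^ (4 * m)
          / ((2 * m).factorial * (2 * m + 1) ^ (4 * m + 1)) := by
        rw [← pow_mul, show 2 * (2 * m) = 4 * m by ring]
        gcongr
        linarith
      _ = 3 * Real.pi / (2 * m + 1) := by
        have : ((2 * m).factorial : ℝ) ≠ 0 := by positivity
        rw [pow_succ]
        field_simp
      _ < 1 := by
        rw [div_lt_one (by positivity)]
        linarith [Real.pi_lt_d2]
  have hmain := hform.le_mul_abs_sub hne hb hab hsmall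
  rw [habs] at hmain
  have hmain' : s / 2 ≤ 2 ^ (m + 2 * m) * (4 * m + 30) ^ (2 * m) * |(a / b : ℝ) - Real.pi| := by
    refine le_of_mul_le_mul_left ?_ hY0
    calc Y * (s / 2) ≤ Y * |binomSinTail m (2 * m)| := by gcongr
      _ ≤ _ := hmain
      _ = _ := by push_cast; ring
  have hπm : (8 : ℝ) ^ m ≤ Real.pi ^ (6 * m + 1) / 2 := by
    have h8 : (8 : ℝ) ≤ Real.pi ^ 6 := by
      have : (3 : ℝ) ^ 6 ≤ Real.pi ^ 6 := by gcongr; exact Real.pi_gt_three.le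
      exact le_trans (by norm_num) this
    calc (8 : ℝ) ^ m ≤ (Real.pi ^ 6) ^ m * 1 := by rw [mul_one]; gcongr
      _ ≤ (Real.pi ^ 6) ^ m * (Real.pi / 2) := by gcongr; linarith [Real.pi_gt_three]
      _ = _ := by rw [← pow_mul, pow_succ]; ring
  have hfac : ((6 * m + 1).factorial : ℝ) ≤ (10 * m) ^ (6 * m + 1) := by
    calc ((6 * m + 1).factorial : ℝ) ≤ ((6 * m + 1 : ℕ) : ℝ) ^ (6 * m + 1) := by
          exact_mod_cast Nat.factorial_le_pow _
      _ ≤ _ := by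
        gcongr
        push_cast
        linarith
  have hδ := abs_nonneg ((a / b : ℝ) - Real.pi)
  have h8 : (2 : ℝ) ^ (m + 2 * m) = 8 ^ m := by
    rw [show m + 2 * m = 3 * m by ring, pow_mul]; norm_num
  rw [div_le_iff₀ (by positivity)]
  refine le_of_mul_le_mul_left ?_ (show (0 : ℝ) < 8 ^ m by positivity)
  calc (8 : ℝ) ^ m * 1 ≤ s / 2 * (6 * m + 1).factorial := by
        rw [mul_one, hs']
        refine hπm.trans (le_of_eq ?_)
        field_simp
    _ ≤ 2 ^ (m + 2 * m) * (4 * m + 30) ^ (2 * m) * |(a / b : ℝ) - Real.pi|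
        * (10 * m) ^ (6 * m + 1) := by gcongr
    _ ≤ 8 ^ m * (10 * m) ^ (2 * m) * |(a / b : ℝ) - Real.pi| * (10 * m) ^ (6 * m + 1) := by
        rw [h8]
        gcongr
        linarith
    _ = 8 ^ m * (|(a / b : ℝ) - Real.pi| * (10 * m) ^ (8 * m + 1)) := by
        rw [show 8 * m + 1 = 2 * m + (6 * m + 1) by ring, pow_add]; ring
    _ ≤ _ := by
        gcongr
        · linarith
        · omega

lemma exists_sq_sub_le_of_one_sub_sin_le {x ε : ℝ} (h : 1 - Real.sin x ≤ ε) :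
    ∃ l : ℤ, (x - Real.pi / 2 - l * (2 * Real.pi)) ^ 2 ≤ 5 * ε := by
  have hπ := Real.pi_pos
  set y := (x - Real.pi / 2) / (2 * Real.pi) with hy
  refine ⟨round y, ?_⟩
  set δ := x - Real.pi / 2 - round y * (2 * Real.pi) with hδ
  have hδy : δ = (y - round y) * (2 * Real.pi) := by rw [hδ, hy]; field_simp
  have hle : |δ| ≤ Real.pi := by
    rw [hδy, abs_mul, abs_of_pos (show 0 < 2 * Real.pi by positivity)]
    nlinarith [abs_sub_round y]
  have hcos : Real.cos δ = Real.sin x := by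
    rw [hδ, Real.cos_sub_int_mul_two_pi, Real.cos_sub_pi_div_two]
  have hq := Real.cos_le_one_sub_mul_cos_sq hle
  have hδε : 2 / Real.pi ^ 2 * δ ^ 2 ≤ ε := by linarith
  have hsq : 0 ≤ δ ^ 2 := sq_nonneg δ
  have h5 : 1 / 5 ≤ 2 / Real.pi ^ 2 := by
    rw [div_le_div_iff₀ (by norm_num) (by positivity)]
    nlinarith [Real.pi_lt_d2]
  nlinarith

/-- Two integers at which `sin` is within `ε` of `1` cannot be close together. -/
lemma pow_le_of_one_sub_sin_le {n h t : ℕ} {ε : ℝ} (ht : 2 ≤ t) (h0 : 0 < h) (hht : h < t ^ 2)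
    (hε : 20 * ε < 1) (hn : 1 - Real.sin n ≤ ε) (hnh : 1 - Real.sin (n + h : ℕ) ≤ ε) :
    (1 / (40 * t : ℝ) ^ (36 * t)) ^ 2 ≤ 20 * ε := by
  have hπ := Real.pi_gt_three
  obtain ⟨l, hl⟩ := exists_sq_sub_le_of_one_sub_sin_le hn
  obtain ⟨l', hl'⟩ := exists_sq_sub_le_of_one_sub_sin_le hnh
  obtain ⟨d, rfl⟩ : ∃ d, l' = l + d := ⟨l' - l, by ring⟩
  push_cast at hl'
  have hsq : (h - d * (2 * Real.pi)) ^ 2 ≤ 20 * ε := by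
    nlinarith [sq_nonneg ((n - Real.pi / 2 - l * (2 * Real.pi))
      + (n + h - Real.pi / 2 - (l + d) * (2 * Real.pi)))]
  have hlt := abs_lt.1 ((sq_lt_one_iff_abs_lt_one _).1 (hsq.trans_lt hε))
  have hh1 : (1 : ℝ) ≤ h := by exact_mod_cast h0
  have hd : 0 < d := by
    by_contra! hd
    have : (d : ℝ) ≤ 0 := by exact_mod_cast hd
    nlinarith
  lift d to ℕ using hd.le
  have hd0 : 0 < d := by exact_mod_cast hd
  push_cast at hlt hsq
  have hd1 : (1 : ℝ) ≤ d := by exact_mod_cast hd0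
  have hdh : 2 * d ≤ h := by
    have : (2 * d : ℝ) ≤ h := by nlinarith
    exact_mod_cast this
  have hmain := one_div_pow_le_abs_sub_pi (m := 4 * t) (b := 2 * d) (by omega) (by omega)
    (by nlinarith) h
  refine le_trans ?_ hsq
  rw [← sq_abs (_ - _)]
  refine pow_le_pow_left₀ (by positivity) ?_ 2
  rw [show 9 * (4 * t) = 36 * t by ring] at hmain
  push_cast at hmain
  rw [show (10 * (4 * t) : ℝ) = 40 * t by ring] at hmain
  refine hmain.trans ?_
  rw [show (h / (2 * d) - Real.pi : ℝ) = (h - d * (2 * Real.pi)) / (2 * d) by field_simp, abs_div,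
    abs_of_pos (show (0 : ℝ) < 2 * d by positivity)]
  exact div_le_self (abs_nonneg _) (by linarith)

lemma card_le_of_separated {A G : ℕ} {S : Finset ℕ} (hG : 0 < G) (hS : S ⊆ Finset.Ico A (2 * A))
    (hsep : ∀ x ∈ S, ∀ h, 0 < h → x + h ∈ S → G ≤ h) : S.card ≤ A / G + 1 := by
  rw [← Finset.card_range (A / G + 1)]
  have hmem : ∀ x ∈ S, A ≤ x ∧ x < 2 * A := fun x hx => Finset.mem_Ico.1 (hS hx)
  refine Finset.card_le_card_of_injOn (fun x => (x - A) / G) (fun x hx => ?_) ?_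
  · have := hmem x hx
    rw [Finset.mem_coe, Finset.mem_range, Nat.lt_succ_iff]
    exact Nat.div_le_div_right (by omega)
  · have key : ∀ x ∈ S, ∀ y ∈ S, (x - A) / G = (y - A) / G → ¬ x < y := by
      intro x hx y hy hxy hlt
      have h1 := hmem x hx
      have h2 := hsep x hx (y - x) (by omega) (by rwa [Nat.add_sub_cancel' hlt.le])
      have h3 := Nat.div_le_div_right (c := G) (show (x - A) + G ≤ y - A by omega)
      rw [Nat.add_div_right _ hG, ← hxy] at h3
      omega
    intro x hx y hy hxy
    exact le_antisymm (not_lt.1 (key y hy x hx hxy.symm)) (not_lt.1 (key x hx y hy hxy))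

lemma summable_of_summable_dyadic_blocks {f : ℕ → ℝ} (hf : ∀ n, 0 ≤ f n)
    (h : Summable fun j : ℕ => ∑ n ∈ Finset.Ico (2 ^ j) (2 ^ (j + 1)), f n) : Summable f := by
  have hpow : ∀ J : ℕ, ∑ n ∈ Finset.range (2 ^ J), f n
      = f 0 + ∑ j ∈ Finset.range J, ∑ n ∈ Finset.Ico (2 ^ j) (2 ^ (j + 1)), f n := by
    intro J
    induction J with
    | zero => simp
    | succ J ih =>
      rw [Finset.sum_range_succ, ← add_assoc, ← ih, Finset.sum_range_add_sum_Ico]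
      exact Nat.pow_le_pow_right (by norm_num) (by omega)
  refine summable_of_sum_range_le (c := f 0 + ∑' j : ℕ, ∑ n ∈ Finset.Ico (2 ^ j) (2 ^ (j + 1)), f n)
    hf fun N => ?_
  calc ∑ n ∈ Finset.range N, f n ≤ ∑ n ∈ Finset.range (2 ^ N), f n :=
        Finset.sum_le_sum_of_subset_of_nonneg
          (Finset.range_mono Nat.lt_two_pow_self.le) fun n _ _ => hf n
    _ ≤ _ := by
      rw [hpow]
      gcongr
      exact h.sum_le_tsum _ fun j _ => Finset.sum_nonneg fun n _ => hf n

lemma eventually_mul_pow_lt_two_pow :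
    ∀ᶠ j : ℕ in Filter.atTop, 2 ≤ ⌊(j : ℝ) ^ (3 / 4 : ℝ)⌋₊ ∧
      (400 : ℝ) * (40 * ⌊(j : ℝ) ^ (3 / 4 : ℝ)⌋₊) ^ (144 * ⌊(j : ℝ) ^ (3 / 4 : ℝ)⌋₊) < 2 ^ j := by
  have hlog : ∀ᶠ x : ℝ in Filter.atTop, Real.log x ≤ 1 / 1000 * x ^ (1 / 4 : ℝ) := by
    filter_upwards [(isLittleO_log_rpow_atTop (r := 1 / 4) (by norm_num)).bound
      (show (0 : ℝ) < 1 / 1000 by norm_num), Filter.eventually_ge_atTop 1] with x hx hx1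
    rwa [Real.norm_of_nonneg (Real.log_nonneg hx1), Real.norm_of_nonneg (by positivity)] at hx
  have hquarter : ∀ᶠ x : ℝ in Filter.atTop, 40 ≤ x ^ (1 / 4 : ℝ) :=
    (tendsto_rpow_atTop (by norm_num)).eventually_ge_atTop 40
  filter_upwards [tendsto_natCast_atTop_atTop.eventually hlog,
    tendsto_natCast_atTop_atTop.eventually hquarter,
    tendsto_natCast_atTop_atTop.eventually (Filter.eventually_ge_atTop (1000 : ℝ))]
    with j hj hj4 hj1
  have hj0 : (0 : ℝ) < j := by linarith
  have hprod : (j : ℝ) ^ (3 / 4 : ℝ) * (j : ℝ) ^ (1 / 4 : ℝ) = j := by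
    rw [← Real.rpow_add hj0]; norm_num
  have hcube : (40 : ℝ) ≤ (j : ℝ) ^ (3 / 4 : ℝ) :=
    hj4.trans (Real.rpow_le_rpow_of_exponent_le (by linarith) (by norm_num))
  set y := (j : ℝ) ^ (3 / 4 : ℝ)
  have hty : (⌊y⌋₊ : ℝ) ≤ y := Nat.floor_le (by linarith)
  have ht2 : 2 ≤ ⌊y⌋₊ := Nat.le_floor (by push_cast; linarith)
  refine ⟨ht2, ?_⟩
  have ht2' : (2 : ℝ) ≤ ⌊y⌋₊ := by exact_mod_cast ht2
  rw [← Real.log_lt_log_iff (by positivity) (by positivity), Real.log_mul (by norm_num)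
    (by positivity), Real.log_pow, Real.log_pow]
  have h40 : Real.log (40 * ⌊y⌋₊) ≤ Real.log j := by
    refine Real.log_le_log (by positivity) ?_
    rw [← hprod, mul_comm y]
    gcongr
  have h400 : Real.log 400 ≤ Real.log j := Real.log_le_log (by norm_num) (by linarith)
  have hj' : (j : ℝ) ^ (1 / 4 : ℝ) ≤ j := by
    exact (le_mul_of_one_le_left (by positivity) (by linarith)).trans_eq hprod
  have hmid : ((144 * ⌊y⌋₊ : ℕ) : ℝ) * Real.log (40 * ⌊y⌋₊) ≤ 144 / 1000 * j := by
    push_cast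
    calc (144 * ⌊y⌋₊ : ℝ) * Real.log (40 * ⌊y⌋₊)
        ≤ 144 * y * (1 / 1000 * (j : ℝ) ^ (1 / 4 : ℝ)) := by
          have h3 := h40.trans hj
          have h4 : 0 ≤ Real.log (40 * ⌊y⌋₊) := Real.log_nonneg (by linarith)
          gcongr
      _ = 144 / 1000 * (y * (j : ℝ) ^ (1 / 4 : ℝ)) := by ring
      _ = _ := by rw [hprod]
  have := Real.log_two_gt_d9
  nlinarith

lemma summable_one_div_of_sin_near_one :
    Summable fun n : ℕ => if 1 - Real.sin n ≤ 1 / √(n : ℝ) then 1 / (n : ℝ) else 0 := by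
  have hmaj : Summable fun j : ℕ => 4 * (1 / (j : ℝ) ^ (3 / 2 : ℝ)) + (1 / 2 : ℝ) ^ j :=
    ((Real.summable_one_div_nat_rpow.2 (by norm_num)).mul_left 4).add summable_geometric_two
  refine summable_of_summable_dyadic_blocks (fun n => by positivity) ?_
  refine Summable.of_norm_bounded_eventually_nat hmaj ?_
  filter_upwards [eventually_mul_pow_lt_two_pow, Filter.eventually_ge_atTop 1] with j hj hj1
  obtain ⟨ht2, hpow⟩ := hj
  have hj0 : (1 : ℝ) ≤ j := by exact_mod_cast hj1
  have hy1 : (1 : ℝ) ≤ (j : ℝ) ^ (3 / 4 : ℝ) := Real.one_le_rpow hj0 (by norm_num)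
  have hysq : ((j : ℝ) ^ (3 / 4 : ℝ)) ^ 2 = (j : ℝ) ^ (3 / 2 : ℝ) := by
    rw [← Real.rpow_natCast, ← Real.rpow_mul (by linarith)]; norm_num
  rw [Real.norm_of_nonneg (Finset.sum_nonneg fun n _ => by positivity), ← hysq,
    ← Finset.sum_filter]
  have hty : (j : ℝ) ^ (3 / 4 : ℝ) / 2 ≤ ⌊(j : ℝ) ^ (3 / 4 : ℝ)⌋₊ := by
    have := Nat.lt_floor_add_one ((j : ℝ) ^ (3 / 4 : ℝ))
    have h2 : (2 : ℝ) ≤ ⌊(j : ℝ) ^ (3 / 4 : ℝ)⌋₊ := by exact_mod_cast ht2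
    linarith
  set y := (j : ℝ) ^ (3 / 4 : ℝ)
  set t := ⌊y⌋₊
  set S := (Finset.Ico (2 ^ j) (2 ^ (j + 1))).filter fun n : ℕ => 1 - Real.sin n ≤ 1 / √(n : ℝ)
    with hS
  have ht0 : (2 : ℝ) ≤ t := by exact_mod_cast ht2
  have hSmem : ∀ n ∈ S, (2 : ℝ) ^ j ≤ n ∧ 1 - Real.sin n ≤ 1 / √(2 ^ j : ℝ) := by
    intro n hn
    rw [hS, Finset.mem_filter, Finset.mem_Ico] at hn
    have h1 : (2 : ℝ) ^ j ≤ n := by exact_mod_cast hn.1.1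
    exact ⟨h1, hn.2.trans (by gcongr)⟩
  have hsqrt : 20 * (40 * t : ℝ) ^ (72 * t) < √(2 ^ j : ℝ) := by
    refine Real.lt_sqrt_of_sq_lt ?_
    refine lt_of_eq_of_lt ?_ hpow
    rw [mul_pow, ← pow_mul, show 72 * t * 2 = 144 * t by ring]
    norm_num
  have hone : (1 : ℝ) ≤ (40 * t : ℝ) ^ (72 * t) := one_le_pow₀ (by linarith)
  have hsqrt0 : (0 : ℝ) < √(2 ^ j : ℝ) := by positivity
  have hcard : S.card ≤ 2 ^ j / t ^ 2 + 1 := by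
    refine card_le_of_separated (by positivity) ?_ fun x hx h h0 hxh => ?_
    · rw [← pow_succ']
      exact Finset.filter_subset _ _
    · by_contra! hlt
      have hle := pow_le_of_one_sub_sin_le ht2 h0 hlt (ε := 1 / √(2 ^ j : ℝ))
        (by rw [mul_one_div, div_lt_one hsqrt0]; linarith) (hSmem x hx).2 (hSmem _ hxh).2
      rw [div_pow, one_pow, ← pow_mul, show 36 * t * 2 = 72 * t by ring, mul_one_div,
        div_le_div_iff₀ (by positivity) hsqrt0] at hle
      linarith
  have hcard' : (S.card : ℝ) ≤ 2 ^ j / t ^ 2 + 1 := by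
    have h1 : (S.card : ℝ) ≤ ((2 ^ j / t ^ 2 : ℕ) : ℝ) + 1 := by exact_mod_cast hcard
    have h2 : ((2 ^ j / t ^ 2 : ℕ) : ℝ) ≤ ((2 ^ j : ℕ) : ℝ) / ((t ^ 2 : ℕ) : ℝ) := Nat.cast_div_le
    push_cast at h2
    linarith
  calc ∑ n ∈ S, 1 / (n : ℝ) ≤ ∑ n ∈ S, 1 / (2 : ℝ) ^ j :=
        Finset.sum_le_sum fun n hn => one_div_le_one_div_of_le (by positivity) (hSmem n hn).1
    _ = S.card * (1 / 2 ^ j) := by rw [Finset.sum_const, nsmul_eq_mul]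
    _ ≤ (2 ^ j / t ^ 2 + 1) * (1 / 2 ^ j) := by gcongr
    _ = 1 / t ^ 2 + (1 / 2) ^ j := by rw [div_pow, one_pow]; field_simp
    _ ≤ 1 / (y / 2) ^ 2 + (1 / 2) ^ j := by gcongr
    _ = _ := by field_simp; norm_num

lemma pow_le_of_lt_one_sub_sin {n : ℕ} (hn : 0 < n) (h : 1 / √(n : ℝ) < 1 - Real.sin n) :
    ((2 + Real.sin n) / 3) ^ n ≤ 18 / n := by
  have hn0 : (0 : ℝ) < n := by exact_mod_cast hn
  have hs0 : 0 < √(n : ℝ) := Real.sqrt_pos.2 hn0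
  have hsq : √(n : ℝ) ^ 2 = n := Real.sq_sqrt hn0.le
  have hbase : (2 + Real.sin n) / 3 ≤ Real.exp (-(1 / (3 * √(n : ℝ)))) := by
    refine le_trans ?_ (Real.one_sub_le_exp_neg _)
    have : 1 / (3 * √(n : ℝ)) = 1 / √(n : ℝ) / 3 := by field_simp
    rw [this]
    linarith
  calc ((2 + Real.sin n) / 3) ^ n ≤ Real.exp (-(1 / (3 * √(n : ℝ)))) ^ n :=
        pow_le_pow_left₀ (by linarith [Real.neg_one_le_sin n]) hbase n
    _ = (Real.exp (√(n : ℝ) / 3))⁻¹ := by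
        rw [← Real.exp_nat_mul, ← Real.exp_neg]
        congr 1
        field_simp
        linarith
    _ ≤ ((√(n : ℝ) / 3) ^ 2 / 2)⁻¹ := by
        gcongr
        have := Real.quadratic_le_exp_of_nonneg (show 0 ≤ √(n : ℝ) / 3 by positivity)
        linarith [show 0 ≤ √(n : ℝ) / 3 by positivity]
    _ = 18 / n := by rw [div_pow, hsq]; field_simp; norm_num

/-- The Borwein–Bailey–Girgensohn series
`S = ∑_{n=1}^∞ (1/n)·((2 + sin n)/3)^n` converges. -/
theorem bbg_series_converges :
    Summable (fun n : ℕ => (1 / (n + 1 : ℝ)) * ((2 + Real.sin (n + 1)) / 3) ^ (n + 1)) := by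
  have hmaj := ((Real.summable_one_div_nat_pow.2 one_lt_two).mul_left 18).add
    summable_one_div_of_sin_near_one
  have hsum : Summable fun n : ℕ => (1 / (n : ℝ)) * ((2 + Real.sin n) / 3) ^ n := by
    refine Summable.of_nonneg_of_le (fun n => ?_) (fun n => ?_) hmaj
    · have : 0 ≤ (2 + Real.sin n) / 3 := by linarith [Real.neg_one_le_sin n]
      positivity
    · rcases Nat.eq_zero_or_pos n with rfl | hn
      · simp
      have hn0 : (0 : ℝ) < n := by exact_mod_cast hn
      split_ifs with h
      · have hle : ((2 + Real.sin n) / 3) ^ n ≤ 1 :=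
          pow_le_one₀ (by linarith [Real.neg_one_le_sin n]) (by linarith [Real.sin_le_one n])
        calc 1 / (n : ℝ) * ((2 + Real.sin n) / 3) ^ n ≤ 1 / (n : ℝ) * 1 := by gcongr
          _ ≤ 18 * (1 / (n : ℝ) ^ 2) + 1 / n := by
            rw [mul_one]
            exact le_add_of_nonneg_left (by positivity)
      · calc 1 / (n : ℝ) * ((2 + Real.sin n) / 3) ^ n ≤ 1 / (n : ℝ) * (18 / n) := by
              have := pow_le_of_lt_one_sub_sin hn (not_le.1 h)
              gcongr
          _ = 18 * (1 / (n : ℝ) ^ 2) + 0 := by field_simp; ring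
  simpa using (summable_nat_add_iff 1).2 hsum
end

section
/- There exists a constant C > 0 such that for all integers n ≥ 1, I_n ≤ C/√n, where I_n = (1/(2π))·∫_0^{2π} ((2 + sin θ)/3)^n dθ. -/
/-- `I n = (1/(2π))·∫_0^{2π} ((2 + sin θ)/3)^n dθ`. -/
noncomputable def Iavg (n : ℕ) : ℝ :=
  (1 / (2 * Real.pi)) * ∫ θ in (0 : ℝ)..(2 * Real.pi), ((2 + Real.sin θ) / 3) ^ n

/-- Recentring the integral at the maximum of the integrand. -/
theorem Iavg_eq_integral_cos (n : ℕ) :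
    Iavg n = (1 / (2 * Real.pi)) *
      ∫ t in (-Real.pi)..Real.pi, ((2 + Real.cos t) / 3) ^ n := by
  have hper : Function.Periodic (fun θ : ℝ => ((2 + Real.sin θ) / 3) ^ n) (2 * Real.pi) :=
    fun θ => by simp only [Real.sin_add_two_pi]
  have hshift := hper.intervalIntegral_add_eq 0 (-Real.pi + Real.pi / 2)
  have hcomp := intervalIntegral.integral_comp_add_right (a := -Real.pi) (b := Real.pi)
    (fun θ : ℝ => ((2 + Real.sin θ) / 3) ^ n) (Real.pi / 2)
  simp only [Real.sin_add_pi_div_two] at hcomp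
  rw [zero_add, show -Real.pi + Real.pi / 2 + 2 * Real.pi = Real.pi + Real.pi / 2 by ring,
    ← hcomp] at hshift
  rw [Iavg, hshift]

/-- Gaussian bound for the recentred integrand. -/
theorem two_add_cos_div_three_pow_le (n : ℕ) {t : ℝ} (ht : |t| ≤ Real.pi) :
    ((2 + Real.cos t) / 3) ^ n ≤ Real.exp (-(2 / (3 * Real.pi ^ 2) * n) * t ^ 2) := by
  have hcos := Real.cos_le_one_sub_mul_cos_sq ht
  have hbase : (2 + Real.cos t) / 3 ≤ Real.exp (-(2 / (3 * Real.pi ^ 2)) * t ^ 2) := by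
    refine le_trans ?_ (Real.add_one_le_exp _)
    have : 2 / (3 * Real.pi ^ 2) = 2 / Real.pi ^ 2 / 3 := by field_simp
    rw [this]
    linarith
  have hnonneg : 0 ≤ (2 + Real.cos t) / 3 := by linarith [Real.neg_one_le_cos t]
  calc ((2 + Real.cos t) / 3) ^ n
      ≤ Real.exp (-(2 / (3 * Real.pi ^ 2)) * t ^ 2) ^ n := by gcongr
    _ = Real.exp (-(2 / (3 * Real.pi ^ 2) * n) * t ^ 2) := by
      rw [← Real.exp_nat_mul]
      ring_nf

/-- The integral of a Gaussian over an interval is at most its integral over the line. -/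
theorem intervalIntegral_exp_neg_mul_sq_le {b : ℝ} (hb : 0 < b) {x y : ℝ} (hxy : x ≤ y) :
    ∫ t in x..y, Real.exp (-b * t ^ 2) ≤ Real.sqrt (Real.pi / b) := by
  rw [intervalIntegral.integral_of_le hxy, ← integral_gaussian b]
  exact MeasureTheory.setIntegral_le_integral (integrable_exp_neg_mul_sq hb)
    (Filter.Eventually.of_forall fun t => (Real.exp_pos _).le)

/-- There is a constant `C > 0` with `I_n ≤ C/√n` for all `n ≥ 1`. -/
theorem Iavg_le_const_div_sqrt :
    ∃ C : ℝ, 0 < C ∧ ∀ n : ℕ, 1 ≤ n → Iavg n ≤ C / Real.sqrt n := by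
  have hpi := Real.pi_pos
  refine ⟨1 / (2 * Real.pi) * Real.sqrt (Real.pi / (2 / (3 * Real.pi ^ 2))), by positivity,
    fun n hn => ?_⟩
  have hn' : (0 : ℝ) < n := by exact_mod_cast hn
  rw [Iavg_eq_integral_cos, mul_div_assoc, ← Real.sqrt_div (by positivity), div_div]
  gcongr
  refine le_trans ?_ (intervalIntegral_exp_neg_mul_sq_le (by positivity)
    (neg_le_self hpi.le))
  refine intervalIntegral.integral_mono_on (neg_le_self hpi.le) ?_ ?_ fun t ht =>
    two_add_cos_div_three_pow_le n (abs_le.mpr ht)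
  · exact Continuous.intervalIntegrable (by fun_prop) _ _
  · exact Continuous.intervalIntegrable (by fun_prop) _ _
end

section
/- The series ∑_{k=1}^∞ 2·Re[G_k((2/3)·e^{ik})] converges and its sum equals S − log 6, where S = ∑_{n=1}^∞ (1/n)·((2 + sin n)/3)^n; that is, S = log 6 + ∑_{k=1}^∞ 2·Re[∑_{n=1}^∞ (c_k(n)/n)·((2/3)·e^{ik})^n]. -/
/-- The `k`-th complex Fourier coefficient
`c_k(n) = (1/(2π))·∫_0^{2π} (1 + (sin θ)/2)^n · e^{-ikθ} dθ`. -/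
noncomputable def ck (k n : ℕ) : ℂ :=
  (1 / (2 * Real.pi) : ℂ) *
    ∫ θ in (0 : ℝ)..(2 * Real.pi),
      (((1 + Real.sin θ / 2) ^ n : ℝ) : ℂ) * Complex.exp (-(Complex.I * k * θ))

/-- The Borwein–Bailey–Girgensohn series `S = ∑_{n≥1} (1/n)·((2 + sin n)/3)^n`. -/
noncomputable def Sbbg : ℝ :=
  ∑' n : ℕ, (1 / (n + 1 : ℝ)) * ((2 + Real.sin (n + 1)) / 3) ^ (n + 1)

/-- In a commutative ring where `x y = y - x`, `x z = x - z` and `2 y z = y - z`, a monomial in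
`x, y, z` splits, up to a power of `2`, into polynomials in the separate variables. -/
theorem exists_partial_fraction {R : Type*} [CommRing R] {x y z : R}
    (hxy : x * y = y - x) (hxz : x * z = x - z) (hyz : 2 * (y * z) = y - z) (N : ℕ) :
    ∀ a b c : ℕ, a + b + c = N → ∃ f g h : Polynomial ℤ,
      f.natDegree ≤ a ∧ g.natDegree ≤ b ∧ h.natDegree ≤ c ∧
      (1 ≤ a → |f.coeff a| = 2 ^ N) ∧
      (∀ j, |f.coeff j| ≤ 4 ^ N) ∧ (∀ j, |g.coeff j| ≤ 4 ^ N) ∧ (∀ j, |h.coeff j| ≤ 4 ^ N) ∧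
      2 ^ N * (x ^ a * y ^ b * z ^ c) =
        f.eval₂ (Int.castRingHom R) x + g.eval₂ (Int.castRingHom R) y +
          h.eval₂ (Int.castRingHom R) z := by
  have bound_sub (s : ℤ) (hs : |s| ≤ 2) (M : ℕ) (p q : Polynomial ℤ)
      (hp : ∀ j, |p.coeff j| ≤ 4 ^ M) (hq : ∀ j, |q.coeff j| ≤ 4 ^ M) (j : ℕ) :
      |(Polynomial.C s * (p - q)).coeff j| ≤ 4 ^ (M + 1) := by
    rw [Polynomial.coeff_C_mul, Polynomial.coeff_sub, abs_mul, pow_succ]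
    have := abs_sub (p.coeff j) (q.coeff j)
    nlinarith [hp j, hq j, abs_nonneg (p.coeff j - q.coeff j), abs_nonneg s]
  have deg_sub (s : ℤ) (d : ℕ) (p q : Polynomial ℤ) (hp : p.natDegree ≤ d)
      (hq : q.natDegree ≤ d) : (Polynomial.C s * (p - q)).natDegree ≤ d :=
    (Polynomial.natDegree_C_mul_le _ _).trans (Polynomial.natDegree_sub_le_of_le hp hq |>.trans
      (by simp))
  have bound_mono (k : ℕ) (j : ℕ) :
      |(Polynomial.C ((2 : ℤ) ^ k) * Polynomial.X ^ k).coeff j| ≤ 4 ^ k := by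
    rw [Polynomial.coeff_C_mul_X_pow]
    split_ifs
    · rw [abs_of_nonneg (by positivity)]
      exact pow_le_pow_left₀ (by norm_num) (by norm_num) k
    · simp
  have eval_mono (k : ℕ) (w : R) :
      (Polynomial.C ((2 : ℤ) ^ k) * Polynomial.X ^ k).eval₂ (Int.castRingHom R) w =
        2 ^ k * w ^ k := by
    rw [Polynomial.eval₂_mul, Polynomial.eval₂_C, Polynomial.eval₂_X_pow]
    simp
  induction N with
  | zero =>
    intro a b c habc
    obtain ⟨rfl, rfl, rfl⟩ : a = 0 ∧ b = 0 ∧ c = 0 := by omega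
    refine ⟨1, 0, 0, by simp, by simp, by simp, by simp, ?_, by simp, by simp, by simp⟩
    intro j
    rw [Polynomial.coeff_one]
    split_ifs <;> simp
  | succ N ih =>
    intro a b c habc
    rcases a with _ | a
    · rcases b with _ | b
      · obtain rfl : c = N + 1 := by omega
        refine ⟨0, 0, Polynomial.C (2 ^ (N + 1)) * Polynomial.X ^ (N + 1), by simp, by simp,
          Polynomial.natDegree_C_mul_X_pow_le _ _, by simp, by simp, by simp, bound_mono _,
          by rw [eval_mono]; simp⟩
      rcases c with _ | c
      · obtain rfl : b = N := by omega
        refine ⟨0, Polynomial.C (2 ^ (b + 1)) * Polynomial.X ^ (b + 1), 0, by simp,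
          Polynomial.natDegree_C_mul_X_pow_le _ _, by simp, by simp, by simp, bound_mono _,
          by simp, by rw [eval_mono]; simp⟩
      obtain ⟨f, g, h, hf, hg, hh, -, bf, bg, bh, e⟩ := ih 0 (b + 1) c (by omega)
      obtain ⟨f', g', h', hf', hg', hh', -, bf', bg', bh', e'⟩ := ih 0 b (c + 1) (by omega)
      refine ⟨Polynomial.C 1 * (f - f'), Polynomial.C 1 * (g - g'), Polynomial.C 1 * (h - h'),
        deg_sub _ _ _ _ hf hf', deg_sub _ _ _ _ hg (by omega), deg_sub _ _ _ _ (by omega) hh',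
        by simp, bound_sub _ (by simp) _ _ _ bf bf', bound_sub _ (by simp) _ _ _ bg bg',
        bound_sub _ (by simp) _ _ _ bh bh', ?_⟩
      simp only [map_one, one_mul, Polynomial.eval₂_sub]
      linear_combination e - e' + 2 ^ N * y ^ b * z ^ c * hyz
    · rcases b with _ | b
      · rcases c with _ | c
        · obtain rfl : a = N := by omega
          refine ⟨Polynomial.C (2 ^ (a + 1)) * Polynomial.X ^ (a + 1), 0, 0,
            Polynomial.natDegree_C_mul_X_pow_le _ _, by simp, by simp, ?_, bound_mono _, by simp,
            by simp, by rw [eval_mono]; simp⟩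
          intro _
          rw [Polynomial.coeff_C_mul_X_pow, if_pos rfl, abs_of_nonneg (by positivity)]
        obtain ⟨f, g, h, hf, hg, hh, tf, bf, bg, bh, e⟩ := ih (a + 1) 0 c (by omega)
        obtain ⟨f', g', h', hf', hg', hh', -, bf', bg', bh', e'⟩ := ih a 0 (c + 1) (by omega)
        refine ⟨Polynomial.C 2 * (f - f'), Polynomial.C 2 * (g - g'), Polynomial.C 2 * (h - h'),
          deg_sub _ _ _ _ hf (by omega), deg_sub _ _ _ _ hg hg', deg_sub _ _ _ _ (by omega) hh',
          ?_, bound_sub _ (by simp) _ _ _ bf bf', bound_sub _ (by simp) _ _ _ bg bg',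
          bound_sub _ (by simp) _ _ _ bh bh', ?_⟩
        · intro _
          rw [Polynomial.coeff_C_mul, Polynomial.coeff_sub,
            Polynomial.coeff_eq_zero_of_natDegree_lt (show f'.natDegree < a + 1 by omega),
            sub_zero, abs_mul, tf (by omega), pow_succ]
          norm_num [mul_comm]
        · simp only [Polynomial.eval₂_mul, Polynomial.eval₂_sub, map_ofNat, Polynomial.eval₂_ofNat]
          linear_combination 2 * (e - e') + 2 * 2 ^ N * x ^ a * z ^ c * hxz
      obtain ⟨f, g, h, hf, hg, hh, -, bf, bg, bh, e⟩ := ih a (b + 1) c (by omega)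
      obtain ⟨f', g', h', hf', hg', hh', tf, bf', bg', bh', e'⟩ := ih (a + 1) b c (by omega)
      refine ⟨Polynomial.C 2 * (f - f'), Polynomial.C 2 * (g - g'), Polynomial.C 2 * (h - h'),
        deg_sub _ _ _ _ (by omega) hf', deg_sub _ _ _ _ hg (by omega), deg_sub _ _ _ _ hh hh',
        ?_, bound_sub _ (by simp) _ _ _ bf bf', bound_sub _ (by simp) _ _ _ bg bg',
        bound_sub _ (by simp) _ _ _ bh bh', ?_⟩
      · intro _
        rw [Polynomial.coeff_C_mul, Polynomial.coeff_sub,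
          Polynomial.coeff_eq_zero_of_natDegree_lt (show f.natDegree < a + 1 by omega),
          zero_sub, abs_mul, abs_neg, tf (by omega), pow_succ]
        norm_num [mul_comm]
      · simp only [Polynomial.eval₂_mul, Polynomial.eval₂_sub, map_ofNat, Polynomial.eval₂_ofNat]
        linear_combination 2 * (e - e') + 2 * 2 ^ N * x ^ a * y ^ b * z ^ c * hxy

open PowerSeries in
theorem coeff_X_mul_mk_one_pow (j m : ℕ) :
    coeff (m + 1) ((X * mk 1 : PowerSeries ℤ) ^ (j + 1)) = m.choose j := by
  rw [mul_pow, mk_one_pow_eq_mk_choose_add, coeff_X_pow_mul']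
  split_ifs with h
  · rw [coeff_mk, show m + 1 - (j + 1) = m - j by omega, Nat.add_sub_cancel' (by omega)]
  · rw [Nat.choose_eq_zero_of_lt (by omega), Nat.cast_zero]

theorem hasSum_choose_mul_pow_div_factorial (j : ℕ) (z : ℂ) :
    HasSum (fun m : ℕ => (m.choose j : ℂ) * z ^ m / m.factorial)
      (z ^ j / j.factorial * Complex.exp z) := by
  have h := (NormedSpace.expSeries_div_hasSum_exp (𝔸 := ℂ) z).mul_left (z ^ j / j.factorial)
  rw [← Complex.exp_eq_exp_ℂ] at h
  have hz : ∑ m ∈ Finset.range j, (m.choose j : ℂ) * z ^ m / m.factorial = 0 :=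
    Finset.sum_eq_zero fun m hm => by
      rw [Nat.choose_eq_zero_of_lt (Finset.mem_range.mp hm)]; simp
  have hs : HasSum (fun i : ℕ => ((i + j).choose j : ℂ) * z ^ (i + j) / (i + j).factorial)
      (z ^ j / j.factorial * Complex.exp z) := by
    convert! h using 2 with i
    rw [add_comm i j, Nat.cast_add_choose ℂ, pow_add]
    have h1 : ((j + i).factorial : ℂ) ≠ 0 := by exact_mod_cast Nat.factorial_ne_zero _
    field_simp
  have := (hasSum_nat_add_iff (f := fun m : ℕ => (m.choose j : ℂ) * z ^ m / m.factorial) j).mp hs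
  rwa [hz, add_zero] at this

/-- The formal Borel transform of `φ / X` at `z`, as a sum in `ℂ`. -/
def BorelSum (φ : PowerSeries ℤ) (z s : ℂ) : Prop :=
  HasSum (fun m : ℕ => ((PowerSeries.coeff (m + 1) φ : ℤ) : ℂ) * z ^ m / m.factorial) s

theorem BorelSum.add {φ ψ : PowerSeries ℤ} {z s t : ℂ} (hφ : BorelSum φ z s)
    (hψ : BorelSum ψ z t) : BorelSum (φ + ψ) z (s + t) := by
  have h := HasSum.add hφ hψ
  unfold BorelSum
  convert! h using 2 with m
  simp [add_mul, add_div]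

theorem borelSum_eval₂ {φ : PowerSeries ℤ} {z : ℂ}
    (hφ : ∀ j : ℕ, BorelSum (φ ^ (j + 1)) z (z ^ j / j.factorial)) (f : Polynomial ℤ) (n : ℕ)
    (hf : f.natDegree ≤ n) :
    BorelSum (f.eval₂ (Int.castRingHom _) φ) z
      (∑ j ∈ Finset.range n, (f.coeff (j + 1) : ℂ) * (z ^ j / j.factorial)) := by
  rw [Polynomial.eval₂_eq_sum_range' _ (Nat.lt_succ_of_le hf),
    Finset.sum_range_succ', RingHom.ext_int (Int.castRingHom (PowerSeries ℤ)) PowerSeries.C]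
  have h := hasSum_sum (s := Finset.range n) fun j _ => (hφ j).mul_left (f.coeff (j + 1) : ℂ)
  unfold BorelSum
  convert! h using 2 with m
  simp only [map_add, map_sum, PowerSeries.coeff_C_mul, pow_zero, PowerSeries.coeff_one,
    Nat.succ_ne_zero, if_false, mul_zero, add_zero]
  push_cast
  rw [Finset.sum_mul, Finset.sum_div]
  refine Finset.sum_congr rfl fun j _ => ?_
  ring

theorem borelSum_X_pow (z : ℂ) (j : ℕ) :
    BorelSum (PowerSeries.X ^ (j + 1)) z (z ^ j / j.factorial) := by
  unfold BorelSum
  convert hasSum_ite_eq j (z ^ j / (j.factorial : ℂ)) using 2 with m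
  rw [PowerSeries.coeff_X_pow]
  by_cases h : m = j <;> simp [h]

open PowerSeries in
theorem borelSum_X_mul_mk_one_pow {z : ℂ} (hz : Complex.exp z = 1) (j : ℕ) :
    BorelSum ((X * mk 1) ^ (j + 1)) z (z ^ j / j.factorial) := by
  unfold BorelSum
  convert hasSum_choose_mul_pow_div_factorial j z using 2 with m
  · rw [coeff_X_mul_mk_one_pow]; simp
  · rw [hz, mul_one]

open PowerSeries in
theorem coeff_neg_rescale_pow (j m : ℕ) :
    coeff (m + 1) ((-rescale (-1) (X * mk 1 : PowerSeries ℤ)) ^ (j + 1))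
      = (-1) ^ (m + j) * m.choose j := by
  rw [neg_pow, ← map_pow, show ((-1 : PowerSeries ℤ)) = C (-1) by simp, ← map_pow, coeff_C_mul,
    coeff_rescale, coeff_X_mul_mk_one_pow]
  ring

open PowerSeries in
theorem borelSum_neg_rescale_pow {z : ℂ} (hz : Complex.exp z = 1) (j : ℕ) :
    BorelSum ((-rescale (-1) (X * mk 1)) ^ (j + 1)) z (z ^ j / j.factorial) := by
  unfold BorelSum
  have h := (hasSum_choose_mul_pow_div_factorial j (-z)).mul_left ((-1) ^ j)
  rw [Complex.exp_neg, hz, inv_one, mul_one, neg_pow z, ← mul_div_assoc, ← mul_assoc, ← pow_add,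
    Even.neg_one_pow ⟨j, rfl⟩, one_mul] at h
  convert! h using 2 with m
  rw [coeff_neg_rescale_pow, neg_pow z]
  push_cast
  ring

open PowerSeries in
theorem abs_coeff_mul_le {φ φ' ψ ψ' : PowerSeries ℤ} (h : ∀ m, |coeff m φ| ≤ coeff m ψ)
    (h' : ∀ m, |coeff m φ'| ≤ coeff m ψ') (m : ℕ) :
    |coeff m (φ * φ')| ≤ coeff m (ψ * ψ') := by
  rw [coeff_mul, coeff_mul]
  refine (Finset.abs_sum_le_sum_abs _ _).trans (Finset.sum_le_sum fun p _ => ?_)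
  rw [abs_mul]
  exact mul_le_mul (h _) (h' _) (abs_nonneg _) ((abs_nonneg _).trans (h _))

open PowerSeries in
theorem abs_coeff_pow_le {φ ψ : PowerSeries ℤ} (h : ∀ m, |coeff m φ| ≤ coeff m ψ) (n : ℕ) :
    ∀ m : ℕ, |coeff m (φ ^ n)| ≤ coeff m (ψ ^ n) := by
  induction n with
  | zero => intro m; rw [pow_zero, pow_zero, coeff_one]; split_ifs <;> simp
  | succ n ih => intro m; rw [pow_succ, pow_succ]; exact abs_coeff_mul_le ih h m

open PowerSeries in
theorem abs_coeff_monomial_le (a b c m : ℕ) :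
    |coeff m (X ^ a * (X * mk 1) ^ b * (-rescale (-1) (X * mk 1 : PowerSeries ℤ)) ^ c)|
      ≤ coeff m ((X * mk 1 : PowerSeries ℤ) ^ (a + b + c)) := by
  have hc (m : ℕ) : coeff m (X * mk 1 : PowerSeries ℤ) = if m = 0 then 0 else 1 := by
    rcases m with _ | m
    · simp
    · simp
  rw [pow_add, pow_add]
  refine abs_coeff_mul_le (abs_coeff_mul_le (abs_coeff_pow_le (fun m => ?_) a)
    (abs_coeff_pow_le (fun m => ?_) b)) (abs_coeff_pow_le (fun m => ?_) c) m
  · rw [hc, coeff_X]; split_ifs <;> simp_all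
  · rw [hc]; split_ifs <;> simp
  · rw [map_neg, coeff_rescale, hc]; split_ifs <;> simp

open PowerSeries in
theorem norm_borelSum_monomial_le (a b c : ℕ) {z s : ℂ}
    (h : BorelSum (X ^ (a + 1) * (X * mk 1) ^ b * (-rescale (-1) (X * mk 1)) ^ c) z s) :
    ‖s‖ ≤ ‖z‖ ^ (a + b + c) / (a + b + c).factorial * Real.exp ‖z‖ := by
  have h1 : HasSum (fun m : ℕ => (m.choose (a + b + c) : ℝ) * ‖z‖ ^ m / m.factorial)
      (‖z‖ ^ (a + b + c) / (a + b + c).factorial * Real.exp ‖z‖) := by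
    have := hasSum_choose_mul_pow_div_factorial (a + b + c) (‖z‖ : ℂ)
    rw [← Complex.hasSum_ofReal]
    push_cast
    exact this
  rw [← h.tsum_eq]
  refine tsum_of_norm_bounded h1 fun m => ?_
  rw [norm_div, norm_mul, norm_pow, Complex.norm_natCast, Complex.norm_intCast]
  gcongr
  have := abs_coeff_monomial_le (a + 1) b c (m + 1)
  rw [show a + 1 + b + c = a + b + c + 1 by ring, coeff_X_mul_mk_one_pow] at this
  exact_mod_cast this

open PowerSeries in
/-- Type I Hermite–Padé approximation to `1, e^z, e^{-z}` at `z = 2πi`. -/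
theorem exists_hermite_coefficients (l : ℕ) : ∃ h : ℕ → ℤ,
    |h l| = 2 ^ (3 * l + 1) ∧ (∀ j, |h j| ≤ 3 * 4 ^ (3 * l + 1)) ∧
    ‖∑ j ∈ Finset.range (l + 1), (h j : ℂ) * ((2 * Real.pi * Complex.I) ^ j / j.factorial)‖ ≤
      2 ^ (3 * l + 1) *
        ((2 * Real.pi) ^ (3 * l) / (3 * l).factorial * Real.exp (2 * Real.pi)) := by
  set U : PowerSeries ℤ := mk 1 with hU
  have hU1 : U * (1 - X) = 1 := mk_one_mul_one_sub_eq_one ℤ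
  have hV1 : rescale (-1) U * (1 + X) = 1 := by
    have := congrArg (rescale (-1 : ℤ)) hU1
    rw [map_mul, map_sub, map_one, rescale_neg_one_X, sub_neg_eq_add] at this
    exact this
  have hZ : -rescale (-1) (X * U) = X * rescale (-1) U := by
    rw [map_mul, rescale_neg_one_X]; ring
  have hxy : X * (X * U) = X * U - X := by linear_combination -X * hU1
  have hxz : X * (-rescale (-1) (X * U)) = X - -rescale (-1) (X * U) := by
    rw [hZ]; linear_combination X * hV1
  have hyz : 2 * (X * U * -rescale (-1) (X * U)) = X * U - -rescale (-1) (X * U) := by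
    rw [hZ]
    linear_combination X * U * hV1 - X * rescale (-1) U * hU1
  obtain ⟨f, g, h, hf, hg, hh, tf, bf, bg, bh, e⟩ :=
    exists_partial_fraction hxy hxz hyz (3 * l + 1) (l + 1) l l (by ring)
  have hexp : Complex.exp (2 * Real.pi * Complex.I) = 1 := Complex.exp_two_pi_mul_I
  have hnorm : ‖(2 * Real.pi * Complex.I : ℂ)‖ = 2 * Real.pi := by
    simp [abs_of_pos Real.pi_pos]
  refine ⟨fun j => f.coeff (j + 1) + g.coeff (j + 1) + h.coeff (j + 1), ?_, fun j => ?_, ?_⟩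
  · beta_reduce
    rw [Polynomial.coeff_eq_zero_of_natDegree_lt (show g.natDegree < l + 1 by omega),
      Polynomial.coeff_eq_zero_of_natDegree_lt (show h.natDegree < l + 1 by omega), add_zero,
      add_zero, tf (by omega)]
  · have := abs_add_three (f.coeff (j + 1)) (g.coeff (j + 1)) (h.coeff (j + 1))
    linarith [bf (j + 1), bg (j + 1), bh (j + 1)]
  · have hs := ((borelSum_eval₂ (borelSum_X_pow _) f (l + 1) hf).add
      (borelSum_eval₂ (borelSum_X_mul_mk_one_pow hexp) g (l + 1) (by omega))).add
      (borelSum_eval₂ (borelSum_neg_rescale_pow hexp) h (l + 1) (by omega))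
    rw [← hU, ← Finset.sum_add_distrib, ← Finset.sum_add_distrib] at hs
    have hs' : BorelSum (2 ^ (3 * l + 1) *
        (X ^ (l + 1) * (X * mk 1) ^ l * (-rescale (-1) (X * mk 1)) ^ l))
        (2 * Real.pi * Complex.I) (∑ j ∈ Finset.range (l + 1),
          ((f.coeff (j + 1) + g.coeff (j + 1) + h.coeff (j + 1) : ℤ) : ℂ) *
            ((2 * Real.pi * Complex.I) ^ j / j.factorial)) := by
      rw [← hU, e]
      convert! hs using 1
      refine Finset.sum_congr rfl fun j _ => ?_
      push_cast
      ring
    have hm : BorelSum (X ^ (l + 1) * (X * mk 1) ^ l * (-rescale (-1) (X * mk 1)) ^ l)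
        (2 * Real.pi * Complex.I) ((2 ^ (3 * l + 1))⁻¹ * ∑ j ∈ Finset.range (l + 1),
          ((f.coeff (j + 1) + g.coeff (j + 1) + h.coeff (j + 1) : ℤ) : ℂ) *
            ((2 * Real.pi * Complex.I) ^ j / j.factorial)) := by
      have := HasSum.mul_left ((2 ^ (3 * l + 1) : ℂ)⁻¹) hs'
      unfold BorelSum
      convert! this using 2 with m
      rw [show (2 : PowerSeries ℤ) ^ (3 * l + 1) = C (2 ^ (3 * l + 1)) by simp, coeff_C_mul]
      push_cast
      field_simp
    have := norm_borelSum_monomial_le _ _ _ hm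
    rw [norm_mul, norm_inv, norm_pow, Complex.norm_ofNat, hnorm,
      show l + l + l = 3 * l by ring] at this
    rwa [inv_mul_le_iff₀ (by positivity)] at this

theorem one_le_norm_gaussian_sum {l p q : ℕ} (hl : l.Prime) (hl2 : l ≠ 2) (hp : ¬ l ∣ p)
    (hq : q ≠ 0) {h : ℕ → ℤ} {s : ℕ} (hh : |h l| = 2 ^ s) :
    1 ≤ l.factorial * q ^ l *
      ‖∑ j ∈ Finset.range (l + 1), (h j : ℂ) * ((p / q * Complex.I) ^ j / j.factorial)‖ := by
  set i : GaussianInt := ⟨0, 1⟩ with hi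
  have hic : GaussianInt.toComplex i = Complex.I := by simp [hi, GaussianInt.toComplex_def']
  set G : GaussianInt := ∑ j ∈ Finset.range (l + 1),
    (h j : GaussianInt) * (l.descFactorial (l - j) : ℕ) * i ^ j * (p : GaussianInt) ^ j *
      (q : GaussianInt) ^ (l - j) with hG
  have hq' : (q : ℂ) ≠ 0 := by exact_mod_cast hq
  have hGc : GaussianInt.toComplex G = l.factorial * q ^ l *
      ∑ j ∈ Finset.range (l + 1), (h j : ℂ) * ((p / q * Complex.I) ^ j / j.factorial) := by
    rw [hG, map_sum, Finset.mul_sum]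
    refine Finset.sum_congr rfl fun j hj => ?_
    have hjl : j ≤ l := Nat.lt_succ_iff.mp (Finset.mem_range.mp hj)
    have hf : (l.factorial : ℂ) = j.factorial * l.descFactorial (l - j) := by
      have := Nat.factorial_mul_descFactorial (Nat.sub_le l j)
      rw [Nat.sub_sub_self hjl] at this
      exact_mod_cast this.symm
    have hpow : (q : ℂ) ^ l = q ^ j * q ^ (l - j) := by rw [← pow_add, Nat.add_sub_cancel' hjl]
    have hj0 : (j.factorial : ℂ) ≠ 0 := by exact_mod_cast Nat.factorial_ne_zero j
    simp only [map_mul, map_pow, map_intCast, map_natCast, hic]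
    rw [hf, hpow, mul_pow, div_pow]
    field_simp
  have hG0 : G ≠ 0 := by
    intro h0
    rw [hG, Finset.sum_range_succ] at h0
    have hdvd : (l : GaussianInt) ∣ ∑ j ∈ Finset.range l,
        (h j : GaussianInt) * (l.descFactorial (l - j) : ℕ) * i ^ j * (p : GaussianInt) ^ j *
          (q : GaussianInt) ^ (l - j) := by
      refine Finset.dvd_sum fun j hj => ?_
      obtain ⟨k, hk⟩ : ∃ k, l - j = k + 1 := ⟨l - j - 1, by
        have := Finset.mem_range.mp hj; omega⟩
      obtain ⟨l', rfl⟩ : ∃ l', l = l' + 1 := ⟨l - 1, by have := hl.pos; omega⟩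
      rw [hk, Nat.succ_descFactorial_succ]
      have : (((l' + 1 : ℕ)) : GaussianInt) ∣ (((l' + 1) * l'.descFactorial k : ℕ) : GaussianInt) :=
        Nat.cast_dvd_cast (Dvd.intro _ rfl)
      exact (((this.mul_left _).mul_right _).mul_right _).mul_right _
    have hdvd2 : (l : GaussianInt) ∣ (h l : GaussianInt) * i ^ l * (p : GaussianInt) ^ l := by
      have := (dvd_neg.mpr hdvd)
      rw [neg_eq_of_add_eq_zero_right h0] at this
      simpa using this
    have hii : i * (-i) = 1 := by rw [hi]; ext <;> simp
    have hdvd3 : ((l : ℤ) : GaussianInt) ∣ ((h l * p ^ l : ℤ) : GaussianInt) := by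
      have := hdvd2.mul_right ((-i) ^ l)
      rw [show (h l : GaussianInt) * i ^ l * (p : GaussianInt) ^ l * (-i) ^ l =
        h l * p ^ l * (i * (-i)) ^ l by rw [mul_pow i]; ring, hii, one_pow, mul_one] at this
      exact_mod_cast this
    rw [Zsqrtd.intCast_dvd_intCast] at hdvd3
    have hlp : Prime (l : ℤ) := Nat.prime_iff_prime_int.mp hl
    rcases hlp.dvd_or_dvd hdvd3 with h1 | h1
    · rw [← dvd_abs, hh] at h1
      have h2 := hlp.dvd_of_dvd_pow h1
      exact hl2 ((Nat.prime_dvd_prime_iff_eq hl Nat.prime_two).mp (by exact_mod_cast h2))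
    · exact hp (by exact_mod_cast hlp.dvd_of_dvd_pow h1)
  have h1 : (1 : ℝ) ≤ ‖GaussianInt.toComplex G‖ ^ 2 := by
    rw [← Complex.normSq_eq_norm_sq, ← GaussianInt.intCast_real_norm]
    exact_mod_cast GaussianInt.norm_pos.mpr hG0
  have h2 : 1 ≤ ‖GaussianInt.toComplex G‖ := by
    by_contra! hlt
    nlinarith [norm_nonneg (GaussianInt.toComplex G)]
  rw [hGc, norm_mul, norm_mul, norm_pow, Complex.norm_natCast, Complex.norm_natCast] at h2
  exact h2

theorem exists_prime_not_dvd {p X : ℕ} (hp : 0 < p) (hX : 0 < X) (hpX : p < 8 * X ^ 3) :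
    ∃ l : ℕ, l.Prime ∧ ¬ l ∣ p ∧ X < l ∧ l ≤ 8 * X := by
  obtain ⟨a, ha, ha1, ha2⟩ := Nat.exists_prime_lt_and_le_two_mul X (by omega)
  obtain ⟨b, hb, hb1, hb2⟩ := Nat.exists_prime_lt_and_le_two_mul (2 * X) (by omega)
  obtain ⟨c, hc, hc1, hc2⟩ := Nat.exists_prime_lt_and_le_two_mul (4 * X) (by omega)
  by_contra! h
  have hda : a ∣ p := by by_contra hn; exact absurd (h a ha hn (by omega)) (by omega)
  have hdb : b ∣ p := by by_contra hn; exact absurd (h b hb hn (by omega)) (by omega)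
  have hdc : c ∣ p := by by_contra hn; exact absurd (h c hc hn (by omega)) (by omega)
  have hab : a.Coprime b := (Nat.coprime_primes ha hb).mpr (by omega)
  have hac : a.Coprime c := (Nat.coprime_primes ha hc).mpr (by omega)
  have hbc : b.Coprime c := (Nat.coprime_primes hb hc).mpr (by omega)
  have hd : a * b * c ∣ p :=
    Nat.Coprime.mul_dvd_of_dvd_of_dvd (Nat.Coprime.mul_left hac hbc)
      (Nat.Coprime.mul_dvd_of_dvd_of_dvd hab hda hdb) hdc
  have hle := Nat.le_of_dvd hp hd
  have : X * (2 * X) * (4 * X) ≤ a * b * c := by gcongr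
  nlinarith

theorem factorial_div_factorial_three_mul_le (l : ℕ) (hl : 0 < l) :
    (l.factorial : ℝ) / (3 * l).factorial ≤ (9 / (l : ℝ) ^ 2) ^ l := by
  have h1 : ((l : ℝ) ^ l / l.factorial) ≤ 3 ^ l := by
    refine (Real.pow_div_factorial_le_exp (l : ℝ) (by positivity) l).trans ?_
    rw [← Real.exp_one_pow]
    exact pow_le_pow_left₀ (by positivity) (by linarith [Real.exp_one_lt_d9]) l
  have h2 : (l.factorial : ℝ) ^ 3 ≤ (3 * l).factorial := by
    have := Nat.le_of_dvd (Nat.factorial_pos _)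
      (Nat.prod_factorial_dvd_factorial_sum (Finset.range 3) (fun _ => l))
    simp only [Finset.prod_const, Finset.sum_const, Finset.card_range, smul_eq_mul] at this
    exact_mod_cast this
  have hf : (0 : ℝ) < l.factorial := by positivity
  have hl' : (0 : ℝ) < l := by exact_mod_cast hl
  calc (l.factorial : ℝ) / (3 * l).factorial ≤ l.factorial / (l.factorial : ℝ) ^ 3 := by gcongr
    _ = (1 / l.factorial) ^ 2 := by field_simp
    _ ≤ (3 ^ l / (l : ℝ) ^ l) ^ 2 := by
      refine pow_le_pow_left₀ (by positivity) ?_ 2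
      rw [div_le_div_iff₀ hf (by positivity), one_mul]
      rwa [div_le_iff₀ hf] at h1
    _ = (9 / (l : ℝ) ^ 2) ^ l := by
      rw [← div_pow, ← pow_mul, mul_comm, pow_mul, div_pow]; norm_num

theorem norm_sum_sub_sum_le {l : ℕ} {h : ℕ → ℤ} {M x y : ℝ} (hh : ∀ j, |(h j : ℝ)| ≤ M)
    (hx : |x| ≤ 8) (hy : |y| ≤ 8) :
    ‖∑ j ∈ Finset.range (l + 1), (h j : ℂ) * ((x * Complex.I) ^ j / j.factorial) -
      ∑ j ∈ Finset.range (l + 1), (h j : ℂ) * ((y * Complex.I) ^ j / j.factorial)‖ ≤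
      (l + 1) * (M * (|x - y| * l * 8 ^ l)) := by
  have hM : 0 ≤ M := (abs_nonneg _).trans (hh 0)
  rw [← Finset.sum_sub_distrib]
  refine (norm_sum_le _ _).trans ?_
  refine (Finset.sum_le_card_nsmul _ _ (M * (|x - y| * l * 8 ^ l)) fun j hj => ?_).trans ?_
  · have hjl : j ≤ l := Nat.lt_succ_iff.mp (Finset.mem_range.mp hj)
    rw [← mul_sub, ← sub_div, mul_pow, mul_pow, ← sub_mul, norm_mul, norm_div, norm_mul, norm_pow,
      Complex.norm_I, one_pow, mul_one, Complex.norm_intCast, Complex.norm_natCast,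
      ← Complex.ofReal_pow, ← Complex.ofReal_pow, ← Complex.ofReal_sub, Complex.norm_real,
      Real.norm_eq_abs]
    gcongr
    · exact hh j
    refine (div_le_self (abs_nonneg _)
      (by exact_mod_cast Nat.one_le_iff_ne_zero.mpr (Nat.factorial_ne_zero j))).trans ?_
    refine (abs_pow_sub_pow_le x y j).trans ?_
    gcongr
    calc max |x| |y| ^ (j - 1) ≤ 8 ^ (j - 1) := by gcongr; exact max_le hx hy
      _ ≤ 8 ^ l := pow_le_pow_right₀ (by norm_num) (by omega)
  · rw [Finset.card_range, nsmul_eq_mul]; push_cast; rfl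

theorem one_le_abs_two_pi_mul_sub_mul_pow {p q : ℕ} (hq : 0 < q)
    (hpq : |2 * Real.pi * q - p| < 1) : ∃ l : ℕ, (l : ℝ) ≤ 8000 * √q ∧
      1 ≤ |2 * Real.pi * q - p| * (8192 * l * q) ^ l := by
  have hq1 : (1 : ℝ) ≤ q := by exact_mod_cast hq
  obtain ⟨hpq1, hpq2⟩ := abs_lt.mp hpq
  have hpi3 := Real.pi_gt_three
  have hpi := Real.pi_lt_d2
  have hp0 : 0 < p := by
    have : (0 : ℝ) < p := by nlinarith
    exact_mod_cast this
  have hp8 : (p : ℝ) ≤ 8 * q := by nlinarith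
  have hs := Nat.lt_succ_sqrt q
  have hs' := Nat.sqrt_le q
  set s := Nat.sqrt q
  have hss : q < (s + 1) ^ 3 := by
    have : (s + 1) * (s + 1) ≤ (s + 1) ^ 3 := by
      rw [pow_succ, ← sq]; exact Nat.le_mul_of_pos_right _ (by omega)
    exact hs.trans_le this
  obtain ⟨l, hl, hlp, hl1, hl2⟩ := exists_prime_not_dvd (X := 500 * (s + 1)) hp0 (by positivity) (by
    have : (p : ℕ) ≤ 8 * q := by exact_mod_cast hp8
    rw [mul_pow]; omega)
  have hl0 : (500 : ℝ) * (s + 1) < l := by exact_mod_cast hl1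
  have hl4 : 500 ≤ l := by nlinarith
  have hl4' : (500 : ℝ) ≤ l := by exact_mod_cast hl4
  refine ⟨l, ?_, ?_⟩
  · have h1 : (s : ℝ) ≤ √q := Real.le_sqrt_of_sq_le (by rw [sq]; exact_mod_cast hs')
    have h2 : 1 ≤ √(q : ℝ) := Real.one_le_sqrt.mpr hq1
    have h3 : (l : ℝ) ≤ 8 * (500 * (s + 1)) := by exact_mod_cast hl2
    linarith
  obtain ⟨h, h1, h2, h3⟩ := exists_hermite_coefficients l
  have h4 := one_le_norm_gaussian_sum hl (by omega) hlp hq.ne' h1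
  have h5 := norm_sum_sub_sum_le (l := l) (h := h) (M := 3 * 4 ^ (3 * l + 1)) (x := p / q)
    (y := 2 * Real.pi) (fun j => by exact_mod_cast h2 j)
    (by rw [abs_of_nonneg (by positivity), div_le_iff₀ (by positivity)]; exact hp8)
    (by rw [abs_of_pos (by positivity)]; linarith)
  push_cast at h5
  have h6 := norm_le_norm_sub_add
    (∑ j ∈ Finset.range (l + 1), (h j : ℂ) * ((p / q * Complex.I) ^ j / j.factorial))
    (∑ j ∈ Finset.range (l + 1), (h j : ℂ) * ((2 * Real.pi * Complex.I) ^ j / j.factorial))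
  have h7 : (l.factorial : ℝ) * q ^ l * (2 ^ (3 * l + 1) *
      ((2 * Real.pi) ^ (3 * l) / (3 * l).factorial * Real.exp (2 * Real.pi))) ≤ 1 / 2 := by
    have e1 : Real.exp (2 * Real.pi) ≤ 3 ^ 7 := by
      calc Real.exp (2 * Real.pi) ≤ Real.exp (1 * 7) := Real.exp_le_exp.mpr (by linarith)
        _ = Real.exp 1 ^ 7 := by rw [← Real.exp_nat_mul]; norm_num
        _ ≤ 3 ^ 7 := by gcongr; linarith [Real.exp_one_lt_d9]
    calc (l.factorial : ℝ) * q ^ l * (2 ^ (3 * l + 1) *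
          ((2 * Real.pi) ^ (3 * l) / (3 * l).factorial * Real.exp (2 * Real.pi)))
        = q ^ l * 2 ^ (3 * l + 1) * (2 * Real.pi) ^ (3 * l) *
          (l.factorial / (3 * l).factorial) * Real.exp (2 * Real.pi) := by ring
      _ ≤ q ^ l * 2 ^ (3 * l + 1) * 7 ^ (3 * l) * (9 / (l : ℝ) ^ 2) ^ l * 3 ^ 7 := by
        gcongr
        · linarith
        · exact factorial_div_factorial_three_mul_le l (by omega)
      _ = 4374 * (24696 * q / (l : ℝ) ^ 2) ^ l := by
        rw [pow_succ, pow_mul, pow_mul, div_pow, div_pow, mul_pow,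
          show (24696 : ℝ) = 2 ^ 3 * 7 ^ 3 * 9 by norm_num, mul_pow, mul_pow]; ring
      _ ≤ 4374 * (1 / 10) ^ l := by
        refine mul_le_mul_of_nonneg_left (pow_le_pow_left₀ (by positivity) ?_ l) (by norm_num)
        rw [div_le_div_iff₀ (by positivity) (by norm_num)]
        have : (q : ℝ) ≤ (s + 1) * (s + 1) := by exact_mod_cast hs.le
        nlinarith
      _ ≤ 4374 * (1 / 10) ^ 4 := by
        exact mul_le_mul_of_nonneg_left
          (pow_le_pow_of_le_one (by norm_num) (by norm_num) (by omega)) (by norm_num)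
      _ ≤ 1 / 2 := by norm_num
  set ε := |2 * Real.pi * q - p| with hε
  have h8 : |(p : ℝ) / q - 2 * Real.pi| ≤ ε := by
    rw [show (p : ℝ) / q - 2 * Real.pi = -((2 * Real.pi * q - p) / q) by field_simp; ring, abs_neg,
      abs_div, abs_of_nonneg (by positivity : (0 : ℝ) ≤ q)]
    exact div_le_self (abs_nonneg _) hq1
  have hlt : (l : ℝ) + 1 ≤ 2 ^ l := by exact_mod_cast Nat.lt_two_pow_self (n := l)
  have h12 : (12 : ℝ) ≤ 2 ^ l := by linarith
  have h9 : (l.factorial : ℝ) * q ^ l * ((l + 1) * (3 * 4 ^ (3 * l + 1) *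
      (|(p : ℝ) / q - 2 * Real.pi| * l * 8 ^ l))) ≤ ε * (4096 * l * q) ^ l := by
    calc (l.factorial : ℝ) * q ^ l * ((l + 1) * (3 * 4 ^ (3 * l + 1) *
          (|(p : ℝ) / q - 2 * Real.pi| * l * 8 ^ l)))
        = l.factorial * q ^ l * (l + 1) * 12 * 4 ^ (3 * l) *
          |(p : ℝ) / q - 2 * Real.pi| * l * 8 ^ l := by ring
      _ ≤ (l : ℝ) ^ l * q ^ l * 2 ^ l * 2 ^ l * 4 ^ (3 * l) * ε * 2 ^ l * 8 ^ l := by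
        gcongr
        · exact_mod_cast Nat.factorial_le_pow l
        · linarith
      _ = ε * (4096 * l * q) ^ l := by
        rw [pow_mul, show (4096 : ℝ) = 2 * 2 * 4 ^ 3 * 2 * 8 by norm_num]
        simp only [mul_pow]
        ring
  have h10 : 1 ≤ 1 / 2 + ε * (4096 * l * q) ^ l := by
    refine h4.trans ((mul_le_mul_of_nonneg_left h6 (by positivity)).trans ?_)
    rw [mul_add, add_comm]
    exact add_le_add ((mul_le_mul_of_nonneg_left h3 (by positivity)).trans h7)
      ((mul_le_mul_of_nonneg_left h5 (by positivity)).trans h9)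
  have h11 : ε * (2 * (4096 * l * q) ^ l) ≤ ε * (8192 * l * q) ^ l := by
    rw [show (8192 : ℝ) * l * q = 2 * (4096 * l * q) by ring, mul_pow 2]
    gcongr
    linarith
  linarith

theorem exists_exp_neg_le_abs_two_pi_mul_sub : ∃ C : ℝ, 0 < C ∧ ∀ p q : ℕ, 0 < q →
    Real.exp (-(C * (q : ℝ) ^ (2 / 3 : ℝ))) ≤ |2 * Real.pi * q - p| := by
  set K : ℝ := 8192 * 8000 with hK
  have hK0 : 0 ≤ Real.log K := Real.log_nonneg (by norm_num)
  refine ⟨8000 * (Real.log K + 9), by positivity, fun p q hq => ?_⟩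
  have hq1 : (1 : ℝ) ≤ q := by exact_mod_cast hq
  rcases le_or_gt 1 |2 * Real.pi * q - p| with h1 | h1
  · refine le_trans (Real.exp_le_one_iff.mpr ?_) h1
    have : 0 ≤ 8000 * (Real.log K + 9) * (q : ℝ) ^ (2 / 3 : ℝ) := by positivity
    linarith
  obtain ⟨l, hl, hle⟩ := one_le_abs_two_pi_mul_sub_mul_pow hq h1
  have hsq : 1 ≤ √(q : ℝ) := Real.one_le_sqrt.mpr hq1
  have hbase : 8192 * (l : ℝ) * q ≤ Real.exp (Real.log K + 3 / 2 * Real.log q) := by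
    rw [Real.exp_add, Real.exp_log (by norm_num), mul_comm (3 / 2),
      ← Real.rpow_def_of_pos (by positivity),
      show (3 / 2 : ℝ) = 1 / 2 + 1 by norm_num, Real.rpow_add (by positivity), ← Real.sqrt_eq_rpow,
      Real.rpow_one, hK]
    calc 8192 * (l : ℝ) * q ≤ 8192 * (8000 * √q) * q := by gcongr
      _ = _ := by ring
  have hlog : Real.log q ≤ 6 * (q : ℝ) ^ (1 / 6 : ℝ) := by
    have := Real.log_le_rpow_div (x := q) (by positivity) (show (0 : ℝ) < 1 / 6 by norm_num)
    linarith
  have hlog0 : 0 ≤ Real.log (q : ℝ) := Real.log_nonneg hq1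
  have h6 : 1 ≤ (q : ℝ) ^ (1 / 6 : ℝ) := Real.one_le_rpow hq1 (by norm_num)
  have hpow : (8192 * (l : ℝ) * q) ^ l ≤
      Real.exp (8000 * (Real.log K + 9) * (q : ℝ) ^ (2 / 3 : ℝ)) := by
    calc (8192 * (l : ℝ) * q) ^ l ≤ Real.exp (Real.log K + 3 / 2 * Real.log q) ^ l := by gcongr
      _ = Real.exp (l * (Real.log K + 3 / 2 * Real.log q)) := by rw [Real.exp_nat_mul]
      _ ≤ _ := by
        rw [Real.exp_le_exp, show (2 / 3 : ℝ) = 1 / 2 + 1 / 6 by norm_num,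
          Real.rpow_add (by positivity), ← Real.sqrt_eq_rpow]
        calc (l : ℝ) * (Real.log K + 3 / 2 * Real.log q)
            ≤ 8000 * √q * ((Real.log K + 9) * (q : ℝ) ^ (1 / 6 : ℝ)) := by
              gcongr
              have := le_mul_of_one_le_right hK0 h6
              linarith
          _ = _ := by ring
  rw [Real.exp_neg, inv_le_iff_one_le_mul₀ (Real.exp_pos _)]
  refine hle.trans ?_
  gcongr

theorem exists_exp_neg_le_norm_exp_sub_one : ∃ C : ℝ, 0 < C ∧ ∀ d : ℕ, 0 < d →
    Real.exp (-(C * (d : ℝ) ^ (2 / 3 : ℝ))) ≤ ‖Complex.exp (Complex.I * d) - 1‖ := by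
  obtain ⟨C, hC, h⟩ := exists_exp_neg_le_abs_two_pi_mul_sub
  refine ⟨C + 1, by positivity, fun d hd => ?_⟩
  have hd1 : (1 : ℝ) ≤ d := by exact_mod_cast hd
  have hdp : 1 ≤ (d : ℝ) ^ (2 / 3 : ℝ) := Real.one_le_rpow hd1 (by norm_num)
  have hpi := Real.pi_pos
  have hpi3 := Real.pi_gt_three
  have hpi4 := Real.pi_le_four
  obtain ⟨m, hm⟩ : ∃ m : ℕ, |2 * Real.pi * m - d| ≤ Real.pi := by
    refine ⟨⌊d / (2 * Real.pi) + 1 / 2⌋₊, ?_⟩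
    have h1 := Nat.floor_le (show 0 ≤ (d : ℝ) / (2 * Real.pi) + 1 / 2 by positivity)
    have h2 := Nat.lt_floor_add_one ((d : ℝ) / (2 * Real.pi) + 1 / 2)
    set m := ⌊(d : ℝ) / (2 * Real.pi) + 1 / 2⌋₊
    have h3 : (d : ℝ) / (2 * Real.pi) * (2 * Real.pi) = d := by field_simp
    rw [abs_le]
    constructor <;> nlinarith
  set x : ℝ := d - 2 * Real.pi * m with hx
  have hxm : |x| = |2 * Real.pi * m - d| := by rw [hx, abs_sub_comm]
  have hexp : Complex.exp (Complex.I * d) = Complex.exp (Complex.I * x) := by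
    rw [Complex.exp_eq_exp_iff_exists_int]
    refine ⟨m, ?_⟩
    rw [hx]
    push_cast
    ring
  have hlow : |x| / 2 ≤ ‖Complex.exp (Complex.I * d) - 1‖ := by
    rw [hexp, Complex.norm_exp_I_mul_ofReal_sub_one, norm_mul, Real.norm_eq_abs, Real.norm_eq_abs,
      abs_two]
    have h1 := Real.mul_abs_le_abs_sin (x := x / 2) (by
      rw [abs_div, abs_two]; linarith)
    have h2 : 1 / 2 ≤ 2 / Real.pi := by
      rw [div_le_div_iff₀ (by norm_num) hpi]; linarith
    rw [abs_div, abs_two] at h1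
    have := mul_le_mul_of_nonneg_right h2 (show 0 ≤ |x| / 2 by positivity)
    linarith
  have hhalf : Real.exp (-((d : ℝ) ^ (2 / 3 : ℝ))) ≤ 1 / 2 := by
    rw [Real.exp_neg, one_div]
    refine inv_anti₀ (by norm_num) ?_
    linarith [Real.add_one_le_exp ((d : ℝ) ^ (2 / 3 : ℝ))]
  have hmain : Real.exp (-(C * (d : ℝ) ^ (2 / 3 : ℝ))) ≤ |x| := by
    rcases Nat.eq_zero_or_pos m with rfl | hm0
    · have : |x| = d := by rw [hx]; simp
      rw [this]
      refine le_trans (Real.exp_le_one_iff.mpr ?_) hd1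
      have : 0 ≤ C * (d : ℝ) ^ (2 / 3 : ℝ) := by positivity
      linarith
    · have hmd : (m : ℝ) ≤ d := by
        have hm1 : (1 : ℝ) ≤ m := by exact_mod_cast hm0
        have := (abs_le.mp hm).2
        nlinarith
      rw [hxm]
      refine le_trans ?_ (h d m hm0)
      gcongr
  refine le_trans ?_ hlow
  rw [add_mul, one_mul, neg_add, Real.exp_add, ← mul_one_div |x|]
  exact mul_le_mul hmain hhalf (by positivity) (abs_nonneg _)

theorem sum_inv_le_of_separated {j : ℕ} {D : ℝ} (hD : 0 < D) {s : Finset ℕ}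
    (hs : s ⊆ Finset.Ico (2 ^ j) (2 ^ (j + 1)))
    (hsep : ∀ a ∈ s, ∀ b ∈ s, a < b → D ≤ ((b - a : ℕ) : ℝ)) :
    ∑ k ∈ s, 1 / (k : ℝ) ≤ 1 / D + 1 / 2 ^ j := by
  have hcard : s.card ≤ ⌊(2 : ℝ) ^ j / D⌋₊ + 1 := by
    rw [← Finset.card_range (⌊(2 : ℝ) ^ j / D⌋₊ + 1)]
    refine Finset.card_le_card_of_injOn (fun k => ⌊((k - 2 ^ j : ℕ) : ℝ) / D⌋₊) (fun k hk => ?_) ?_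
    · have := Finset.mem_Ico.mp (hs hk)
      rw [Finset.coe_range, Set.mem_Iio, Nat.lt_succ_iff]
      refine Nat.floor_mono (div_le_div_of_nonneg_right ?_ hD.le)
      have h2 : k - 2 ^ j ≤ 2 ^ j := by rw [pow_succ] at this; omega
      exact_mod_cast h2
    · have key (a b : ℕ) (ha : a ∈ s) (hb : b ∈ s) (hab : a < b) :
          ⌊((a - 2 ^ j : ℕ) : ℝ) / D⌋₊ ≠ ⌊((b - 2 ^ j : ℕ) : ℝ) / D⌋₊ := by
        have h1 := hsep a ha b hb hab
        have h2 := (Finset.mem_Ico.mp (hs ha)).1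
        have h3 : ((b - 2 ^ j : ℕ) : ℝ) = ((a - 2 ^ j : ℕ) : ℝ) + ((b - a : ℕ) : ℝ) := by
          norm_cast; omega
        refine ne_of_lt (Nat.lt_of_succ_le ?_)
        rw [Nat.succ_eq_add_one, ← Nat.floor_add_one (by positivity)]
        refine Nat.floor_mono ?_
        rw [h3, add_div]
        have : 1 ≤ ((b - a : ℕ) : ℝ) / D := (one_le_div hD).mpr h1
        linarith
      intro a ha b hb hab
      rcases lt_trichotomy a b with h | h | h
      · exact absurd hab (key a b ha hb h)
      · exact h
      · exact absurd hab.symm (key b a hb ha h)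
  have hcard' : (s.card : ℝ) ≤ 2 ^ j / D + 1 := by
    refine le_trans (by exact_mod_cast hcard) (?_ : ((⌊(2 : ℝ) ^ j / D⌋₊ : ℝ) + 1) ≤ _)
    gcongr
    exact Nat.floor_le (by positivity)
  calc ∑ k ∈ s, 1 / (k : ℝ) ≤ s.card • (1 / 2 ^ j : ℝ) := by
        refine Finset.sum_le_card_nsmul _ _ _ fun k hk => ?_
        have := (Finset.mem_Ico.mp (hs hk)).1
        gcongr
        exact_mod_cast this
    _ ≤ (2 ^ j / D + 1) * (1 / 2 ^ j) := by
        rw [nsmul_eq_mul]; gcongr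
    _ = 1 / D + 1 / 2 ^ j := by field_simp

theorem summable_of_summable_sum_Ico_two_pow {f : ℕ → ℝ} (hf : ∀ k, 0 ≤ f k)
    (h : Summable fun j => ∑ k ∈ Finset.Ico (2 ^ j) (2 ^ (j + 1)), f k) : Summable f := by
  have hsum (n : ℕ) : ∑ k ∈ Finset.range (2 ^ n), f k =
      f 0 + ∑ j ∈ Finset.range n, ∑ k ∈ Finset.Ico (2 ^ j) (2 ^ (j + 1)), f k := by
    induction n with
    | zero => simp
    | succ n ih =>
      rw [Finset.sum_range_succ, ← add_assoc, ← ih,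
        Finset.sum_range_add_sum_Ico _ (Nat.pow_le_pow_right (by norm_num) (Nat.le_succ n))]
  refine summable_of_sum_range_le (c := f 0 + ∑' j, ∑ k ∈ Finset.Ico (2 ^ j) (2 ^ (j + 1)), f k)
    hf fun n => ?_
  refine (Finset.sum_le_sum_of_subset_of_nonneg
    (Finset.range_mono Nat.lt_two_pow_self.le) fun k _ _ => hf k).trans ?_
  rw [hsum]
  gcongr
  exact h.sum_le_tsum _ fun j _ => Finset.sum_nonneg fun k _ => hf k

theorem norm_exp_sub_one_sub_le {a b : ℕ} (hab : a ≤ b) :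
    ‖Complex.exp (Complex.I * (b - a : ℕ)) - 1‖ ≤
      ‖Complex.exp (Complex.I * a) - 1‖ + ‖Complex.exp (Complex.I * b) - 1‖ := by
  have h1 : ‖Complex.exp (Complex.I * a)‖ = 1 := by
    rw [mul_comm]; exact_mod_cast Complex.norm_exp_ofReal_mul_I a
  have h2 : Complex.exp (Complex.I * b) =
      Complex.exp (Complex.I * a) * Complex.exp (Complex.I * (b - a : ℕ)) := by
    rw [← Complex.exp_add, Nat.cast_sub hab]; ring_nf
  calc ‖Complex.exp (Complex.I * (b - a : ℕ)) - 1‖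
      = ‖Complex.exp (Complex.I * a) * (Complex.exp (Complex.I * (b - a : ℕ)) - 1)‖ := by
        rw [norm_mul, h1, one_mul]
    _ = ‖(Complex.exp (Complex.I * b) - 1) - (Complex.exp (Complex.I * a) - 1)‖ := by
        rw [h2]; ring_nf
    _ ≤ _ := by rw [add_comm]; exact norm_sub_le _ _

open Classical in
theorem summable_inv_of_norm_exp_sub_one_le : Summable fun k : ℕ =>
    if ‖Complex.exp (Complex.I * k) - 1‖ ≤ (k : ℝ) ^ (-(1 / 4) : ℝ) then 1 / (k : ℝ) else 0 := by
  obtain ⟨C, hC, h⟩ := exists_exp_neg_le_norm_exp_sub_one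
  have hlog : 0 < Real.log 2 := Real.log_pos (by norm_num)
  refine summable_of_summable_sum_Ico_two_pow (fun k => by split_ifs <;> positivity) ?_
  set c : ℝ := Real.log 2 / (8 * C) with hc
  have hc0 : 0 < c := by positivity
  have hu : Summable fun j : ℕ => (1 / c ^ (3 / 2 : ℝ)) * (1 / (j : ℝ) ^ (3 / 2 : ℝ)) +
      (1 / 2 : ℝ) ^ j :=
    ((Real.summable_one_div_nat_rpow.mpr (by norm_num)).mul_left _).add
      (summable_geometric_of_lt_one (by norm_num) (by norm_num))
  refine Summable.of_norm_bounded_eventually_nat hu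
    (Filter.eventually_atTop.mpr ⟨8, fun j hj => ?_⟩)
  rw [Real.norm_of_nonneg (Finset.sum_nonneg fun k _ => by split_ifs <;> positivity),
    ← Finset.sum_filter]
  have hj8 : (8 : ℝ) ≤ j := by exact_mod_cast hj
  refine (sum_inv_le_of_separated (D := (c * j) ^ (3 / 2 : ℝ)) (by positivity)
    (Finset.filter_subset _ _) fun a ha b hb hab => ?_).trans_eq ?_
  · rw [Finset.mem_filter, Finset.mem_Ico] at ha hb
    have hle (a : ℕ) (ha : 2 ^ j ≤ a) :
        (a : ℝ) ^ (-(1 / 4) : ℝ) ≤ Real.exp (-(j * Real.log 2 / 4)) := by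
      have : (2 : ℝ) ^ j ≤ a := by exact_mod_cast ha
      calc (a : ℝ) ^ (-(1 / 4) : ℝ) ≤ ((2 : ℝ) ^ j) ^ (-(1 / 4) : ℝ) :=
            Real.rpow_le_rpow_of_nonpos (by positivity) this (by norm_num)
        _ = _ := by
          rw [Real.rpow_def_of_pos (by positivity), Real.log_pow]; ring_nf
    have h1 := (h (b - a) (by omega)).trans (norm_exp_sub_one_sub_le hab.le)
    have h2 : Real.exp (-(C * ((b - a : ℕ) : ℝ) ^ (2 / 3 : ℝ))) ≤
        Real.exp (Real.log 2 - j * Real.log 2 / 4) := by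
      rw [sub_eq_add_neg, Real.exp_add, Real.exp_log (by norm_num)]
      linarith [ha.2, hb.2, hle a ha.1.1, hle b hb.1.1]
    rw [Real.exp_le_exp] at h2
    have h3 : c * j ≤ ((b - a : ℕ) : ℝ) ^ (2 / 3 : ℝ) := by
      rw [hc, div_mul_eq_mul_div, div_le_iff₀ (by positivity)]
      nlinarith
    calc (c * j) ^ (3 / 2 : ℝ) ≤ (((b - a : ℕ) : ℝ) ^ (2 / 3 : ℝ)) ^ (3 / 2 : ℝ) := by gcongr
      _ = _ := by rw [← Real.rpow_mul (by positivity)]; norm_num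
  · rw [Real.mul_rpow hc0.le (by positivity), one_div_pow]
    field_simp

theorem summable_exp_neg_mul_sqrt_norm_exp_sub_one : Summable fun k : ℕ =>
    Real.exp (-(k * √‖Complex.exp (Complex.I * k) - 1‖ / 3)) / k := by
  classical
  have hs : Summable fun k : ℕ => 18 * (1 / (k : ℝ) ^ (7 / 4 : ℝ)) :=
    (Real.summable_one_div_nat_rpow.mpr (by norm_num)).mul_left _
  refine Summable.of_nonneg_of_le (fun k => by positivity) (fun k => ?_)
    (summable_inv_of_norm_exp_sub_one_le.add hs)
  rcases Nat.eq_zero_or_pos k with rfl | hk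
  · simp
  have hk1 : (1 : ℝ) ≤ k := by exact_mod_cast hk
  split_ifs with h
  · have : Real.exp (-(k * √‖Complex.exp (Complex.I * k) - 1‖ / 3)) ≤ 1 :=
      Real.exp_le_one_iff.mpr (neg_nonpos.mpr (by positivity))
    have h2 : Real.exp (-(k * √‖Complex.exp (Complex.I * k) - 1‖ / 3)) / k ≤ 1 / k := by gcongr
    have h3 : 0 ≤ 18 * (1 / (k : ℝ) ^ (7 / 4 : ℝ)) := by positivity
    linarith
  · rw [zero_add]
    push Not at h
    have h1 : (k : ℝ) ^ (7 / 8 : ℝ) ≤ k * √‖Complex.exp (Complex.I * k) - 1‖ := by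
      calc (k : ℝ) ^ (7 / 8 : ℝ) = k * √((k : ℝ) ^ (-(1 / 4) : ℝ)) := by
            rw [Real.sqrt_eq_rpow, ← Real.rpow_mul (by positivity),
              ← Real.rpow_one_add' (by positivity) (by norm_num)]
            norm_num
        _ ≤ _ := by gcongr
    set y := (k : ℝ) * √‖Complex.exp (Complex.I * k) - 1‖ / 3 with hy
    have hy0 : 0 < (k : ℝ) ^ (7 / 8 : ℝ) / 3 := by positivity
    have hyk : (k : ℝ) ^ (7 / 8 : ℝ) / 3 ≤ y := by rw [hy]; gcongr
    refine (div_le_self (by positivity) hk1).trans ?_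
    rw [Real.exp_neg]
    have h3 : ((k : ℝ) ^ (7 / 8 : ℝ) / 3) ^ 2 / 2 ≤ Real.exp y := by
      have := Real.quadratic_le_exp_of_nonneg (hy0.le.trans hyk)
      nlinarith
    refine (inv_anti₀ (by positivity) h3).trans_eq ?_
    rw [div_pow, ← Real.rpow_natCast, ← Real.rpow_mul (by positivity)]
    norm_num
    field_simp
    norm_num

/-- The coefficient of `e^{ikθ}` in `(1 + (sin θ)/2)^n`. -/
noncomputable def trigCoeff : ℕ → ℤ → ℂ
  | 0, k => if k = 0 then 1 else 0
  | n + 1, k => trigCoeff n k +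
      (trigCoeff n (k - 1) - trigCoeff n (k + 1)) / (4 * Complex.I)

theorem trigCoeff_zero (k : ℤ) : trigCoeff 0 k = if k = 0 then 1 else 0 := rfl

theorem trigCoeff_succ (n : ℕ) (k : ℤ) : trigCoeff (n + 1) k = trigCoeff n k +
    (trigCoeff n (k - 1) - trigCoeff n (k + 1)) / (4 * Complex.I) := rfl

theorem trigCoeff_neg (n : ℕ) (k : ℤ) : trigCoeff n (-k) = starRingEnd ℂ (trigCoeff n k) := by
  induction n generalizing k with
  | zero => simp only [trigCoeff_zero, neg_eq_zero]; split_ifs <;> simp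
  | succ n ih =>
    rw [trigCoeff_succ, trigCoeff_succ, show -k - 1 = -(k + 1) by ring,
      show -k + 1 = -(k - 1) by ring, ih, ih, ih]
    simp only [map_add, map_div₀, map_sub, map_mul, Complex.conj_I, map_ofNat]
    rw [mul_neg, div_neg]
    ring

theorem I_mul_mul_trigCoeff_succ (n : ℕ) (k : ℤ) :
    Complex.I * k * trigCoeff (n + 1) k =
      (n + 1) / 4 * (trigCoeff n (k - 1) + trigCoeff n (k + 1)) := by
  have hI : Complex.I ≠ 0 := Complex.I_ne_zero
  induction n generalizing k with
  | zero =>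
    simp only [trigCoeff_succ, trigCoeff_zero]
    rcases eq_or_ne k 0 with rfl | h0
    · simp
    rcases eq_or_ne k 1 with rfl | h1
    · norm_num; field_simp; simp
    rcases eq_or_ne k (-1) with rfl | h2
    · norm_num; field_simp
    · simp [h0, show k - 1 ≠ 0 by omega, show k + 1 ≠ 0 by omega]
  | succ n ih =>
    have h0 := ih k
    have h1 := ih (k - 1)
    have h2 := ih (k + 1)
    rw [show k - 1 + 1 = k by ring] at h1
    rw [show k + 1 - 1 = k by ring] at h2
    push_cast at h1 h2
    have e1 := trigCoeff_succ n (k - 1)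
    have e2 := trigCoeff_succ n (k + 1)
    rw [show k - 1 + 1 = k by ring] at e1
    rw [show k + 1 - 1 = k by ring] at e2
    rw [trigCoeff_succ (n + 1) k]
    set A := trigCoeff (n + 1) k
    set A1 := trigCoeff (n + 1) (k - 1)
    set A2 := trigCoeff (n + 1) (k + 1)
    field_simp at h0 h1 h2 e1 e2 ⊢
    push_cast
    refine mul_left_cancel₀ hI ?_
    linear_combination Complex.I * h0 + h1 / 4 - h2 / 4 - ((n : ℂ) + 1) / 4 * (e1 + e2)

theorem hasSum_int_shift {E : Type*} [AddCommMonoid E] [TopologicalSpace E] {f : ℤ → E}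
    {s : E} (h : HasSum f s) (a : ℤ) :
    HasSum (fun k => f (k + a)) s :=
  (Equiv.addRight a).hasSum_iff.mpr h

theorem hasSum_trigCoeff_mul_zpow (n : ℕ) {w : ℂ} (hw : w ≠ 0) :
    HasSum (fun k : ℤ => trigCoeff n k * w ^ k) ((1 + (w - w⁻¹) / (4 * Complex.I)) ^ n) := by
  induction n with
  | zero =>
    simp only [trigCoeff_zero, pow_zero]
    convert! hasSum_ite_eq (0 : ℤ) (1 : ℂ) using 2 with k
    split_ifs with h <;> simp [h]
  | succ n ih =>
    have h := ih.add ((((hasSum_int_shift ih (-1)).mul_left w).sub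
      ((hasSum_int_shift ih 1).mul_left w⁻¹)).div_const (4 * Complex.I))
    convert! h using 2 with k
    · rw [trigCoeff_succ, zpow_add₀ hw, zpow_add₀ hw, zpow_neg_one, zpow_one, ← sub_eq_add_neg]
      field_simp
    · rw [pow_succ]; ring

theorem summable_norm_trigCoeff (n : ℕ) : Summable (fun k : ℤ => ‖trigCoeff n k‖) ∧
    ∑' k : ℤ, ‖trigCoeff n k‖ ≤ (3 / 2) ^ n := by
  induction n with
  | zero =>
    have : HasSum (fun k : ℤ => ‖trigCoeff 0 k‖) 1 := by
      have e : (fun k : ℤ => ‖trigCoeff 0 k‖) = fun k => if k = 0 then 1 else 0 := by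
        funext k
        rw [trigCoeff_zero]
        split_ifs <;> simp
      rw [e]
      exact hasSum_ite_eq 0 1
    exact ⟨this.summable, by rw [this.tsum_eq, pow_zero]⟩
  | succ n ih =>
    have hs := ih.1.hasSum
    have h1 := hasSum_int_shift hs (-1)
    have h2 := hasSum_int_shift hs 1
    have h := hs.add ((h1.add h2).div_const 4)
    have hle (k : ℤ) : ‖trigCoeff (n + 1) k‖ ≤
        ‖trigCoeff n k‖ + (‖trigCoeff n (k + -1)‖ + ‖trigCoeff n (k + 1)‖) / 4 := by
      rw [trigCoeff_succ, ← sub_eq_add_neg]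
      refine (norm_add_le _ _).trans ?_
      rw [norm_div, norm_mul, Complex.norm_I, mul_one, Complex.norm_ofNat]
      gcongr
      exact norm_sub_le _ _
    have hsum := Summable.of_nonneg_of_le (fun _ => norm_nonneg _) hle h.summable
    refine ⟨hsum, (hasSum_le hle hsum.hasSum h).trans ?_⟩
    rw [pow_succ]
    linarith [ih.2]

theorem norm_trigCoeff_le (n : ℕ) (k : ℤ) : ‖trigCoeff n k‖ ≤ (3 / 2) ^ n :=
  ((summable_norm_trigCoeff n).1.le_tsum k fun _ _ => norm_nonneg _).trans
    (summable_norm_trigCoeff n).2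

theorem trigCoeff_eq_integral (n : ℕ) (k : ℤ) : trigCoeff n k = (1 / (2 * Real.pi) : ℂ) *
    ∫ θ in (0 : ℝ)..(2 * Real.pi),
      (((1 + Real.sin θ / 2) ^ n : ℝ) : ℂ) * Complex.exp (-(Complex.I * k * θ)) := by
  have hpi : (Real.pi : ℂ) ≠ 0 := by exact_mod_cast Real.pi_ne_zero
  induction n generalizing k with
  | zero =>
    rw [trigCoeff_zero]
    simp only [pow_zero, Complex.ofReal_one, one_mul]
    split_ifs with h
    · rw [h]; simp; field_simp
    · have hc : -(Complex.I * k) ≠ 0 := by simp [h]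
      have := integral_exp_mul_complex (a := 0) (b := 2 * Real.pi) hc
      simp only [neg_mul] at this
      rw [this, show -(Complex.I * k * ((2 * Real.pi : ℝ) : ℂ)) =
        ((-k : ℤ) : ℂ) * (2 * Real.pi * Complex.I) by push_cast; ring,
        Complex.exp_int_mul_two_pi_mul_I]
      simp
  | succ n ih =>
    have hint (m : ℤ) : IntervalIntegrable (fun θ : ℝ => (((1 + Real.sin θ / 2) ^ n : ℝ) : ℂ) *
        Complex.exp (-(Complex.I * m * θ))) MeasureTheory.volume 0 (2 * Real.pi) :=
      Continuous.intervalIntegrable (by fun_prop) _ _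
    have hpt (θ : ℝ) : (((1 + Real.sin θ / 2) ^ (n + 1) : ℝ) : ℂ) *
        Complex.exp (-(Complex.I * k * θ)) =
        (((1 + Real.sin θ / 2) ^ n : ℝ) : ℂ) * Complex.exp (-(Complex.I * k * θ)) +
        ((((1 + Real.sin θ / 2) ^ n : ℝ) : ℂ) * Complex.exp (-(Complex.I * (k - 1 : ℤ) * θ)) -
          (((1 + Real.sin θ / 2) ^ n : ℝ) : ℂ) * Complex.exp (-(Complex.I * (k + 1 : ℤ) * θ))) /
          (4 * Complex.I) := by
      have e1 : Complex.exp (-(Complex.I * (k - 1 : ℤ) * θ)) =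
          Complex.exp (-(Complex.I * k * θ)) * Complex.exp (θ * Complex.I) := by
        rw [← Complex.exp_add]; push_cast; ring_nf
      have e2 : Complex.exp (-(Complex.I * (k + 1 : ℤ) * θ)) =
          Complex.exp (-(Complex.I * k * θ)) * Complex.exp (-θ * Complex.I) := by
        rw [← Complex.exp_add]; push_cast; ring_nf
      have e3 : Complex.sin θ = (Complex.exp (θ * Complex.I) - Complex.exp (-θ * Complex.I)) /
          (2 * Complex.I) := by
        rw [Complex.sin, eq_div_iff (by simp)]
        linear_combination (Complex.exp (-θ * Complex.I) - Complex.exp (θ * Complex.I)) *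
          Complex.I_sq
      rw [e1, e2]
      push_cast
      rw [e3, pow_succ]
      have := Complex.I_ne_zero
      field_simp
      ring
    simp only [hpt]
    rw [intervalIntegral.integral_add (hint k) (((hint _).sub (hint _)).div_const _),
      intervalIntegral.integral_div, intervalIntegral.integral_sub (hint _) (hint _),
      trigCoeff_succ, ih, ih, ih]
    ring

theorem norm_trigCoeff_le_re (n : ℕ) (k : ℤ) : ‖trigCoeff n k‖ ≤ (trigCoeff n 0).re := by
  have hpos (θ : ℝ) : 0 ≤ 1 + Real.sin θ / 2 := by linarith [Real.neg_one_le_sin θ]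
  have h0 : trigCoeff n 0 = ((1 / (2 * Real.pi) *
      ∫ θ in (0 : ℝ)..(2 * Real.pi), (1 + Real.sin θ / 2) ^ n : ℝ) : ℂ) := by
    rw [trigCoeff_eq_integral]
    push_cast
    rw [← intervalIntegral.integral_ofReal]
    simp
  rw [h0, Complex.ofReal_re, trigCoeff_eq_integral, norm_mul]
  have h1 : ‖(1 / (2 * Real.pi) : ℂ)‖ = 1 / (2 * Real.pi) := by
    simp [abs_of_pos Real.pi_pos]
  rw [h1]
  gcongr
  refine (intervalIntegral.norm_integral_le_integral_norm (by positivity)).trans_eq ?_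
  refine intervalIntegral.integral_congr fun θ _ => ?_
  rw [norm_mul, Complex.norm_real, Real.norm_of_nonneg (pow_nonneg (hpos θ) n),
    show -(Complex.I * k * θ) = ((-(k * θ) : ℝ) : ℂ) * Complex.I by push_cast; ring,
    Complex.norm_exp_ofReal_mul_I, mul_one]

theorem hasSum_pow_div_log_sin {θ : ℝ} (h : Real.sin θ ≠ 1) :
    HasSum (fun n : ℕ => ((2 + Real.sin θ) / 3) ^ (n + 1) / (n + 1))
      (Real.log 6 - 2 * Real.log ‖circleMap 0 1 θ - Complex.I‖) := by
  have h1 : Real.sin θ < 1 := lt_of_le_of_ne (Real.sin_le_one θ) h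
  have h2 := Real.neg_one_le_sin θ
  have hn : ‖circleMap 0 1 θ - Complex.I‖ ^ 2 = 2 - 2 * Real.sin θ := by
    rw [← Complex.normSq_eq_norm_sq, circleMap_zero, Complex.normSq_apply]
    simp only [Complex.ofReal_one, one_mul, Complex.sub_re, Complex.sub_im, Complex.I_re,
      Complex.I_im, Complex.exp_ofReal_mul_I_re, Complex.exp_ofReal_mul_I_im]
    linarith [Real.sin_sq_add_cos_sq θ]
  have hs := Real.hasSum_pow_div_log_of_abs_lt_one (x := (2 + Real.sin θ) / 3)
    (by rw [abs_lt]; constructor <;> linarith)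
  convert hs using 1
  rw [show 1 - (2 + Real.sin θ) / 3 = ‖circleMap 0 1 θ - Complex.I‖ ^ 2 / 6 by rw [hn]; ring,
    Real.log_div (by rw [hn]; linarith) (by norm_num), Real.log_pow]
  push_cast
  ring

theorem ae_sin_ne_one : ∀ᵐ θ : ℝ, Real.sin θ ≠ 1 := by
  have hc : {θ : ℝ | Real.sin θ = 1}.Countable := by
    refine (Set.countable_range fun n : ℤ => Real.pi / 2 + n * (2 * Real.pi)).mono fun θ hθ => ?_
    exact Real.sin_eq_one_iff.mp hθ
  rw [MeasureTheory.ae_iff]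
  simpa using hc.measure_zero MeasureTheory.volume

theorem hasSum_re_trigCoeff_zero : HasSum (fun n : ℕ =>
    (trigCoeff (n + 1) 0).re * (2 / 3) ^ (n + 1) / (n + 1)) (Real.log 6) := by
  have hpos (θ : ℝ) : 0 ≤ (2 + Real.sin θ) / 3 := by linarith [Real.neg_one_le_sin θ]
  have hci : IntervalIntegrable (fun θ : ℝ => Real.log ‖circleMap 0 1 θ - Complex.I‖)
      MeasureTheory.volume 0 (2 * Real.pi) := circleIntegrable_log_norm_sub_const 1
  have hgi := (intervalIntegrable_const (c := Real.log 6) (μ := MeasureTheory.volume)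
    (a := 0) (b := 2 * Real.pi)).sub (hci.const_mul 2)
  have hae : ∀ᵐ θ : ℝ, HasSum (fun n : ℕ => ((2 + Real.sin θ) / 3) ^ (n + 1) / (n + 1))
      (Real.log 6 - 2 * Real.log ‖circleMap 0 1 θ - Complex.I‖) := by
    filter_upwards [ae_sin_ne_one] with θ hθ using hasSum_pow_div_log_sin hθ
  have h := intervalIntegral.hasSum_integral_of_dominated_convergence
    (μ := MeasureTheory.volume) (a := 0) (b := 2 * Real.pi)
    (F := fun (n : ℕ) (θ : ℝ) => ((2 + Real.sin θ) / 3) ^ (n + 1) / (n + 1))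
    (f := fun θ => Real.log 6 - 2 * Real.log ‖circleMap 0 1 θ - Complex.I‖)
    (fun (n : ℕ) (θ : ℝ) => ((2 + Real.sin θ) / 3) ^ (n + 1) / (n + 1))
    (fun n => Continuous.aestronglyMeasurable (by fun_prop))
    (fun n => Filter.Eventually.of_forall fun θ _ =>
      (Real.norm_of_nonneg (by have := hpos θ; positivity)).le)
    (hae.mono fun θ hθ _ => hθ.summable)
    (hgi.congr_ae ((MeasureTheory.ae_restrict_of_ae hae).mono fun θ hθ => hθ.tsum_eq.symm))
    (hae.mono fun θ hθ _ => hθ)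
  have havg := circleAverage_log_norm_sub_const_of_mem_closedBall (a := Complex.I) (c := 0)
    (R := 1) (by simp)
  rw [Real.circleAverage, Real.log_one, smul_eq_mul] at havg
  have havg' : ∫ θ in (0 : ℝ)..(2 * Real.pi), Real.log ‖circleMap 0 1 θ - Complex.I‖ = 0 :=
    (mul_eq_zero.mp havg).resolve_left (by positivity)
  rw [intervalIntegral.integral_sub intervalIntegrable_const (hci.const_mul 2),
    intervalIntegral.integral_const, intervalIntegral.integral_const_mul, havg'] at h
  have h' := h.mul_left (1 / (2 * Real.pi))
  rw [show 1 / (2 * Real.pi) * ((2 * Real.pi - 0) • Real.log 6 - 2 * 0) = Real.log 6 by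
    rw [smul_eq_mul]; field_simp; ring] at h'
  convert! h' using 2 with n
  · rw [trigCoeff_eq_integral]
    have e1 : (∫ θ in (0 : ℝ)..(2 * Real.pi), (((1 + Real.sin θ / 2) ^ (n + 1) : ℝ) : ℂ) *
        Complex.exp (-(Complex.I * (0 : ℤ) * θ))) =
        ((∫ θ in (0 : ℝ)..(2 * Real.pi), (1 + Real.sin θ / 2) ^ (n + 1) : ℝ) : ℂ) := by
      rw [← intervalIntegral.integral_ofReal]; simp
    rw [e1, show (1 / (2 * Real.pi) : ℂ) = ((1 / (2 * Real.pi) : ℝ) : ℂ) by push_cast; rfl,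
      ← Complex.ofReal_mul, Complex.ofReal_re, mul_assoc, mul_div_assoc]
    congr 1
    rw [← intervalIntegral.integral_mul_const, ← intervalIntegral.integral_div]
    refine intervalIntegral.integral_congr fun θ _ => ?_
    rw [← mul_pow]
    congr 2
    ring

theorem summable_trigCoeff_mul_pow {z : ℂ} (hz : ‖z‖ < 2 / 3) (k : ℤ) :
    Summable fun n : ℕ => trigCoeff n k * z ^ n := by
  refine Summable.of_norm_bounded (g := fun n : ℕ => (3 / 2 * ‖z‖) ^ n)
    (summable_geometric_of_lt_one (by positivity) (by linarith)) fun n => ?_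
  rw [norm_mul, norm_pow, mul_pow]
  gcongr
  exact norm_trigCoeff_le n k

theorem norm_tsum_trigCoeff_mul_pow_le {z : ℂ} (hz : ‖z‖ < 2 / 3) (k : ℤ) :
    ‖∑' n : ℕ, trigCoeff n k * z ^ n‖ ≤ (1 - 3 / 2 * ‖z‖)⁻¹ := by
  refine tsum_of_norm_bounded (hasSum_geometric_of_lt_one (by positivity) (by linarith)) fun n => ?_
  rw [norm_mul, norm_pow, mul_pow]
  gcongr
  exact norm_trigCoeff_le n k

theorem tsum_trigCoeff_mul_pow_eq {z : ℂ} (hz : ‖z‖ < 2 / 3) (k : ℤ) :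
    ∑' n : ℕ, trigCoeff n k * z ^ n = (if k = 0 then 1 else 0) +
      z * ∑' n : ℕ, trigCoeff n k * z ^ n +
      z / (4 * Complex.I) * (∑' n : ℕ, trigCoeff n (k - 1) * z ^ n -
        ∑' n : ℕ, trigCoeff n (k + 1) * z ^ n) := by
  have h := (((summable_trigCoeff_mul_pow hz k).hasSum.mul_left z).add
    (((summable_trigCoeff_mul_pow hz (k - 1)).hasSum.sub
      (summable_trigCoeff_mul_pow hz (k + 1)).hasSum).mul_left (z / (4 * Complex.I)))).tsum_eq
  conv_lhs => rw [(summable_trigCoeff_mul_pow hz k).tsum_eq_zero_add]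
  rw [pow_zero, mul_one, trigCoeff_zero, add_assoc, ← h]
  congr 1
  refine tsum_congr fun n => ?_
  rw [trigCoeff_succ, pow_succ]
  ring

theorem I_mul_mul_tsum_trigCoeff_succ {z : ℂ} (hz : ‖z‖ < 2 / 3) (k : ℤ) :
    Complex.I * k * ∑' n : ℕ, trigCoeff (n + 1) k / (n + 1) * z ^ (n + 1) =
      z / 4 * (∑' n : ℕ, trigCoeff n (k - 1) * z ^ n + ∑' n : ℕ, trigCoeff n (k + 1) * z ^ n) := by
  rw [← (((summable_trigCoeff_mul_pow hz (k - 1)).hasSum.add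
    (summable_trigCoeff_mul_pow hz (k + 1)).hasSum).mul_left (z / 4)).tsum_eq, ← tsum_mul_left]
  refine tsum_congr fun n => ?_
  have hn : (n : ℂ) + 1 ≠ 0 := Nat.cast_add_one_ne_zero n
  have := I_mul_mul_trigCoeff_succ n k
  field_simp at this ⊢
  rw [pow_succ]
  linear_combination z ^ n * z * this

theorem norm_eq_pow_of_bounded_recurrence {D : ℕ → ℂ} {b v : ℂ} {M : ℝ} (hb : ‖b‖ < 1)
    (hv : b ^ 2 + 1 = v * b) (h1 : D 2 + Complex.I * v * D 1 = Complex.I)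
    (h2 : ∀ k, D (k + 3) + Complex.I * v * D (k + 2) = D (k + 1)) (hM : ∀ k, ‖D k‖ ≤ M) (k : ℕ) :
    ‖D (k + 1)‖ = ‖b‖ ^ (k + 1) := by
  have hb0 : b ≠ 0 := by rintro rfl; simp at hv
  have hstep (k : ℕ) : D (k + 2) + Complex.I * b * D (k + 1) =
      Complex.I * b * (D (k + 3) + Complex.I * b * D (k + 2)) := by
    linear_combination -Complex.I * b * h2 k - Complex.I ^ 2 * D (k + 2) * hv +
      D (k + 2) * Complex.I_sq
  have hiter (m k : ℕ) : D (k + 2) + Complex.I * b * D (k + 1) =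
      (Complex.I * b) ^ m * (D (k + m + 2) + Complex.I * b * D (k + m + 1)) := by
    induction m with
    | zero => simp
    | succ m ih => rw [ih, hstep (k + m), pow_succ]; ring_nf
  have hT (k : ℕ) : D (k + 2) + Complex.I * b * D (k + 1) = 0 := by
    have hle (m : ℕ) : ‖D (k + 2) + Complex.I * b * D (k + 1)‖ ≤ ‖b‖ ^ m * (M + M) := by
      rw [hiter m k, norm_mul, norm_pow, norm_mul, Complex.norm_I, one_mul]
      gcongr
      refine (norm_add_le _ _).trans (add_le_add (hM _) ?_)
      rw [norm_mul, norm_mul, Complex.norm_I, one_mul]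
      exact (mul_le_of_le_one_left (norm_nonneg _) hb.le).trans (hM _)
    have hlim : Filter.Tendsto (fun m : ℕ => ‖b‖ ^ m * (M + M)) Filter.atTop (nhds 0) := by
      simpa using (tendsto_pow_atTop_nhds_zero_of_lt_one (norm_nonneg b) hb).mul_const (M + M)
    exact norm_le_zero_iff.mp (ge_of_tendsto' hlim hle)
  induction k with
  | zero =>
    have h3 := hT 0
    have h4 : Complex.I * (D 1 - b) = 0 := by
      linear_combination b * h1 - b * h3 + Complex.I * D 1 * hv
    rw [zero_add, sub_eq_zero.mp ((mul_eq_zero.mp h4).resolve_left Complex.I_ne_zero), pow_one]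
  | succ k ih =>
    rw [eq_neg_of_add_eq_zero_left (hT k), norm_neg, norm_mul, norm_mul, Complex.norm_I, one_mul,
      ih, pow_succ _ (k + 1), mul_comm]

theorem exists_small_root {y : ℂ} (hy : 1 < ‖y‖) : ∃ b : ℂ, b ^ 2 + 1 = (6 * y - 4) * b ∧
    ‖b‖ < 1 ∧ 3 * ‖b‖ * ‖y - 1‖ ≤ (1 - ‖b‖) ^ 2 := by
  have h4 : 4 < ‖6 * y - 2‖ := by
    have := norm_sub_norm_le (6 * y) 2
    rw [norm_mul, Complex.norm_ofNat, Complex.norm_ofNat] at this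
    linarith
  have hroot (b : ℂ) (hb : b ^ 2 + 1 = (6 * y - 4) * b) :
      2 * (1 + ‖b‖ ^ 2) = ‖b‖ * (6 * ‖y - 1‖ + ‖6 * y - 2‖) := by
    have e1 : ‖b - 1‖ ^ 2 = ‖b‖ * (6 * ‖y - 1‖) := by
      rw [← norm_pow, show (b - 1) ^ 2 = b * (6 * (y - 1)) by linear_combination hb, norm_mul,
        norm_mul, Complex.norm_ofNat]
    have e2 : ‖b + 1‖ ^ 2 = ‖b‖ * ‖6 * y - 2‖ := by
      rw [← norm_pow, show (b + 1) ^ 2 = b * (6 * y - 2) by linear_combination hb, norm_mul]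
    have e3 := parallelogram_law_with_norm ℝ b 1
    rw [norm_one] at e3
    linarith
  have hbound (b : ℂ) (hb : b ^ 2 + 1 = (6 * y - 4) * b) (hb1 : ‖b‖ < 1) :
      3 * ‖b‖ * ‖y - 1‖ ≤ (1 - ‖b‖) ^ 2 := by
    nlinarith [hroot b hb, mul_le_mul_of_nonneg_left h4.le (norm_nonneg b)]
  have hne (b : ℂ) (hb : b ^ 2 + 1 = (6 * y - 4) * b) : ‖b‖ ≠ 1 := by
    intro h1
    have := hroot b hb
    rw [h1] at this
    linarith [norm_nonneg (y - 1)]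
  obtain ⟨s, hs⟩ := IsAlgClosed.exists_pow_nat_eq ((6 * y - 4) ^ 2 - 4) (show 0 < 2 by norm_num)
  have r1 : ((6 * y - 4 + s) / 2) ^ 2 + 1 = (6 * y - 4) * ((6 * y - 4 + s) / 2) := by
    linear_combination hs / 4
  have r2 : ((6 * y - 4 - s) / 2) ^ 2 + 1 = (6 * y - 4) * ((6 * y - 4 - s) / 2) := by
    linear_combination hs / 4
  have hprod : ‖(6 * y - 4 + s) / 2‖ * ‖(6 * y - 4 - s) / 2‖ = 1 := by
    rw [← norm_mul, show (6 * y - 4 + s) / 2 * ((6 * y - 4 - s) / 2) = 1 by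
      linear_combination -hs / 4, norm_one]
  rcases lt_or_ge ‖(6 * y - 4 + s) / 2‖ 1 with h | h
  · exact ⟨_, r1, h, hbound _ r1 h⟩
  · have h' : ‖(6 * y - 4 - s) / 2‖ < 1 := by
      refine lt_of_le_of_ne ?_ (hne _ r2)
      nlinarith [norm_nonneg ((6 * y - 4 - s) / 2)]
    exact ⟨_, r2, h', hbound _ r2 h'⟩

theorem norm_sub_one_le_two_mul {w : ℂ} (hw : ‖w‖ = 1) {r : ℝ} (hr0 : 0 < r) (hr1 : r < 1) :
    ‖w - 1‖ ≤ 2 * ‖(r * w)⁻¹ - 1‖ := by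
  have hw0 : w ≠ 0 := by rintro rfl; simp at hw
  have h1 : ‖w - 1‖ = ‖w⁻¹ - 1‖ := by
    rw [show w - 1 = -(w * (w⁻¹ - 1)) by field_simp; ring, norm_neg, norm_mul, hw, one_mul]
  have hri : 1 < r⁻¹ := (one_lt_inv₀ hr0).mpr hr1
  have hn : ‖(r * w : ℂ)⁻¹‖ = r⁻¹ := by
    rw [norm_inv, norm_mul, hw, Complex.norm_real, Real.norm_of_nonneg hr0.le, mul_one]
  have h2 : ‖w⁻¹ - (r * w : ℂ)⁻¹‖ = r⁻¹ - 1 := by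
    rw [mul_inv, show w⁻¹ - (r : ℂ)⁻¹ * w⁻¹ = -(((r⁻¹ - 1 : ℝ) : ℂ) * w⁻¹) by push_cast; ring,
      norm_neg, norm_mul, norm_inv, hw, inv_one, mul_one, Complex.norm_real,
      Real.norm_of_nonneg (by linarith)]
  have h3 := norm_sub_norm_le (r * w : ℂ)⁻¹ 1
  rw [hn, norm_one] at h3
  have h4 := norm_sub_le_norm_sub_add_norm_sub w⁻¹ (r * w : ℂ)⁻¹ 1
  rw [h1]
  linarith

theorem le_exp_neg_sqrt_div_three {ρ δ : ℝ} (hρ1 : ρ < 1) (hδ0 : 0 ≤ δ) (hδ2 : δ ≤ 2)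
    (h : 3 / 2 * ρ * δ ≤ (1 - ρ) ^ 2) : ρ ≤ Real.exp (-(√δ / 3)) := by
  refine le_trans ?_ (Real.one_sub_le_exp_neg _)
  have hs := Real.sqrt_nonneg δ
  have hsq := Real.sq_sqrt hδ0
  by_contra! hlt
  have h1 : (1 - ρ) ^ 2 < δ / 9 := by nlinarith
  have h2 : ρ < 2 / 27 := by
    by_contra! h3
    nlinarith
  nlinarith

theorem norm_tsum_trigCoeff_succ_le {w : ℂ} (hw : ‖w‖ = 1) {r : ℝ} (hr0 : 0 < r) (hr1 : r < 1)
    (k : ℕ) : ‖∑' n : ℕ, trigCoeff (n + 1) (k + 1 : ℕ) / (n + 1) * (2 / 3 * (r * w)) ^ (n + 1)‖ ≤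
      Real.exp (-((k + 1 : ℕ) * √‖w - 1‖ / 3)) / (k + 1 : ℕ) := by
  have hw0 : w ≠ 0 := by rintro rfl; simp at hw
  have hr : (r : ℂ) ≠ 0 := by exact_mod_cast hr0.ne'
  have hx0 : (r * w : ℂ) ≠ 0 := mul_ne_zero hr hw0
  have hxn : ‖(r * w : ℂ)‖ = r := by
    rw [norm_mul, hw, Complex.norm_real, Real.norm_of_nonneg hr0.le, mul_one]
  set z : ℂ := 2 / 3 * (r * w) with hzdef
  have hz : ‖z‖ < 2 / 3 := by
    rw [hzdef, norm_mul, hxn, norm_div, Complex.norm_ofNat, Complex.norm_ofNat]; linarith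
  have hz0 : z ≠ 0 := mul_ne_zero (by norm_num) hx0
  obtain ⟨b, hb, hb1, hb2⟩ := exists_small_root (y := (r * w : ℂ)⁻¹) (by
    rw [norm_inv, hxn]; exact (one_lt_inv₀ hr0).mpr hr1)
  have hvz : (6 * (r * w : ℂ)⁻¹ - 4) * z = 4 * (1 - z) := by
    rw [hzdef]; field_simp; ring
  set v := 6 * (r * w : ℂ)⁻¹ - 4
  set L : ℤ → ℂ := fun k => ∑' n : ℕ, trigCoeff n k * z ^ n with hL
  set D : ℤ → ℂ := fun k => z / 4 * (L (k - 1) + L (k + 1)) with hD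
  have hLrec (k : ℤ) : L k = (if k = 0 then 1 else 0) + z * L k +
      z / (4 * Complex.I) * (L (k - 1) - L (k + 1)) := tsum_trigCoeff_mul_pow_eq hz k
  have hGD (k : ℤ) : Complex.I * k * ∑' n : ℕ, trigCoeff (n + 1) k / (n + 1) * z ^ (n + 1) = D k :=
    I_mul_mul_tsum_trigCoeff_succ hz k
  have hD0 : D 0 = 0 := by rw [← hGD 0]; simp
  have hDrec (k : ℤ) : D (k + 1) + Complex.I * v * D k - D (k - 1) =
      Complex.I * ((if k - 1 = 0 then 1 else 0) + (if k + 1 = 0 then 1 else 0)) := by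
    have e1 := hLrec (k - 1)
    have e2 := hLrec (k + 1)
    have hJ : z / (4 * Complex.I) = -(z * Complex.I / 4) := by
      rw [div_eq_iff (by simp)]
      linear_combination z * Complex.I_sq
    refine mul_left_cancel₀ hz0 ?_
    simp only [hD]
    rw [show k - 1 + 1 = k by ring] at e1 ⊢
    rw [show k + 1 - 1 = k by ring] at e2 ⊢
    set a := L (k - 1 - 1)
    set b := L (k - 1)
    set c := L k
    set d := L (k + 1)
    set e := L (k + 1 + 1)
    set δ₁ : ℂ := if k - 1 = 0 then 1 else 0
    set δ₂ : ℂ := if k + 1 = 0 then 1 else 0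
    rw [hJ] at e1 e2
    linear_combination z * Complex.I * (e1 + e2) + z * Complex.I / 4 * (b + d) * hvz -
      z ^ 2 / 4 * (a - e) * Complex.I_sq
  have key := norm_eq_pow_of_bounded_recurrence (D := fun k : ℕ => D k) (b := b) (v := v)
    (M := ‖z / 4‖ * ((1 - 3 / 2 * ‖z‖)⁻¹ + (1 - 3 / 2 * ‖z‖)⁻¹)) hb1 hb
    (by simpa [hD0] using hDrec 1)
    (fun k => by
      have := hDrec (k + 2)
      rw [if_neg (by omega), if_neg (by omega)] at this
      rw [← sub_eq_zero]
      push_cast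
      rw [show (k : ℤ) + 3 = k + 2 + 1 by ring, show (k : ℤ) + 1 = k + 2 - 1 by ring, this]
      simp)
    (fun k => by
      rw [hD, norm_mul]
      gcongr
      exact (norm_add_le _ _).trans (add_le_add (norm_tsum_trigCoeff_mul_pow_le hz _)
        (norm_tsum_trigCoeff_mul_pow_le hz _))) k
  beta_reduce at key
  rw [← hGD, norm_mul, norm_mul, Complex.norm_I, one_mul] at key
  have hk : ‖(((k + 1 : ℕ) : ℤ) : ℂ)‖ = (k + 1 : ℕ) := by
    rw [Int.cast_natCast, Complex.norm_natCast]
  rw [hk] at key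
  rw [le_div_iff₀' (by positivity), key]
  have hρ := le_exp_neg_sqrt_div_three (ρ := ‖b‖) (δ := ‖w - 1‖) hb1 (norm_nonneg _)
    ((norm_sub_le _ _).trans (by rw [hw, norm_one]; norm_num)) (by
      refine le_trans ?_ hb2
      nlinarith [norm_sub_one_le_two_mul hw hr0 hr1, norm_nonneg b])
  calc ‖b‖ ^ (k + 1) ≤ Real.exp (-(√‖w - 1‖ / 3)) ^ (k + 1) := by gcongr
    _ = _ := by rw [← Real.exp_nat_mul]; congr 1; ring

/-- The `k`-th harmonic `G_k((2/3)·r·e^{ik})`. -/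
noncomputable def harmonicSum (r : ℝ) (k : ℤ) : ℂ :=
  ∑' n : ℕ, trigCoeff (n + 1) k / (n + 1) * (2 / 3 * (r * Complex.exp (Complex.I * k))) ^ (n + 1)

theorem norm_exp_I_mul_intCast (k : ℤ) : ‖Complex.exp (Complex.I * k)‖ = 1 := by
  rw [mul_comm]
  exact_mod_cast Complex.norm_exp_ofReal_mul_I k

theorem norm_harmonicSum_term_le {r : ℝ} (hr0 : 0 ≤ r) (hr1 : r ≤ 1) (k : ℤ) (n : ℕ) :
    ‖trigCoeff (n + 1) k / (n + 1) * (2 / 3 * (r * Complex.exp (Complex.I * k))) ^ (n + 1)‖ ≤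
      (trigCoeff (n + 1) 0).re * (2 / 3) ^ (n + 1) / (n + 1) := by
  have hn : ‖(n : ℂ) + 1‖ = n + 1 := by exact_mod_cast Complex.norm_natCast (n + 1)
  rw [norm_mul, norm_div, norm_pow, norm_mul, norm_mul, norm_exp_I_mul_intCast, mul_one, hn,
    Complex.norm_real, Real.norm_of_nonneg hr0, norm_div, Complex.norm_ofNat, Complex.norm_ofNat,
    div_mul_eq_mul_div]
  gcongr
  · exact (norm_nonneg _).trans (norm_trigCoeff_le_re (n + 1) k)
  · exact norm_trigCoeff_le_re (n + 1) k
  · linarith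

theorem norm_harmonicSum_le {r : ℝ} (hr0 : 0 ≤ r) (hr1 : r ≤ 1) (k : ℤ) :
    ‖harmonicSum r k‖ ≤ Real.log 6 :=
  tsum_of_norm_bounded hasSum_re_trigCoeff_zero fun n => norm_harmonicSum_term_le hr0 hr1 k n

theorem tendsto_harmonicSum (k : ℤ) :
    Filter.Tendsto (fun r : ℝ => harmonicSum r k) (nhdsWithin 1 (Set.Iio 1))
      (nhds (harmonicSum 1 k)) := by
  refine tendsto_tsum_of_dominated_convergence hasSum_re_trigCoeff_zero.summable (fun n => ?_) ?_
  · exact tendsto_nhdsWithin_of_tendsto_nhds (Continuous.tendsto (by fun_prop) (1 : ℝ))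
  · filter_upwards [Ioo_mem_nhdsLT (zero_lt_one' ℝ)] with r hr n
    exact norm_harmonicSum_term_le hr.1.le hr.2.le k n

theorem harmonicSum_neg (r : ℝ) (k : ℤ) :
    harmonicSum r (-k) = starRingEnd ℂ (harmonicSum r k) := by
  rw [harmonicSum, harmonicSum, Complex.conj_tsum]
  refine tsum_congr fun n => ?_
  simp only [map_mul, map_div₀, map_pow, map_add, map_one, map_natCast, map_ofNat, trigCoeff_neg,
    Complex.conj_ofReal, ← Complex.exp_conj, Complex.conj_I, map_intCast]
  push_cast
  rw [mul_neg, neg_mul]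

theorem harmonicSum_one_zero : harmonicSum 1 0 = Real.log 6 := by
  rw [← (Complex.hasSum_ofReal.mpr hasSum_re_trigCoeff_zero).tsum_eq, harmonicSum]
  refine tsum_congr fun n => ?_
  have hre : ((trigCoeff (n + 1) 0).re : ℂ) = trigCoeff (n + 1) 0 := by
    rw [← Complex.conj_eq_iff_re, ← trigCoeff_neg, neg_zero]
  push_cast
  rw [hre]
  simp
  ring

theorem hasSum_harmonicSum_term {r : ℝ} (n : ℕ) :
    HasSum (fun k : ℤ => trigCoeff (n + 1) k / (n + 1) *
      (2 / 3 * (r * Complex.exp (Complex.I * k))) ^ (n + 1))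
      ((r ^ (n + 1) * (1 / (n + 1 : ℝ) * ((2 + Real.sin (n + 1)) / 3) ^ (n + 1)) : ℝ) : ℂ) := by
  have hw := Complex.exp_ne_zero (Complex.I * (n + 1))
  have h := (hasSum_trigCoeff_mul_zpow (n + 1) hw).mul_left ((2 / 3 * r) ^ (n + 1) / ((n : ℂ) + 1))
  convert! h using 2 with k
  · rw [← Complex.exp_int_mul, ← mul_assoc (2 / 3 : ℂ), mul_pow, ← Complex.exp_nat_mul]
    push_cast
    ring_nf
  · have e : Complex.sin (n + 1) = (Complex.exp (Complex.I * (n + 1)) -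
        (Complex.exp (Complex.I * (n + 1)))⁻¹) / (2 * Complex.I) := by
      rw [← Complex.exp_neg, Complex.sin, eq_div_iff (by simp)]
      rw [show Complex.I * ((n : ℂ) + 1) = (n + 1) * Complex.I by ring, ← neg_mul]
      linear_combination (Complex.exp (-((n : ℂ) + 1) * Complex.I) -
        Complex.exp (((n : ℂ) + 1) * Complex.I)) * Complex.I_sq
    push_cast
    rw [show (Complex.exp (Complex.I * (n + 1)) - (Complex.exp (Complex.I * (n + 1)))⁻¹) /
      (4 * Complex.I) = Complex.sin (n + 1) / 2 by rw [e, div_div]; ring_nf,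
      show (2 + Complex.sin (n + 1)) / 3 = 2 / 3 * (1 + Complex.sin (n + 1) / 2) by ring,
      mul_pow, mul_pow]
    ring

theorem summable_harmonicSum_term {r : ℝ} (hr0 : 0 < r) (hr1 : r < 1) :
    Summable fun p : ℕ × ℤ => trigCoeff (p.1 + 1) p.2 / (p.1 + 1) *
      (2 / 3 * (r * Complex.exp (Complex.I * p.2))) ^ (p.1 + 1) := by
  have hterm (n : ℕ) (k : ℤ) : ‖trigCoeff (n + 1) k / (n + 1) *
      (2 / 3 * (r * Complex.exp (Complex.I * k))) ^ (n + 1)‖ =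
      (2 / 3 * r) ^ (n + 1) / (n + 1) * ‖trigCoeff (n + 1) k‖ := by
    have hn : ‖(n : ℂ) + 1‖ = n + 1 := by exact_mod_cast Complex.norm_natCast (n + 1)
    rw [norm_mul, norm_div, norm_pow, norm_mul, norm_mul, norm_exp_I_mul_intCast, mul_one, hn,
      Complex.norm_real, Real.norm_of_nonneg hr0.le, norm_div, Complex.norm_ofNat,
      Complex.norm_ofNat]
    ring
  refine Summable.of_norm ((summable_prod_of_nonneg fun _ => norm_nonneg _).mpr ⟨fun n => ?_, ?_⟩)
  · simp only [hterm]
    exact (summable_norm_trigCoeff (n + 1)).1.mul_left _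
  · simp only [hterm, tsum_mul_left]
    refine Summable.of_nonneg_of_le (fun n => ?_) (fun n => ?_)
      ((summable_nat_add_iff 1).mpr (summable_geometric_of_lt_one hr0.le hr1))
    · exact mul_nonneg (by positivity) (tsum_nonneg fun _ => norm_nonneg _)
    · calc (2 / 3 * r) ^ (n + 1) / (n + 1) * ∑' k : ℤ, ‖trigCoeff (n + 1) k‖
          ≤ (2 / 3 * r) ^ (n + 1) * (3 / 2) ^ (n + 1) := by
            have h : (2 / 3 * r) ^ (n + 1) / (n + 1) ≤ (2 / 3 * r) ^ (n + 1) :=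
              div_le_self (by positivity) (by linarith [n.cast_nonneg (α := ℝ)])
            exact mul_le_mul h (summable_norm_trigCoeff (n + 1)).2
              (tsum_nonneg fun _ => norm_nonneg _) (by positivity)
        _ = r ^ (n + 1) := by rw [← mul_pow]; congr 1; ring

theorem hasSum_two_mul_re_harmonicSum {r : ℝ} (hr0 : 0 < r) (hr1 : r < 1) :
    HasSum (fun k : ℕ => 2 * (harmonicSum r (k + 1 : ℕ)).re)
      (∑' n : ℕ, r ^ (n + 1) * (1 / (n + 1 : ℝ) * ((2 + Real.sin (n + 1)) / 3) ^ (n + 1)) -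
        (harmonicSum r 0).re) ∧
    Summable fun n : ℕ =>
      r ^ (n + 1) * (1 / (n + 1 : ℝ) * ((2 + Real.sin (n + 1)) / 3) ^ (n + 1)) := by
  have hs := summable_harmonicSum_term hr0 hr1
  have h1 := hs.hasSum.prod_fiberwise fun n => hasSum_harmonicSum_term n
  have h1' := Complex.hasSum_ofReal.mp
    (by rw [← h1.tsum_eq, ← Complex.ofReal_tsum] at h1; exact h1)
  have h2 := (Equiv.prodComm ℤ ℕ).hasSum_iff.mpr hs.hasSum
  have h3 := h2.prod_fiberwise fun k => (h2.summable.prod_factor k).hasSum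
  rw [← h1.tsum_eq, ← Complex.ofReal_tsum] at h3
  have h4 : HasSum (fun k : ℤ => harmonicSum r k) _ := h3
  have h5 := Complex.hasSum_re h4.nat_add_neg
  have h6 := (hasSum_nat_add_iff' 1).mpr h5
  refine ⟨?_, h1'.summable⟩
  rw [Complex.add_re, Complex.ofReal_re, Finset.sum_range_one, Nat.cast_zero, neg_zero,
    Complex.add_re, add_sub_add_right_eq_sub] at h6
  convert! h6 using 2 with k
  rw [harmonicSum_neg, Complex.add_re, Complex.conj_re, two_mul]

theorem summable_harmonic_bound :
    Summable fun k : ℕ => 2 * (Real.exp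
      (-((k + 1 : ℕ) * √‖Complex.exp (Complex.I * (k + 1 : ℕ)) - 1‖ / 3)) / (k + 1 : ℕ)) :=
  ((summable_nat_add_iff 1).mpr summable_exp_neg_mul_sqrt_norm_exp_sub_one).mul_left 2

theorem norm_two_mul_re_harmonicSum_le {r : ℝ} (hr0 : 0 < r) (hr1 : r < 1) (k : ℕ) :
    ‖2 * (harmonicSum r (k + 1 : ℕ)).re‖ ≤ 2 * (Real.exp
      (-((k + 1 : ℕ) * √‖Complex.exp (Complex.I * (k + 1 : ℕ)) - 1‖ / 3)) / (k + 1 : ℕ)) := by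
  rw [norm_mul, Real.norm_ofNat]
  have hw := norm_exp_I_mul_intCast (k + 1 : ℕ)
  have h := norm_tsum_trigCoeff_succ_le hw hr0 hr1 k
  rw [Int.cast_natCast] at h
  refine mul_le_mul_of_nonneg_left ((Complex.abs_re_le_norm _).trans ?_) zero_le_two
  simpa only [harmonicSum, Int.cast_natCast] using h

theorem summable_sin_power_series :
    Summable fun n : ℕ => 1 / (n + 1 : ℝ) * ((2 + Real.sin (n + 1)) / 3) ^ (n + 1) := by
  have hnonneg (n : ℕ) : 0 ≤ 1 / (n + 1 : ℝ) * ((2 + Real.sin (n + 1)) / 3) ^ (n + 1) := by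
    have := Real.neg_one_le_sin (n + 1)
    have : 0 ≤ (2 + Real.sin (n + 1)) / 3 := by linarith
    positivity
  set b : ℕ → ℝ := fun k => 2 * (Real.exp
      (-((k + 1 : ℕ) * √‖Complex.exp (Complex.I * (k + 1 : ℕ)) - 1‖ / 3)) / (k + 1 : ℕ))
  refine summable_of_sum_range_le (c := Real.log 6 + ∑' k, b k) hnonneg fun N => ?_
  have hcont : Continuous fun r : ℝ => ∑ n ∈ Finset.range N,
      r ^ (n + 1) * (1 / (n + 1 : ℝ) * ((2 + Real.sin (n + 1)) / 3) ^ (n + 1)) := by fun_prop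
  have hlim := tendsto_nhdsWithin_of_tendsto_nhds (s := Set.Iio 1) (hcont.tendsto 1)
  simp only [one_pow, one_mul] at hlim
  refine le_of_tendsto hlim ?_
  filter_upwards [Ioo_mem_nhdsLT (zero_lt_one' ℝ)] with r hr
  obtain ⟨h1, h2⟩ := hasSum_two_mul_re_harmonicSum hr.1 hr.2
  have h3 := h2.sum_le_tsum (Finset.range N) fun n _ =>
    mul_nonneg (pow_nonneg hr.1.le (n + 1)) (hnonneg n)
  have h4 := h1.summable.tsum_le_tsum
    (fun k => (le_abs_self _).trans (norm_two_mul_re_harmonicSum_le hr.1 hr.2 k))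
    summable_harmonic_bound
  have h5 := (Complex.re_le_norm _).trans (norm_harmonicSum_le hr.1.le hr.2.le 0)
  rw [h1.tsum_eq] at h4
  linarith

theorem tendsto_abel_sin_power_series :
    Filter.Tendsto (fun r : ℝ => ∑' n : ℕ,
      r ^ (n + 1) * (1 / (n + 1 : ℝ) * ((2 + Real.sin (n + 1)) / 3) ^ (n + 1)))
      (nhdsWithin 1 (Set.Iio 1)) (nhds Sbbg) := by
  refine tendsto_tsum_of_dominated_convergence summable_sin_power_series.norm (fun n => ?_) ?_
  · refine tendsto_nhdsWithin_of_tendsto_nhds ?_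
    have hcont : Continuous fun r : ℝ =>
      r ^ (n + 1) * (1 / (n + 1 : ℝ) * ((2 + Real.sin (n + 1)) / 3) ^ (n + 1)) := by fun_prop
    simpa only [one_pow, one_mul] using hcont.tendsto 1
  · filter_upwards [Ioo_mem_nhdsLT (zero_lt_one' ℝ)] with r hr n
    rw [norm_mul, norm_pow, Real.norm_of_nonneg hr.1.le]
    exact mul_le_of_le_one_left (norm_nonneg _) (pow_le_one₀ hr.1.le hr.2.le)

theorem hasSum_two_mul_re_harmonicSum_one :
    HasSum (fun k : ℕ => 2 * (harmonicSum 1 (k + 1 : ℕ)).re) (Sbbg - Real.log 6) := by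
  have hlim (k : ℤ) : Filter.Tendsto (fun r : ℝ => (harmonicSum r k).re)
      (nhdsWithin 1 (Set.Iio 1)) (nhds (harmonicSum 1 k).re) :=
    (Complex.continuous_re.tendsto _).comp (tendsto_harmonicSum k)
  have hlim2 (k : ℕ) := (hlim (k + 1 : ℕ)).const_mul 2
  have hIoo := Ioo_mem_nhdsLT (zero_lt_one' ℝ)
  have hsum : Summable fun k : ℕ => 2 * (harmonicSum 1 (k + 1 : ℕ)).re := by
    refine Summable.of_norm_bounded summable_harmonic_bound fun k => ?_
    refine le_of_tendsto (hlim2 k).norm ?_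
    filter_upwards [hIoo] with r hr
    exact norm_two_mul_re_harmonicSum_le hr.1 hr.2 k
  have h1 := tendsto_tsum_of_dominated_convergence summable_harmonic_bound hlim2 (by
    filter_upwards [hIoo] with r hr k
    exact norm_two_mul_re_harmonicSum_le hr.1 hr.2 k)
  have h2 := tendsto_abel_sin_power_series.sub (hlim 0)
  rw [harmonicSum_one_zero, Complex.ofReal_re] at h2
  have h3 := h2.congr' (by
    filter_upwards [hIoo] with r hr
    exact (hasSum_two_mul_re_harmonicSum hr.1 hr.2).1.tsum_eq.symm)
  rw [← tendsto_nhds_unique h1 h3]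
  exact hsum.hasSum

theorem ck_eq_trigCoeff (k n : ℕ) : ck k n = trigCoeff n k := by
  rw [trigCoeff_eq_integral, ck]
  simp only [Int.cast_natCast]

/-- Fourier harmonic decomposition:
`∑_{k≥1} 2·Re[G_k((2/3)e^{ik})]` converges, with sum `S − log 6`; that is,
`S = log 6 + ∑_{k≥1} 2·Re[∑_{n≥1} (c_k(n)/n)·((2/3)e^{ik})^n]`. -/
theorem fourier_harmonic_decomposition :
    HasSum (fun k : ℕ =>
        2 * (∑' n : ℕ, (ck (k + 1) (n + 1) / (n + 1)) *
              ((2 / 3 : ℂ) * Complex.exp (Complex.I * (k + 1))) ^ (n + 1)).re)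
      (Sbbg - Real.log 6) := by
  convert! hasSum_two_mul_re_harmonicSum_one using 5 with k
  rw [harmonicSum]
  refine tsum_congr fun n => ?_
  rw [ck_eq_trigCoeff]
  push_cast
  rw [one_mul]
end

section
/- The series M = ∑_{n=1}^∞ I_n/n converges, the series R = ∑_{n=1}^∞ (1/n)·[((2 + sin n)/3)^n − I_n] converges, and S = M + R, where S = ∑_{n=1}^∞ (1/n)·((2 + sin n)/3)^n. -/
section

open Finset Real

/-- Partial fractions with integer coefficients for `p ^ a * q ^ b * r ^ c`, where `p`, `q`, `r`
behave like `1 / (t - 1)`, `1 / t`, `1 / (t + 1)`. -/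
theorem exists_partial_fraction_s7 {S : Type*} [CommRing S] {p q r : S} (hpq : p * q = p - q)
    (hqr : q * r = q - r) (hpr : 2 * (p * r) = p - r) (n : ℕ) (N : ℕ) :
    ∀ a b c : ℕ, a + b + c = N + 1 → a ≤ n → b ≤ n → c ≤ n →
      ∃ α β γ : ℕ → ℤ, (∀ k, |α k| ≤ 4 ^ (N + 1) ∧ |β k| ≤ 4 ^ (N + 1) ∧ |γ k| ≤ 4 ^ (N + 1)) ∧
        2 ^ (N + 1) * (p ^ a * q ^ b * r ^ c) =
          ∑ k ∈ range n, (α k * p ^ (k + 1) + β k * q ^ (k + 1) + γ k * r ^ (k + 1)) := by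
  induction N with
  | zero =>
    intro a b c h ha hb hc
    have : (a = 1 ∧ b = 0 ∧ c = 0) ∨ (a = 0 ∧ b = 1 ∧ c = 0) ∨ (a = 0 ∧ b = 0 ∧ c = 1) := by omega
    rcases this with ⟨rfl, rfl, rfl⟩ | ⟨rfl, rfl, rfl⟩ | ⟨rfl, rfl, rfl⟩
    · refine ⟨Pi.single 0 2, 0, 0, fun k => ?_, ?_⟩
      · rcases k with _ | k <;> simp
      · rw [sum_eq_single 0] <;> simp +contextual
        omega
    · refine ⟨0, Pi.single 0 2, 0, fun k => ?_, ?_⟩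
      · rcases k with _ | k <;> simp
      · rw [sum_eq_single 0] <;> simp +contextual
        omega
    · refine ⟨0, 0, Pi.single 0 2, fun k => ?_, ?_⟩
      · rcases k with _ | k <;> simp
      · rw [sum_eq_single 0] <;> simp +contextual
        omega
  | succ N ih =>
    have hsub : ∀ {x y z : S} (e : ℤ), |e| ≤ 2 → x = e * (y - z) →
        (∃ α β γ : ℕ → ℤ,
          (∀ k, |α k| ≤ 4 ^ (N + 1) ∧ |β k| ≤ 4 ^ (N + 1) ∧ |γ k| ≤ 4 ^ (N + 1)) ∧
          y = ∑ k ∈ range n, (α k * p ^ (k + 1) + β k * q ^ (k + 1) + γ k * r ^ (k + 1))) →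
        (∃ α β γ : ℕ → ℤ,
          (∀ k, |α k| ≤ 4 ^ (N + 1) ∧ |β k| ≤ 4 ^ (N + 1) ∧ |γ k| ≤ 4 ^ (N + 1)) ∧
          z = ∑ k ∈ range n, (α k * p ^ (k + 1) + β k * q ^ (k + 1) + γ k * r ^ (k + 1))) →
        ∃ α β γ : ℕ → ℤ, (∀ k, |α k| ≤ 4 ^ (N + 1 + 1) ∧ |β k| ≤ 4 ^ (N + 1 + 1) ∧
            |γ k| ≤ 4 ^ (N + 1 + 1)) ∧
          x = ∑ k ∈ range n, (α k * p ^ (k + 1) + β k * q ^ (k + 1) + γ k * r ^ (k + 1)) := by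
      rintro x y z e he rfl ⟨α, β, γ, hb, rfl⟩ ⟨α', β', γ', hb', rfl⟩
      have key : ∀ u v : ℤ, |u| ≤ 4 ^ (N + 1) → |v| ≤ 4 ^ (N + 1) →
          |e * (u - v)| ≤ 4 ^ (N + 1 + 1) := by
        intro u v hu hv
        rw [abs_mul, pow_succ (4 : ℤ) (N + 1)]
        have := abs_sub u v
        nlinarith [abs_nonneg e, abs_nonneg (u - v)]
      refine ⟨fun k => e * (α k - α' k), fun k => e * (β k - β' k), fun k => e * (γ k - γ' k),
        fun k => ⟨key _ _ (hb k).1 (hb' k).1, key _ _ (hb k).2.1 (hb' k).2.1,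
          key _ _ (hb k).2.2 (hb' k).2.2⟩, ?_⟩
      rw [← sum_sub_distrib, mul_sum]
      refine sum_congr rfl fun k _ => ?_
      push_cast
      ring
    have hpw : ∀ k l, |(Pi.single k (2 ^ (N + 1 + 1)) : ℕ → ℤ) l| ≤ 4 ^ (N + 1 + 1) := by
      intro k l
      by_cases h : l = k
      · subst h
        simpa using pow_le_pow_left₀ (by norm_num) (by norm_num) _
      · simp [h]
    intro a b c h ha hb hc
    rcases a with _ | a <;> rcases b with _ | b <;> rcases c with _ | c
    · omega
    · refine ⟨0, 0, Pi.single c (2 ^ (N + 1 + 1)), fun k => ⟨by simp, by simp, hpw c k⟩, ?_⟩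
      rw [sum_eq_single c] <;> simp +contextual
      · omega
    · refine ⟨0, Pi.single b (2 ^ (N + 1 + 1)), 0, fun k => ⟨by simp, hpw b k, by simp⟩, ?_⟩
      rw [sum_eq_single b] <;> simp +contextual
      · omega
    · refine hsub 2 (by norm_num) ?_ (ih 0 (b + 1) c (by omega) ha hb (by omega))
        (ih 0 b (c + 1) (by omega) ha (by omega) hc)
      push_cast
      linear_combination 2 ^ (N + 2) * q ^ b * r ^ c * hqr
    · refine ⟨Pi.single a (2 ^ (N + 1 + 1)), 0, 0, fun k => ⟨hpw a k, by simp, by simp⟩, ?_⟩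
      rw [sum_eq_single a] <;> simp +contextual
      · omega
    · refine hsub 1 (by norm_num) ?_ (ih (a + 1) 0 c (by omega) ha hb (by omega))
        (ih a 0 (c + 1) (by omega) (by omega) hb hc)
      push_cast
      linear_combination 2 ^ (N + 1) * p ^ a * r ^ c * hpr
    · refine hsub 2 (by norm_num) ?_ (ih (a + 1) b 0 (by omega) ha (by omega) hc)
        (ih a (b + 1) 0 (by omega) (by omega) hb hc)
      push_cast
      linear_combination 2 ^ (N + 2) * p ^ a * q ^ b * hpq
    · refine hsub 2 (by norm_num) ?_ (ih (a + 1) b (c + 1) (by omega) ha (by omega) hc)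
        (ih a (b + 1) (c + 1) (by omega) (by omega) hb hc)
      push_cast
      linear_combination 2 ^ (N + 2) * p ^ a * q ^ b * r ^ (c + 1) * hpq

open PowerSeries in
theorem PowerSeries.mk_pow_mul_one_sub {S : Type*} [CommRing S] (a : S) :
    (mk fun m => a ^ m : PowerSeries S) * (1 - C a * X) = 1 := by
  have h := congrArg (rescale a) (mk_one_mul_one_sub_eq_one S)
  simpa [rescale_mk, rescale_X] using h

open PowerSeries in
theorem PowerSeries.X_mul_mk_pow_sub {S : Type*} [CommRing S] (a b : S) :
    X * (mk fun m => a ^ m) - X * (mk fun m => b ^ m) =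
      C (a - b) * ((X * mk fun m => a ^ m) * (X * mk fun m => b ^ m)) := by
  have ha := mk_pow_mul_one_sub a
  have hb := mk_pow_mul_one_sub b
  rw [map_sub]
  linear_combination (X * mk fun m => b ^ m) * ha - (X * mk fun m => a ^ m) * hb

open PowerSeries in
theorem PowerSeries.X_mul_mk_pow_pow {S : Type*} [CommRing S] (a : S) (k : ℕ) :
    (X * mk fun m => a ^ m) ^ (k + 1) =
      X ^ (k + 1) * mk fun m => a ^ m * ((k + m).choose k : S) := by
  have h := congrArg (rescale a) (mk_one_pow_eq_mk_choose_add S k)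
  rw [map_pow, rescale_mk, rescale_mk] at h
  simp only [Pi.one_apply, mul_one] at h
  rw [mul_pow, h]

open PowerSeries in
theorem PowerSeries.expand_mk_one_pow {S : Type*} [CommRing S] (n : ℕ) :
    ((X * mk fun m => (1 : S) ^ m) * (X * mk fun m => (0 : S) ^ m) *
      (X * mk fun m => (-1 : S) ^ m)) ^ (n + 1) =
      X ^ (3 * n + 3) * expand 2 two_ne_zero (mk fun m => ((n + m).choose n : S)) := by
  rw [← mk_one_pow_eq_mk_choose_add, map_pow]
  have h := congrArg (expand 2 two_ne_zero) (mk_one_mul_one_sub_eq_one S)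
  simp only [map_mul, map_sub, map_one, expand_X] at h
  have h0 := mk_pow_mul_one_sub (0 : S)
  have h1 := mk_pow_mul_one_sub (1 : S)
  have h2 := mk_pow_mul_one_sub (-1 : S)
  simp only [map_zero, map_one, map_neg] at h0 h1 h2
  have key : (mk fun m => (1 : S) ^ m) * (mk fun m => (0 : S) ^ m) * (mk fun m => (-1 : S) ^ m)
      = expand 2 two_ne_zero (mk 1) := by
    set g : PowerSeries S := mk fun m => (1 : S) ^ m
    set g' : PowerSeries S := mk fun m => (-1 : S) ^ m
    set e : PowerSeries S := mk fun m => (0 : S) ^ m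
    have he : e = 1 := by linear_combination h0
    rw [he]
    linear_combination (-g * g') * h + expand 2 two_ne_zero (mk 1) * h1 * ((1 + X) * g')
      + expand 2 two_ne_zero (mk 1) * h2
  rw [← key]
  ring

/-- `f = ∑ aₘ X^(m+1)` has Borel sum `v = ∑ aₘ z^m / m!` at `z`. -/
def HasBorelSum (z : ℂ) (f : PowerSeries ℂ) (v : ℂ) : Prop :=
  HasSum (fun m : ℕ => PowerSeries.coeff (m + 1) f * (z ^ m / m.factorial)) v

theorem HasBorelSum.add {z : ℂ} {f g : PowerSeries ℂ} {u v : ℂ} (hf : HasBorelSum z f u)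
    (hg : HasBorelSum z g v) : HasBorelSum z (f + g) (u + v) := by
  simpa [HasBorelSum, add_mul] using HasSum.add hf hg

theorem HasBorelSum.intCast_mul {z : ℂ} {f : PowerSeries ℂ} {u : ℂ} (hf : HasBorelSum z f u)
    (c : ℤ) : HasBorelSum z (c * f) (c * u) := by
  have h := HasSum.mul_left (c : ℂ) hf
  rw [← map_intCast (PowerSeries.C (R := ℂ)) c]
  simpa only [HasBorelSum, PowerSeries.coeff_C_mul, mul_assoc] using h

theorem HasBorelSum.sum {z : ℂ} {ι : Type*} (s : Finset ι) {f : ι → PowerSeries ℂ} {u : ι → ℂ}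
    (hf : ∀ i ∈ s, HasBorelSum z (f i) (u i)) :
    HasBorelSum z (∑ i ∈ s, f i) (∑ i ∈ s, u i) := by
  simpa [HasBorelSum, sum_mul] using hasSum_sum hf

theorem hasBorelSum_pow (z a : ℂ) (k : ℕ) :
    HasBorelSum z ((PowerSeries.X * PowerSeries.mk fun m => a ^ m) ^ (k + 1))
      (z ^ k / k.factorial * Complex.exp (a * z)) := by
  rw [HasBorelSum, PowerSeries.X_mul_mk_pow_pow]
  rw [← hasSum_nat_add_iff' k, sum_eq_zero, sub_zero]
  · have h := (NormedSpace.expSeries_div_hasSum_exp (a * z)).mul_left (z ^ k / (k.factorial : ℂ))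
    rw [← Complex.exp_eq_exp_ℂ] at h
    refine h.congr_fun fun m => ?_
    rw [show m + k + 1 = m + (k + 1) by ring, mul_comm (PowerSeries.X ^ _),
      PowerSeries.coeff_mul_X_pow, PowerSeries.coeff_mk]
    have hc : ((m + k).factorial : ℂ) = ((k + m).choose k : ℂ) * k.factorial * m.factorial := by
      have := Nat.add_choose_mul_factorial_mul_factorial k m
      rw [add_comm m k, ← this, Nat.choose_symm_add]; push_cast; ring
    have h1 : ((k + m).choose k : ℂ) ≠ 0 := by
      exact_mod_cast (Nat.choose_pos (Nat.le_add_right k m)).ne'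
    have h2 := Nat.cast_ne_zero (R := ℂ).2 k.factorial_ne_zero
    have h3 := Nat.cast_ne_zero (R := ℂ).2 m.factorial_ne_zero
    rw [hc]
    field_simp
    ring
  · intro m hm
    rw [PowerSeries.coeff_X_pow_mul', if_neg (by simp at hm; omega), zero_mul]

theorem hasBorelSum_remainder {z v : ℂ} {n : ℕ} (h : HasBorelSum z
      (PowerSeries.X ^ (3 * n + 3) * PowerSeries.expand 2 two_ne_zero
        (PowerSeries.mk fun m => ((n + m).choose n : ℂ))) v) :
    HasSum (fun j : ℕ => ((n + j).choose n : ℂ) *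
      (z ^ (3 * n + 2 + 2 * j) / (3 * n + 2 + 2 * j).factorial)) v := by
  have hinj : Function.Injective fun j : ℕ => 3 * n + 2 + 2 * j := fun i j hij => by
    simpa using hij
  have := (hinj.hasSum_iff ?_).2 h
  · refine this.congr_fun fun j => ?_
    simp only [Function.comp]
    rw [show 3 * n + 2 + 2 * j + 1 = 2 * j + (3 * n + 3) by ring, mul_comm (PowerSeries.X ^ _),
      PowerSeries.coeff_mul_X_pow, PowerSeries.coeff_expand_mul, PowerSeries.coeff_mk]
  · intro m hm
    rw [PowerSeries.coeff_X_pow_mul']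
    split_ifs with hle
    · rw [PowerSeries.coeff_expand_of_not_dvd, zero_mul]
      rintro ⟨j, hj⟩
      exact hm ⟨j, by simp; omega⟩
    · rw [zero_mul]

theorem norm_remainder_sub_le {z v : ℂ} {n : ℕ} (hz : ‖z‖ ^ 2 ≤ 3)
    (h : HasSum (fun j : ℕ => ((n + j).choose n : ℂ) *
      (z ^ (3 * n + 2 + 2 * j) / (3 * n + 2 + 2 * j).factorial)) v) :
    ‖v - z ^ (3 * n + 2) / (3 * n + 2).factorial‖ ≤
      (‖z‖ ^ (3 * n + 2) / (3 * n + 2).factorial) / 2 := by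
  have h1 := (hasSum_nat_add_iff' 1).2 h
  simp only [sum_range_one, mul_zero, add_zero, Nat.choose_self, Nat.cast_one, one_mul] at h1
  rw [← h1.tsum_eq]
  have hg : HasSum (fun j : ℕ => (‖z‖ ^ (3 * n + 2) / (3 * n + 2).factorial) *
      ((1 / 3) * (1 / 3 : ℝ) ^ j)) ((‖z‖ ^ (3 * n + 2) / (3 * n + 2).factorial) / 2) := by
    have := ((hasSum_geometric_of_lt_one (r := (1 / 3 : ℝ)) (by norm_num)
      (by norm_num)).mul_left (1 / 3)).mul_left (‖z‖ ^ (3 * n + 2) / (3 * n + 2).factorial)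
    rwa [show (1 / 3 * (1 - 1 / 3)⁻¹ : ℝ) = 1 / 2 by norm_num, mul_one_div] at this
  refine tsum_of_norm_bounded hg fun j => ?_
  generalize hi : j + 1 = i
  rw [← pow_succ', hi, norm_mul, norm_div, norm_pow, Complex.norm_natCast, Complex.norm_natCast,
    pow_add, pow_mul]
  have hc : (n + i).choose n ≤ (n + 1) ^ i := by
    rw [add_comm, ← Nat.choose_symm_add]
    clear hi
    induction i with
    | zero => simp
    | succ i ih' =>
      have h2 := Nat.add_one_mul_choose_eq (i + n) i
      rw [show i + 1 + n = i + n + 1 by ring, pow_succ]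
      refine Nat.le_of_mul_le_mul_right (c := i + 1) ?_ i.succ_pos
      rw [← h2]
      calc (i + n + 1) * (i + n).choose i ≤ ((n + 1) * (i + 1)) * (n + 1) ^ i :=
            Nat.mul_le_mul (by nlinarith [Nat.zero_le (n * i)]) ih'
        _ = _ := by ring
  have hf : (3 * n + 2).factorial * (3 * n + 3) ^ (2 * i) ≤ (3 * n + 2 + 2 * i).factorial :=
    Nat.factorial_mul_pow_le_factorial
  have hc' : ((n + i).choose n : ℝ) ≤ (n + 1) ^ i := by exact_mod_cast hc
  have hf' : ((3 * n + 2).factorial : ℝ) * (3 * n + 3) ^ (2 * i) ≤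
      (3 * n + 2 + 2 * i).factorial := by exact_mod_cast hf
  have h0 : (0 : ℝ) < (3 * n + 2).factorial := by positivity
  have hz' : (‖z‖ ^ 2) ^ i ≤ 3 ^ i := pow_le_pow_left₀ (by positivity) hz i
  calc ((n + i).choose n : ℝ) * (‖z‖ ^ (3 * n + 2) * (‖z‖ ^ 2) ^ i / (3 * n + 2 + 2 * i).factorial)
      ≤ (n + 1) ^ i * (‖z‖ ^ (3 * n + 2) * 3 ^ i /
          ((3 * n + 2).factorial * (3 * n + 3) ^ (2 * i))) := by gcongr
    _ = ‖z‖ ^ (3 * n + 2) / (3 * n + 2).factorial * (1 / (3 * (n + 1))) ^ i := by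
        rw [pow_mul, div_pow, show (3 * n + 3 : ℝ) ^ 2 = (n + 1) * 3 * (3 * (n + 1)) by ring,
          mul_pow, mul_pow]
        field_simp
        rw [one_pow, mul_one]
    _ ≤ _ := by
        gcongr
        nlinarith [(n.cast_nonneg : (0 : ℝ) ≤ n)]

theorem exists_gaussianInt_hasBorelSum (n : ℕ) : ∃ u : ℕ → GaussianInt,
    (∀ k, ‖(u k : ℂ)‖ ≤ 3 * 64 ^ (n + 1)) ∧
    HasBorelSum ((π / 2 : ℝ) * Complex.I)
      (PowerSeries.X ^ (3 * n + 3) * PowerSeries.expand 2 two_ne_zero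
        (PowerSeries.mk fun m => ((n + m).choose n : ℂ)))
      ((∑ k ∈ range (n + 1), (u k : ℂ) * ((π / 2 : ℝ) : ℂ) ^ k / k.factorial) / 8 ^ (n + 1)) := by
  obtain ⟨α, β, γ, hb, hs⟩ := exists_partial_fraction_s7 (S := PowerSeries ℂ)
    (p := PowerSeries.X * PowerSeries.mk fun m => (1 : ℂ) ^ m)
    (q := PowerSeries.X * PowerSeries.mk fun m => (0 : ℂ) ^ m)
    (r := PowerSeries.X * PowerSeries.mk fun m => (-1 : ℂ) ^ m)
    (by rw [PowerSeries.X_mul_mk_pow_sub]; simp)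
    (by rw [PowerSeries.X_mul_mk_pow_sub]; simp)
    (by rw [PowerSeries.X_mul_mk_pow_sub]; norm_num; left; rfl)
    (n + 1) (3 * n + 2) (n + 1) (n + 1) (n + 1) (by ring) le_rfl le_rfl le_rfl
  rw [← mul_pow, ← mul_pow, PowerSeries.expand_mk_one_pow] at hs
  set z : ℂ := (π / 2 : ℝ) * Complex.I with hz
  have hexp : Complex.exp z = Complex.I := by
    rw [hz]; push_cast; exact Complex.exp_pi_div_two_mul_I
  have hexp' : Complex.exp (-z) = -Complex.I := by
    rw [Complex.exp_neg, hexp, Complex.inv_I]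
  have hsum := HasBorelSum.sum (z := z) (range (n + 1)) fun k _ =>
    (((hasBorelSum_pow z 1 k).intCast_mul (α k)).add
      ((hasBorelSum_pow z 0 k).intCast_mul (β k))).add
      ((hasBorelSum_pow z (-1) k).intCast_mul (γ k))
  rw [← hs] at hsum
  simp only [one_mul, zero_mul, neg_one_mul, hexp, hexp', Complex.exp_zero, mul_one] at hsum
  let ii : GaussianInt := ⟨0, 1⟩
  have hii : (ii : ℂ) = Complex.I := by simp [ii, GaussianInt.toComplex_def]
  let u : ℕ → GaussianInt := fun k => ii ^ k * (α k * ii + β k - γ k * ii)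
  have hu : ∀ k, (u k : ℂ) = Complex.I ^ k * (α k * Complex.I + β k - γ k * Complex.I) := by
    intro k
    simp only [u, map_mul, map_pow, map_sub, map_add, map_intCast, hii]
  have hval : (∑ k ∈ range (n + 1), (α k * (z ^ k / k.factorial * Complex.I) +
      β k * (z ^ k / k.factorial) + γ k * (z ^ k / k.factorial * -Complex.I)) : ℂ) =
      ∑ k ∈ range (n + 1), (u k : ℂ) * ((π / 2 : ℝ) : ℂ) ^ k / k.factorial := by
    refine sum_congr rfl fun k _ => ?_
    rw [hu, hz, mul_pow]
    ring
  rw [hval] at hsum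
  set P := ∑ k ∈ range (n + 1), (u k : ℂ) * ((π / 2 : ℝ) : ℂ) ^ k / k.factorial
  have hrem : HasBorelSum z (PowerSeries.X ^ (3 * n + 3) * PowerSeries.expand 2 two_ne_zero
      (PowerSeries.mk fun m => ((n + m).choose n : ℂ))) (P / 8 ^ (n + 1)) := by
    have h := HasSum.mul_left ((8 : ℂ) ^ (n + 1))⁻¹ hsum
    rw [HasBorelSum, div_eq_inv_mul]
    refine h.congr_fun fun m => ?_
    rw [show (2 : PowerSeries ℂ) ^ (3 * n + 2 + 1) = PowerSeries.C (8 ^ (n + 1)) by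
      rw [map_pow, show 3 * n + 2 + 1 = 3 * (n + 1) by ring, pow_mul]
      congr 1
      rw [show (8 : ℂ) = 2 ^ 3 by norm_num, map_pow]; rfl, PowerSeries.coeff_C_mul, mul_assoc,
      inv_mul_cancel_left₀ (pow_ne_zero _ (by norm_num))]
  refine ⟨u, fun k => ?_, hrem⟩
  have h4 : (4 : ℝ) ^ (3 * n + 2 + 1) = 64 ^ (n + 1) := by
    rw [show 3 * n + 2 + 1 = 3 * (n + 1) by ring, pow_mul]; norm_num
  have hc : ∀ c : ℤ, |c| ≤ 4 ^ (3 * n + 2 + 1) → ‖(c : ℂ)‖ ≤ 64 ^ (n + 1) := by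
    intro c hc
    rw [Complex.norm_intCast, ← h4]
    exact_mod_cast hc
  rw [hu, norm_mul, norm_pow, Complex.norm_I, one_pow, one_mul]
  refine (norm_sub_le _ _).trans ?_
  have h1 := norm_add_le (α k * Complex.I : ℂ) (β k)
  rw [norm_mul, Complex.norm_I, mul_one] at h1 ⊢
  linarith [hc _ (hb k).1, hc _ (hb k).2.1, hc _ (hb k).2.2]

/-- Small values at `π / 2` of polynomials with Gaussian integer coefficients (up to factorials),
obtained from the Hermite–Padé approximation to `1`, `exp z`, `exp (-z)` at `z = π / 2 * I`. -/
theorem exists_gaussianInt_forms (n : ℕ) : ∃ u : ℕ → GaussianInt,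
    (∀ k, ‖(u k : ℂ)‖ ≤ 3 * 64 ^ (n + 1)) ∧
    1 / ((3 * n + 2).factorial : ℝ) ≤
      ‖∑ k ∈ range (n + 1), (u k : ℂ) * ((π / 2 : ℝ) : ℂ) ^ k / k.factorial‖ ∧
    ‖∑ k ∈ range (n + 1), (u k : ℂ) * ((π / 2 : ℝ) : ℂ) ^ k / k.factorial‖ ≤
      64 ^ (n + 1) / ((3 * n + 2).factorial : ℝ) := by
  obtain ⟨u, hu, hrem⟩ := exists_gaussianInt_hasBorelSum n
  refine ⟨u, hu, ?_⟩
  generalize ∑ k ∈ range (n + 1), (u k : ℂ) * ((π / 2 : ℝ) : ℂ) ^ k / k.factorial = P at *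
  set z : ℂ := (π / 2 : ℝ) * Complex.I with hz
  have hnz : ‖z‖ = π / 2 := by
    rw [hz, norm_mul, Complex.norm_I, mul_one, Complex.norm_real,
      Real.norm_of_nonneg (by positivity)]
  have hest := norm_remainder_sub_le (by rw [hnz]; nlinarith [Real.pi_lt_d2, Real.pi_gt_three])
    (hasBorelSum_remainder hrem)
  generalize hwz : z ^ (3 * n + 2) / ((3 * n + 2).factorial : ℂ) = w at hest
  have hw : ‖w‖ = (π / 2) ^ (3 * n + 2) / (3 * n + 2).factorial := by
    simp only [← hwz, norm_div, norm_pow, hnz, Complex.norm_natCast]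
  rw [hnz, ← hw] at hest
  have hP : ‖P / 8 ^ (n + 1)‖ = ‖P‖ / 8 ^ (n + 1) := by simp
  have h8 : (1 : ℝ) ≤ 8 ^ n := one_le_pow₀ (by norm_num)
  have h80 : (0 : ℝ) < 8 ^ (n + 1) := by positivity
  have hlow : ‖w‖ / 2 ≤ ‖P‖ / 8 ^ (n + 1) := by
    have := norm_sub_norm_le w (P / 8 ^ (n + 1))
    rw [norm_sub_rev, hP] at this
    linarith
  have hupp : ‖P‖ / 8 ^ (n + 1) ≤ 2 * ‖w‖ := by
    have := norm_sub_norm_le (P / 8 ^ (n + 1)) w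
    rw [hP] at this
    linarith [norm_nonneg w]
  rw [le_div_iff₀ h80] at hlow
  rw [div_le_iff₀ h80] at hupp
  refine ⟨le_trans ?_ hlow, hupp.trans ?_⟩
  · rw [hw]
    have h1 : (1 : ℝ) ≤ (π / 2) ^ (3 * n + 2) := one_le_pow₀ (by linarith [Real.pi_gt_three])
    rw [div_div, div_mul_eq_mul_div, div_le_div_iff₀ (by positivity) (by positivity),
      pow_succ (8 : ℝ) n]
    have : (0 : ℝ) < (3 * n + 2).factorial := by positivity
    have h2 : (2 : ℝ) ≤ (π / 2) ^ (3 * n + 2) * (8 ^ n * 8) := by nlinarith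
    nlinarith
  · rw [hw, ← mul_div_assoc, div_mul_eq_mul_div]
    have h1 : (π / 2) ^ (3 * n + 2) ≤ 2 ^ (3 * n + 2) :=
      pow_le_pow_left₀ (by positivity) (by linarith [Real.pi_lt_d2]) _
    have h2 : (2 : ℝ) * 2 ^ (3 * n + 2) * 8 ^ (n + 1) = 64 ^ (n + 1) := by
      rw [← pow_succ', show 3 * n + 2 + 1 = 3 * (n + 1) by ring, pow_mul, ← mul_pow]; norm_num
    rw [← h2]
    gcongr

theorem exists_gaussianInt_eq_mul_sum (u : ℕ → GaussianInt) (n : ℕ) (a : ℤ) {b : ℕ} (hb : 0 < b) :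
    ∃ g : GaussianInt, (n.factorial * b ^ n : ℂ) *
      ∑ k ∈ range (n + 1), (u k : ℂ) * ((a / b : ℝ) : ℂ) ^ k / k.factorial = g := by
  refine ⟨∑ k ∈ range (n + 1), u k * a ^ k * b ^ (n - k) * (n.factorial / k.factorial : ℕ), ?_⟩
  rw [mul_sum, map_sum]
  refine sum_congr rfl fun k hk => ?_
  have hkn : k ≤ n := Nat.lt_succ_iff.1 (mem_range.1 hk)
  have hb' : (b : ℂ) ≠ 0 := by exact_mod_cast hb.ne'
  simp only [map_mul, map_pow, map_intCast, map_natCast]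
  rw [Nat.cast_div (Nat.factorial_dvd_factorial hkn) (by exact_mod_cast k.factorial_ne_zero)]
  push_cast
  rw [div_pow, ← Nat.sub_add_cancel hkn, pow_add (b : ℂ) (n - k) k, Nat.sub_add_cancel hkn]
  field_simp

theorem GaussianInt.one_le_norm {g : GaussianInt} (hg : (g : ℂ) ≠ 0) : 1 ≤ ‖(g : ℂ)‖ := by
  have h : 0 < g.norm := GaussianInt.norm_pos.2 fun h => hg (by simp [h])
  have h1 : (1 : ℝ) ≤ (g.norm : ℝ) := by exact_mod_cast h
  rw [GaussianInt.intCast_real_norm, Complex.normSq_eq_norm_sq] at h1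
  nlinarith [_root_.norm_nonneg (g : ℂ)]

theorem norm_sum_mul_pow_sub_le {u : ℕ → ℂ} {n : ℕ} {x y U : ℝ} (hu : ∀ k, ‖u k‖ ≤ U)
    (hx : |x| ≤ 2) (hy : |y| ≤ 2) :
    ‖∑ k ∈ range (n + 1), u k * (x : ℂ) ^ k / k.factorial -
      ∑ k ∈ range (n + 1), u k * (y : ℂ) ^ k / k.factorial‖ ≤ U * 8 ^ (n + 1) * |x - y| := by
  have hU : 0 ≤ U := (norm_nonneg _).trans (hu 0)
  rw [← sum_sub_distrib]
  have hterm : ∀ k ∈ range (n + 1), ‖u k * (x : ℂ) ^ k / k.factorial -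
      u k * (y : ℂ) ^ k / k.factorial‖ ≤ U * 4 ^ (n + 1) * |x - y| := by
    intro k hk
    rw [← sub_div, ← mul_sub, norm_div, norm_mul, Complex.norm_natCast]
    have h1 : ‖(x : ℂ) ^ k - (y : ℂ) ^ k‖ ≤ |x - y| * 4 ^ (n + 1) := by
      rw [← Complex.ofReal_pow, ← Complex.ofReal_pow, ← Complex.ofReal_sub, Complex.norm_real,
        Real.norm_eq_abs]
      refine (abs_pow_sub_pow_le x y k).trans ?_
      rw [mul_assoc]
      gcongr
      have hk2 : (k : ℝ) ≤ 2 ^ k := by exact_mod_cast (Nat.lt_two_pow_self).le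
      have hkn : k ≤ n + 1 := (mem_range.1 hk).le
      calc (k : ℝ) * max |x| |y| ^ (k - 1) ≤ 2 ^ k * 2 ^ (k - 1) := by
            gcongr
            exact max_le hx hy
        _ ≤ 2 ^ (n + 1) * 2 ^ (n + 1) := by
            gcongr <;> first | omega | norm_num
        _ = 4 ^ (n + 1) := by rw [← mul_pow]; norm_num
    have h2 : (1 : ℝ) ≤ k.factorial := by exact_mod_cast k.factorial_pos
    refine (div_le_self (by positivity) h2).trans ?_
    calc _ ≤ U * (|x - y| * 4 ^ (n + 1)) := by gcongr; exact hu k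
      _ = _ := by ring
  refine (norm_sum_le_of_le _ hterm).trans ?_
  rw [sum_const, card_range, nsmul_eq_mul]
  have hn : ((n + 1 : ℕ) : ℝ) ≤ 2 ^ (n + 1) := by exact_mod_cast (Nat.lt_two_pow_self).le
  calc _ ≤ 2 ^ (n + 1) * (U * 4 ^ (n + 1) * |x - y|) := by gcongr
    _ = U * (2 ^ (n + 1) * 4 ^ (n + 1)) * |x - y| := by ring
    _ = _ := by rw [← mul_pow]; norm_num

/-- A bound of the form `exp (-b ^ (1 / 2 + ε))` on the distance of `π / 2` to fractions with
denominator `b`. -/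
theorem one_div_le_abs_pi_div_two_sub {n b : ℕ} (a : ℤ) (hb : 0 < b)
    (h : 128 * b ≤ (n + 1) ^ 2) :
    1 / (4096 ^ (n + 1) * ((3 * n + 2).factorial : ℝ)) ≤ |π / 2 - a / b| := by
  have hf0 : (0 : ℝ) < (3 * n + 2).factorial := by positivity
  have hf1 : (1 : ℝ) ≤ (3 * n + 2).factorial := by exact_mod_cast (Nat.factorial_pos _)
  rcases le_or_gt (1 / 4) |π / 2 - a / b| with hfar | hnear
  · refine le_trans ?_ hfar
    rw [div_le_div_iff₀ (by positivity) (by norm_num), pow_succ]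
    have : (1 : ℝ) ≤ 4096 ^ n := one_le_pow₀ (by norm_num)
    nlinarith
  have hpi := Real.pi_lt_d2
  have hpi' := Real.pi_gt_three
  have hy : |(a / b : ℝ)| ≤ 2 := by
    rw [abs_lt] at hnear
    rw [abs_le]
    constructor <;> linarith
  obtain ⟨u, hu, hlow, hupp⟩ := exists_gaussianInt_forms n
  have hlip := norm_sum_mul_pow_sub_le (n := n) hu (x := π / 2) (y := a / b)
    (by rw [abs_of_pos (by positivity)]; linarith) hy
  obtain ⟨g, hg⟩ := exists_gaussianInt_eq_mul_sum u n a hb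
  set P := ∑ k ∈ range (n + 1), (u k : ℂ) * ((π / 2 : ℝ) : ℂ) ^ k / k.factorial
  set Q := ∑ k ∈ range (n + 1), (u k : ℂ) * ((a / b : ℝ) : ℂ) ^ k / k.factorial
  suffices hmain : 1 / ((3 * n + 2).factorial : ℝ) / 2 ≤ ‖P - Q‖ by
    have h1 := hmain.trans hlip
    have h2 : (3 * 64 ^ (n + 1) * 8 ^ (n + 1) : ℝ) * 2 ≤ 4096 ^ (n + 1) := by
      rw [mul_assoc 3, ← mul_pow, show (4096 : ℝ) = 8 * 512 by norm_num, mul_pow 8]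
      have : (1 : ℝ) ≤ 8 ^ n := one_le_pow₀ (by norm_num)
      rw [pow_succ (8 : ℝ)]
      have h5 : (0 : ℝ) < 512 ^ (n + 1) := by positivity
      norm_num
      nlinarith
    rw [div_le_iff₀ (by positivity)]
    rw [div_div, div_le_iff₀ (by positivity)] at h1
    calc (1 : ℝ) ≤ _ := h1
      _ = |π / 2 - a / b| * ((3 * 64 ^ (n + 1) * 8 ^ (n + 1) * 2) * (3 * n + 2).factorial) := by
        ring
      _ ≤ _ := by gcongr
  rcases eq_or_ne Q 0 with hQ | hQ
  · rw [hQ, sub_zero]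
    refine le_trans ?_ hlow
    have : 0 < 1 / ((3 * n + 2).factorial : ℝ) := by positivity
    linarith
  have hb' : (0 : ℝ) < b := by exact_mod_cast hb
  have hg1 : 1 ≤ ‖(g : ℂ)‖ := GaussianInt.one_le_norm <| by
    rw [← hg]
    refine mul_ne_zero (mul_ne_zero ?_ (pow_ne_zero _ ?_)) hQ
    · exact_mod_cast n.factorial_ne_zero
    · exact_mod_cast hb.ne'
  rw [← hg, norm_mul, norm_mul, norm_pow, Complex.norm_natCast, Complex.norm_natCast] at hg1
  have hfac : (128 : ℝ) ^ (n + 1) * (n.factorial * b ^ n) ≤ (3 * n + 2).factorial := by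
    have h1 : n.factorial * (n + 1) ^ (2 * n + 2) ≤ (n + (2 * n + 2)).factorial :=
      Nat.factorial_mul_pow_le_factorial
    have h2 : (128 * b) ^ (n + 1) ≤ (n + 1) ^ (2 * n + 2) := by
      rw [show 2 * n + 2 = 2 * (n + 1) by ring, pow_mul]
      exact Nat.pow_le_pow_left h _
    have h3 : b ^ n ≤ b ^ (n + 1) := Nat.pow_le_pow_right hb n.le_succ
    have : 128 ^ (n + 1) * (n.factorial * b ^ n) ≤ (3 * n + 2).factorial :=
      calc _ ≤ 128 ^ (n + 1) * (n.factorial * b ^ (n + 1)) := by gcongr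
        _ = n.factorial * (128 * b) ^ (n + 1) := by ring
        _ ≤ n.factorial * (n + 1) ^ (2 * n + 2) := by gcongr
        _ ≤ _ := by rwa [show 3 * n + 2 = n + (2 * n + 2) by ring]
    exact_mod_cast this
  set d : ℝ := n.factorial * b ^ n
  have hd : 0 < d := by positivity
  have h64 : (64 : ℝ) ^ (n + 1) * 2 ≤ 128 ^ (n + 1) := by
    rw [show (128 : ℝ) = 64 * 2 by norm_num, mul_pow]
    gcongr
    exact le_self_pow₀ (by norm_num) (by simp)
  have hP : ‖P‖ ≤ 1 / (2 * d) := by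
    refine hupp.trans ?_
    rw [div_le_div_iff₀ hf0 (by positivity), one_mul]
    refine le_trans ?_ hfac
    rw [← mul_assoc]
    gcongr
  have hQ1 : 1 / d ≤ ‖Q‖ := by
    rw [div_le_iff₀ hd, mul_comm]
    exact hg1
  have hfd : 1 / ((3 * n + 2).factorial : ℝ) ≤ 1 / d := by
    refine one_div_le_one_div_of_le hd (le_trans ?_ hfac)
    exact le_mul_of_one_le_left hd.le (one_le_pow₀ (by norm_num))
  have h2 : 1 / (2 * d) = 1 / d / 2 := by rw [div_div, mul_comm]
  have := norm_sub_norm_le Q P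
  rw [norm_sub_rev] at this
  linarith

theorem eventually_mul_factorial_lt : ∀ᶠ i : ℕ in Filter.atTop, ∃ n : ℕ,
    (i : ℝ) ^ (3 / 2 : ℝ) ≤ (n + 1) ^ 2 ∧
    2 * (4096 ^ (n + 1) * ((3 * n + 2).factorial : ℝ)) < 2 ^ i := by
  have ho : (fun x : ℝ => x ^ (3 / 4 : ℝ) * ((2 * Real.log 4096 + 6 * Real.log 6) + 6 * Real.log x)
      + Real.log 2) =o[Filter.atTop] fun x => x := by
    have hc : ∀ (c r : ℝ), 0 < r → (fun _ : ℝ => c) =o[Filter.atTop] fun x : ℝ => x ^ r :=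
      fun c r hr => Asymptotics.isLittleO_const_left.2 <| Or.inr <|
        Filter.tendsto_abs_atTop_atTop.comp (tendsto_rpow_atTop hr)
    have h1 := (Asymptotics.isBigO_refl (fun x : ℝ => x ^ (3 / 4 : ℝ)) Filter.atTop).mul_isLittleO
      ((hc (2 * Real.log 4096 + 6 * Real.log 6) (1 / 4) (by norm_num)).add
        ((isLittleO_log_rpow_atTop (r := 1 / 4) (by norm_num)).const_mul_left 6))
    have h2 : (fun x : ℝ => x ^ (3 / 4 : ℝ) * x ^ (1 / 4 : ℝ)) =ᶠ[Filter.atTop] fun x => x := by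
      filter_upwards [Filter.eventually_gt_atTop 0] with x hx
      rw [← Real.rpow_add hx]
      norm_num
    refine (h1.trans_eventuallyEq h2).add ?_
    simpa using hc (Real.log 2) 1 one_pos
  have hl2 : 0 < Real.log 2 := Real.log_pos (by norm_num)
  have hev := (ho.comp_tendsto tendsto_natCast_atTop_atTop).def (half_pos hl2)
  filter_upwards [hev, Filter.eventually_ge_atTop 1] with i hi hi1
  simp only [Function.comp] at hi
  have hi1' : (1 : ℝ) ≤ i := by exact_mod_cast hi1
  rw [Real.norm_of_nonneg (by positivity : (0 : ℝ) ≤ i)] at hi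
  replace hi := (le_abs_self _).trans hi
  set t : ℝ := (i : ℝ) ^ (3 / 4 : ℝ) with ht
  have ht1 : 1 ≤ t := Real.one_le_rpow hi1' (by norm_num)
  have hti : t ≤ i := by
    calc t ≤ (i : ℝ) ^ (1 : ℝ) := Real.rpow_le_rpow_of_exponent_le hi1' (by norm_num)
      _ = i := Real.rpow_one _
  refine ⟨⌊t⌋₊, ?_, ?_⟩
  · have h1 : (i : ℝ) ^ (3 / 2 : ℝ) = t ^ 2 := by
      rw [ht, ← Real.rpow_natCast, ← Real.rpow_mul (by positivity)]
      norm_num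
    rw [h1]
    exact pow_le_pow_left₀ (by positivity) (Nat.lt_floor_add_one t).le 2
  · set n := ⌊t⌋₊
    have hn : (n : ℝ) ≤ t := Nat.floor_le (by positivity)
    have hfac : ((3 * n + 2).factorial : ℝ) ≤ (3 * (n + 1) : ℝ) ^ (3 * (n + 1)) := by
      have h1 : (3 * n + 2).factorial ≤ (3 * (n + 1)) ^ (3 * (n + 1)) :=
        (Nat.factorial_le (by omega)).trans (Nat.factorial_le_pow (3 * (n + 1)))
      exact_mod_cast h1
    rw [← Real.log_lt_log_iff (by positivity) (by positivity), Real.log_pow]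
    have hf := Real.log_le_log (by positivity) hfac
    rw [Real.log_pow] at hf
    rw [Real.log_mul (by norm_num) (by positivity), Real.log_mul (by positivity) (by positivity),
      Real.log_pow]
    have hlog : Real.log (3 * (n + 1)) ≤ Real.log 6 + Real.log i := by
      rw [← Real.log_mul (by norm_num) (by positivity)]
      exact Real.log_le_log (by positivity) (by linarith)
    push_cast at hf ⊢
    have h4096 : 0 ≤ Real.log 4096 := Real.log_nonneg (by norm_num)
    have hlog0 : 0 ≤ Real.log 6 + Real.log i :=
      add_nonneg (Real.log_nonneg (by norm_num)) (Real.log_nonneg hi1')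
    have hA : ((n : ℝ) + 1) * Real.log 4096 ≤ 2 * t * Real.log 4096 := by
      gcongr
      linarith
    have hB : 3 * ((n : ℝ) + 1) * Real.log (3 * (n + 1)) ≤
        3 * (2 * t) * (Real.log 6 + Real.log i) := by
      refine mul_le_mul (by linarith) hlog (Real.log_nonneg ?_) (by positivity)
      have : (0 : ℝ) ≤ n := n.cast_nonneg
      linarith
    nlinarith

/-- Integers that approximate a multiple of `2π` to within `8 / 2 ^ i` are large. -/
theorem eventually_le_of_abs_sub_le : ∀ᶠ i : ℕ in Filter.atTop, ∀ (m : ℕ) (k : ℤ), 0 < m →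
    |(m : ℝ) - k * (2 * π)| ≤ 8 / 2 ^ i → (i : ℝ) ^ (3 / 2 : ℝ) / 512 ≤ m := by
  filter_upwards [eventually_mul_factorial_lt, Filter.eventually_ge_atTop 4] with i hi hi4 m k hm h
  obtain ⟨n, hn, hlt⟩ := hi
  have hpi := Real.pi_gt_three
  have h16 : (16 : ℝ) ≤ 2 ^ i := by
    calc (16 : ℝ) = 2 ^ 4 := by norm_num
      _ ≤ 2 ^ i := pow_le_pow_right₀ (by norm_num) hi4
  have h8 : (8 : ℝ) / 2 ^ i ≤ 1 / 2 := by
    rw [div_le_div_iff₀ (by positivity) (by norm_num)]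
    linarith
  have hm1 : (1 : ℝ) ≤ m := by exact_mod_cast hm
  have hh := abs_le.1 (h.trans h8)
  have hk : 0 < k := by
    by_contra! hk
    have : (k : ℝ) ≤ 0 := by exact_mod_cast hk
    nlinarith
  lift k to ℕ using hk.le
  have hk' : 0 < k := by exact_mod_cast hk
  push_cast at h hh
  have hk1 : (1 : ℝ) ≤ k := by exact_mod_cast hk'
  have hkm : (k : ℝ) ≤ m := by nlinarith
  by_contra! hlt'
  have hb : 128 * (4 * k) ≤ (n + 1) ^ 2 := by
    have : (128 * (4 * k) : ℝ) ≤ (n + 1) ^ 2 := by linarith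
    exact_mod_cast this
  have hdio := one_div_le_abs_pi_div_two_sub (m : ℤ) (by omega) hb
  push_cast at hdio
  have heq : π / 2 - m / (4 * k) = -((m - k * (2 * π)) / (4 * k)) := by field_simp; ring
  rw [heq, abs_neg, abs_div, abs_of_pos (by positivity : (0 : ℝ) < 4 * k)] at hdio
  have hle : |(m : ℝ) - k * (2 * π)| / (4 * k) ≤ 2 / 2 ^ i := by
    rw [div_le_div_iff₀ (by positivity) (by positivity)]
    rw [le_div_iff₀ (by positivity)] at h
    linarith
  have := hdio.trans hle
  rw [div_le_div_iff₀ (by positivity) (by positivity)] at this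
  linarith

theorem Finset.card_le_of_pairwise_le {s : Finset ℕ} {M g : ℕ} (hg : 0 < g)
    (hs : ∀ x ∈ s, x < M) (h : ∀ x ∈ s, ∀ y ∈ s, x < y → g ≤ y - x) : #s ≤ M / g + 1 := by
  rw [← card_range (M / g + 1)]
  refine card_le_card_of_injOn (· / g) (fun x hx => ?_) fun x hx y hy hxy => ?_
  · simpa [Nat.lt_succ_iff] using Nat.div_le_div_right (hs x hx).le
  · have key : ∀ x ∈ s, ∀ y ∈ s, x / g = y / g → ¬ x < y := by
      intro x hx y hy hxy hlt
      have h1 := h x hx y hy hlt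
      have h2 : x / g + 1 ≤ y / g := by
        rw [← Nat.add_div_right x hg]
        exact Nat.div_le_div_right (by omega)
      omega
    exact le_antisymm (not_lt.1 (key y hy x hx hxy.symm)) (not_lt.1 (key x hx y hy hxy))

theorem exists_abs_sub_le_of_one_sub_sin_le {x : ℝ} {i : ℕ} (h : 1 - Real.sin x ≤ 3 / 4 ^ i) :
    ∃ k : ℤ, |x - π / 2 - k * (2 * π)| ≤ 4 / 2 ^ i := by
  have hpi := Real.pi_pos
  have hpi4 := Real.pi_lt_d2
  refine ⟨round ((x - π / 2) / (2 * π)), ?_⟩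
  set k := round ((x - π / 2) / (2 * π))
  have hround := abs_sub_round ((x - π / 2) / (2 * π))
  have heq : (x - π / 2) / (2 * π) - k = (x - π / 2 - k * (2 * π)) / (2 * π) := by field_simp
  rw [heq, abs_div, abs_of_pos (by positivity : 0 < 2 * π), div_le_iff₀ (by positivity)] at hround
  have hcos := Real.cos_le_one_sub_mul_cos_sq (x := x - π / 2 - k * (2 * π)) (by linarith)
  rw [Real.cos_sub_int_mul_two_pi, Real.cos_sub_pi_div_two] at hcos
  set d := x - π / 2 - k * (2 * π)
  have h1 : 2 / π ^ 2 * d ^ 2 ≤ 3 / 4 ^ i := by linarith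
  refine abs_le_of_sq_le_sq ?_ (by positivity)
  rw [div_pow, ← pow_mul, mul_comm i 2, pow_mul]
  norm_num
  rw [div_mul_eq_mul_div, div_le_div_iff₀ (by positivity) (by positivity)] at h1
  rw [le_div_iff₀ (by positivity)]
  nlinarith

theorem eventually_card_le : ∀ᶠ i : ℕ in Filter.atTop,
    (#{ν ∈ Ico (16 ^ i) (16 ^ (i + 1)) | 1 - Real.sin (ν : ℕ) ≤ 3 / 4 ^ i} : ℝ) ≤
      16 ^ i * (8192 / (i : ℝ) ^ (3 / 2 : ℝ)) + 1 := by
  filter_upwards [eventually_le_of_abs_sub_le, Filter.eventually_ge_atTop 1] with i hi hi1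
  have hi0 : (0 : ℝ) < i := by exact_mod_cast hi1
  set r : ℝ := (i : ℝ) ^ (3 / 2 : ℝ) / 512
  have hr : 0 < r := by positivity
  have hg : 0 < ⌈r⌉₊ := Nat.ceil_pos.2 hr
  have hcard := Finset.card_le_of_pairwise_le (M := 16 ^ (i + 1)) hg
    (s := {ν ∈ Ico (16 ^ i) (16 ^ (i + 1)) | 1 - Real.sin (ν : ℕ) ≤ 3 / 4 ^ i})
    (fun x hx => (mem_Ico.1 (mem_filter.1 hx).1).2) fun x hx y hy hxy => by
      obtain ⟨k, hk⟩ := exists_abs_sub_le_of_one_sub_sin_le (mem_filter.1 hx).2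
      obtain ⟨l, hl⟩ := exists_abs_sub_le_of_one_sub_sin_le (mem_filter.1 hy).2
      refine Nat.ceil_le.2 (hi (y - x) (l - k) (by omega) ?_)
      have := abs_sub ((y : ℝ) - π / 2 - l * (2 * π)) (x - π / 2 - k * (2 * π))
      rw [Nat.cast_sub hxy.le]
      push_cast
      rw [show (y : ℝ) - x - (l - k) * (2 * π) =
        (y - π / 2 - l * (2 * π)) - (x - π / 2 - k * (2 * π)) by ring]
      calc _ ≤ _ := this
        _ ≤ 4 / 2 ^ i + 4 / 2 ^ i := add_le_add hl hk
        _ = 8 / 2 ^ i := by ring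
  calc _ ≤ ((16 ^ (i + 1) / ⌈r⌉₊ + 1 : ℕ) : ℝ) := by exact_mod_cast hcard
    _ ≤ 16 ^ (i + 1) / r + 1 := by
      push_cast
      gcongr
      refine Nat.cast_div_le.trans ?_
      push_cast
      gcongr
      exact Nat.le_ceil r
    _ = _ := by
      simp only [r]
      rw [pow_succ]
      field_simp
      ring

theorem summable_of_eventually_sum_Ico_pow_le {f B : ℕ → ℝ} (hf : ∀ n, 0 ≤ f n) (hB : Summable B)
    {a : ℕ} (ha : 1 < a)
    (h : ∀ᶠ i in Filter.atTop, ∑ n ∈ Ico (a ^ i) (a ^ (i + 1)), f n ≤ B i) : Summable f := by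
  have hF : Summable fun i => ∑ n ∈ Ico (a ^ i) (a ^ (i + 1)), f n := by
    refine Summable.of_norm_bounded_eventually_nat hB ?_
    filter_upwards [h] with i hi
    rwa [Real.norm_of_nonneg (sum_nonneg fun n _ => hf n)]
  refine summable_of_sum_range_le hf
    (c := ∑ n ∈ range 1, f n + ∑' i, ∑ n ∈ Ico (a ^ i) (a ^ (i + 1)), f n) fun N => ?_
  have hpow : ∀ N, ∑ n ∈ range (a ^ N), f n =
      ∑ n ∈ range 1, f n + ∑ i ∈ range N, ∑ n ∈ Ico (a ^ i) (a ^ (i + 1)), f n := by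
    intro N
    induction N with
    | zero => simp
    | succ N ih =>
      rw [sum_range_succ _ N, ← add_assoc, ← ih, sum_range_add_sum_Ico _
        (Nat.pow_le_pow_right (by omega) N.le_succ)]
  calc ∑ n ∈ range N, f n ≤ ∑ n ∈ range (a ^ N), f n :=
        sum_le_sum_of_subset_of_nonneg (range_mono (Nat.lt_pow_self ha).le) fun n _ _ => hf n
    _ ≤ _ := by
      rw [hpow]
      gcongr
      exact hF.sum_le_tsum _ fun i _ => sum_nonneg fun n _ => hf n

theorem summable_one_div_mul_sin_pow :
    Summable fun n : ℕ => (1 / (n : ℝ)) * ((2 + Real.sin n) / 3) ^ n := by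
  have hbase : ∀ x : ℝ, 0 ≤ (2 + Real.sin x) / 3 ∧ (2 + Real.sin x) / 3 ≤ 1 := fun x =>
    ⟨by linarith [Real.neg_one_le_sin x], by linarith [Real.sin_le_one x]⟩
  refine summable_of_eventually_sum_Ico_pow_le (a := 16) (B := fun i : ℕ =>
    (8192 / (i : ℝ) ^ (3 / 2 : ℝ) + (1 / 16) ^ i) + 16 * Real.exp (-i))
    (fun n => mul_nonneg (by positivity) (pow_nonneg (hbase n).1 n)) ?_ (by norm_num) ?_
  · refine ((?_ : Summable _).add (summable_geometric_of_lt_one (by norm_num) (by norm_num))).add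
      (Real.summable_exp_neg_nat.mul_left 16)
    simpa [div_eq_mul_inv] using
      (Real.summable_nat_rpow_inv.2 (by norm_num : (1 : ℝ) < 3 / 2)).mul_left 8192
  filter_upwards [eventually_card_le] with i hi
  have h16 : (0 : ℝ) < 16 ^ i := by positivity
  rw [← sum_filter_add_sum_filter_not _ (fun ν : ℕ => 1 - Real.sin ν ≤ 3 / 4 ^ i)]
  have hinv : ∀ n ∈ Ico ((16 : ℕ) ^ i) (16 ^ (i + 1)), 1 / (n : ℝ) ≤ 1 / 16 ^ i := by
    intro n hn
    refine one_div_le_one_div_of_le h16 ?_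
    exact_mod_cast (mem_Ico.1 hn).1
  refine add_le_add ?_ ?_
  · refine (sum_le_card_nsmul _ _ (1 / 16 ^ i) fun n hn => ?_).trans ?_
    · rw [← mul_one (1 / (16 : ℝ) ^ i)]
      exact mul_le_mul (hinv n (mem_filter.1 hn).1) (pow_le_one₀ (hbase n).1 (hbase n).2)
        (pow_nonneg (hbase n).1 n) (by positivity)
    · rw [nsmul_eq_mul, mul_one_div, div_le_iff₀ h16]
      refine hi.trans (le_of_eq ?_)
      rw [add_mul, ← mul_pow]
      norm_num
      ring
  · refine (sum_le_card_nsmul _ _ (1 / 16 ^ i * Real.exp (-i)) fun n hn => ?_).trans ?_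
    · obtain ⟨hn, hsin⟩ := mem_filter.1 hn
      rw [not_le] at hsin
      refine mul_le_mul (hinv n hn) ?_ (pow_nonneg (hbase n).1 n) (by positivity)
      have h1 : (2 + Real.sin n) / 3 ≤ Real.exp (-(1 / 4 ^ i)) := by
        refine le_trans ?_ (Real.one_sub_le_exp_neg _)
        have : (3 : ℝ) / 4 ^ i = 3 * (1 / 4 ^ i) := by ring
        linarith
      refine (pow_le_pow_left₀ (hbase n).1 h1 n).trans ?_
      rw [← Real.exp_nat_mul]
      refine Real.exp_le_exp.2 ?_
      have hn16 : (16 : ℝ) ^ i ≤ n := by exact_mod_cast (mem_Ico.1 hn).1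
      have hi4 : (i : ℝ) ≤ 4 ^ i := by exact_mod_cast (Nat.lt_pow_self (by norm_num)).le
      have h2 : (4 : ℝ) ^ i ≤ n * (1 / 4 ^ i) := by
        rw [mul_one_div, le_div_iff₀ (by positivity), ← mul_pow]
        norm_num
        exact hn16
      linarith
    · have hc : (#{ν ∈ Ico (16 ^ i) (16 ^ (i + 1)) | ¬ 1 - Real.sin (ν : ℕ) ≤ 3 / 4 ^ i} : ℝ) ≤
          16 * 16 ^ i := by
        have h1 := card_filter_le (Ico (16 ^ i) (16 ^ (i + 1)))
          (fun ν : ℕ => ¬ 1 - Real.sin (ν : ℕ) ≤ 3 / 4 ^ i)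
        rw [Nat.card_Ico] at h1
        have h2 : #{ν ∈ Ico (16 ^ i) (16 ^ (i + 1)) | ¬ 1 - Real.sin (ν : ℕ) ≤ 3 / 4 ^ i} ≤
            16 * 16 ^ i := h1.trans ((Nat.sub_le _ _).trans (by rw [pow_succ, mul_comm]))
        exact_mod_cast h2
      rw [nsmul_eq_mul]
      calc _ ≤ (16 * 16 ^ i) * (1 / 16 ^ i * Real.exp (-i)) := by gcongr
        _ = _ := by field_simp

theorem intervalIntegrable_log_one_sub_sin (a b : ℝ) :
    IntervalIntegrable (fun θ => Real.log (1 - (2 + Real.sin θ) / 3)) MeasureTheory.volume a b := by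
  refine MeromorphicOn.intervalIntegrable_log (f := fun θ => 1 - (2 + Real.sin θ) / 3) fun x _ => ?_
  refine AnalyticAt.meromorphicAt ?_
  fun_prop

theorem sum_pow_div_le_neg_log {x : ℝ} (h0 : 0 ≤ x) (h1 : x < 1) (N : ℕ) :
    ∑ n ∈ range N, x ^ (n + 1) / (n + 1) ≤ -Real.log (1 - x) := by
  have h := Real.hasSum_pow_div_log_of_abs_lt_one (by rwa [abs_of_nonneg h0])
  exact sum_le_hasSum _ (fun n _ => by positivity) h

theorem summable_Iavg_div : Summable (fun n : ℕ => Iavg (n + 1) / (n + 1)) := by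
  have hpi := Real.pi_pos
  have hbase : ∀ x : ℝ, 0 ≤ (2 + Real.sin x) / 3 := fun x => by linarith [Real.neg_one_le_sin x]
  have hshift : ∀ n, Iavg n =
      1 / (2 * π) * ∫ θ in (π / 2)..(π / 2 + 2 * π), ((2 + Real.sin θ) / 3) ^ n := by
    intro n
    have hp : Function.Periodic (fun θ : ℝ => ((2 + Real.sin θ) / 3) ^ n) (2 * π) := fun θ => by
      simp only [Real.sin_add_two_pi]
    rw [Iavg, ← hp.intervalIntegral_add_eq 0 (π / 2), zero_add]
  have hint : ∀ n : ℕ, IntervalIntegrable (fun θ : ℝ => ((2 + Real.sin θ) / 3) ^ n)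
      MeasureTheory.volume (π / 2) (π / 2 + 2 * π) :=
    fun n => Continuous.intervalIntegrable (by fun_prop) _ _
  refine summable_of_sum_range_le (c := 1 / (2 * π) *
    ∫ θ in (π / 2)..(π / 2 + 2 * π), -Real.log (1 - (2 + Real.sin θ) / 3)) (fun n => ?_) fun N => ?_
  · rw [hshift]
    refine div_nonneg (mul_nonneg (by positivity) ?_) (by positivity)
    exact intervalIntegral.integral_nonneg (by linarith) fun θ _ => pow_nonneg (hbase θ) _
  have hsum : ∑ n ∈ range N, Iavg (n + 1) / (n + 1) = 1 / (2 * π) *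
      ∫ θ in (π / 2)..(π / 2 + 2 * π),
        ∑ n ∈ range N, ((2 + Real.sin θ) / 3) ^ (n + 1) / ((n : ℝ) + 1) := by
    rw [intervalIntegral.integral_finsetSum fun n _ => (hint (n + 1)).div_const _, mul_sum]
    refine sum_congr rfl fun n _ => ?_
    rw [hshift, intervalIntegral.integral_div, mul_div_assoc]
  rw [hsum]
  refine mul_le_mul_of_nonneg_left ?_ (by positivity)
  refine intervalIntegral.integral_mono_on_of_le_Ioo (by linarith)
    (Continuous.intervalIntegrable (by fun_prop) _ _)
    (intervalIntegrable_log_one_sub_sin _ _).neg fun θ hθ => ?_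
  refine sum_pow_div_le_neg_log (hbase θ) ?_ N
  have hcos : Real.cos (θ - π / 2) ≠ 1 := fun h => by
    rw [Real.cos_eq_one_iff_of_lt_of_lt (by linarith [hθ.1]) (by linarith [hθ.2])] at h
    linarith [hθ.1]
  rw [Real.cos_sub_pi_div_two] at hcos
  linarith [lt_of_le_of_ne (Real.sin_le_one θ) hcos]

end

/-- Weyl decomposition `S = M + R`: the averaging series
`M = ∑_{n≥1} I_n/n` converges, the remainder series
`R = ∑_{n≥1} (1/n)·[((2 + sin n)/3)^n − I_n]` converges, and
`∑_{n≥1} (1/n)·((2 + sin n)/3)^n = M + R`. -/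
theorem weyl_decomposition :
    Summable (fun n : ℕ => Iavg (n + 1) / (n + 1)) ∧
    Summable (fun n : ℕ =>
      (1 / (n + 1 : ℝ)) * (((2 + Real.sin (n + 1)) / 3) ^ (n + 1) - Iavg (n + 1))) ∧
    (∑' n : ℕ, (1 / (n + 1 : ℝ)) * ((2 + Real.sin (n + 1)) / 3) ^ (n + 1)) =
      (∑' n : ℕ, Iavg (n + 1) / (n + 1)) +
      (∑' n : ℕ,
        (1 / (n + 1 : ℝ)) * (((2 + Real.sin (n + 1)) / 3) ^ (n + 1) - Iavg (n + 1))) := by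
  have hS : Summable fun n : ℕ =>
      (1 / (n + 1 : ℝ)) * ((2 + Real.sin (n + 1)) / 3) ^ (n + 1) := by
    simpa using (summable_nat_add_iff 1).2 summable_one_div_mul_sin_pow
  have heq : (fun n : ℕ =>
      (1 / (n + 1 : ℝ)) * (((2 + Real.sin (n + 1)) / 3) ^ (n + 1) - Iavg (n + 1))) =
      fun n : ℕ => (1 / (n + 1 : ℝ)) * ((2 + Real.sin (n + 1)) / 3) ^ (n + 1) -
        Iavg (n + 1) / (n + 1) := by
    funext n
    ring
  have hR := hS.sub summable_Iavg_div
  rw [← heq] at hR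
  refine ⟨summable_Iavg_div, hR, ?_⟩
  rw [← summable_Iavg_div.tsum_add hR]
  refine tsum_congr fun n => ?_
  ring
end
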